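/- For every fixed δ > 0 there exists a constant A > 0 such that the Lebesgue measure of the set H_δ(T) = { t : T ≤ t ≤ 2T, |S(t)| ≥ (log log T)^{1/2+δ} } satisfies μ(H_δ(T)) ≪ T exp(−A (log log T)^δ). In particular, if δ > 1, then for any fixed C₁ > 0 one has μ(H_δ(T)) ≪ T (log T)^{−C₁}. -/

import Mathlib

open Complex Real MeasureTheory Set Filter

noncomputable section

/-- The multiplicity of `ρ` as a zero of the Riemann zeta function
(the order of vanishing, i.e. the least `n` with `ζ⁽ⁿ⁾(ρ) ≠ 0`). -/
def zetaMult (ρ : ℂ) : ℕ := sInf {n : ℕ | iteratedDeriv n riemannZeta ρ ≠ 0}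

/-- `ρ` is a nontrivial zero of the Riemann zeta function. -/
def IsNontrivialZero (ρ : ℂ) : Prop := riemannZeta ρ = 0 ∧ 0 < ρ.re ∧ ρ.re < 1

/-- `S` is the function `S(T) = (1/π) arg ζ(1/2 + iT)`, where the argument is obtained by
continuous variation along the straight segments joining `2`, `2 + iT`, `1/2 + iT`, starting
with the value `0` at `2`; if `T` is an ordinate of a zero then `S(T) = S(T+0)`
(right-continuity). -/
def IsS (S : ℝ → ℝ) : Prop :=
  (∀ T : ℝ, 0 < T →
    (∀ σ : ℝ, 1/2 ≤ σ → σ ≤ 2 → riemannZeta (σ + T * I) ≠ 0) →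
    ∃ θ : ℝ → ℂ, ContinuousOn θ (Icc 0 2) ∧
      θ 0 = Complex.log (riemannZeta 2) ∧
      (∀ u ∈ Icc (0:ℝ) 1, Complex.exp (θ u) = riemannZeta (2 + u * T * I)) ∧
      (∀ u ∈ Icc (1:ℝ) 2, Complex.exp (θ u) = riemannZeta (2 - 3/2 * (u - 1) + T * I)) ∧
      S T = (θ 2).im / π) ∧
  (∀ T : ℝ, 0 < T → Tendsto S (nhdsWithin T (Ioi T)) (nhds (S T)))

/-- The logarithm of the norm of an analytic function satisfies the sub-mean value property. -/
theorem log_norm_le_circleAverage {f : ℂ → ℂ} {c : ℂ} {r : ℝ} (hr : 0 < r)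
    (hf : AnalyticOnNhd ℂ f (Metric.closedBall c r)) (hc : f c ≠ 0) :
    Real.log ‖f c‖ ≤ circleAverage (fun z => Real.log ‖f z‖) c r := by
  have hf' : AnalyticOnNhd ℂ f (Metric.closedBall c |r|) := by rwa [abs_of_pos hr]
  rw [hf'.circleAverage_log_norm hr.ne' hc]
  refine le_add_of_nonneg_left (finsum_nonneg fun u => ?_)
  by_cases hu : u ∈ Metric.closedBall c |r|
  · refine mul_nonneg ?_ ?_
    · exact_mod_cast MeromorphicOn.AnalyticOnNhd.divisor_nonneg hf' u
    · rcases eq_or_ne u c with rfl | hne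
      · simp
      · apply Real.log_nonneg
        have h1 : 0 < ‖c - u‖ := norm_pos_iff.2 (sub_ne_zero.2 hne.symm)
        rw [← div_eq_mul_inv, le_div_iff₀ h1, one_mul, ← dist_eq_norm, dist_comm]
        rw [abs_of_pos hr] at hu
        exact hu
  · simp [Function.locallyFinsuppWithin.apply_eq_zero_of_notMem _ hu]

/-- `‖f‖ ^ p` satisfies the sub-mean value property on circles. -/
theorem norm_rpow_le_circleAverage {f : ℂ → ℂ} {c : ℂ} {r p : ℝ} (hr : 0 < r) (hp : 0 < p)
    (hf : AnalyticOnNhd ℂ f (Metric.closedBall c r)) :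
    ‖f c‖ ^ p ≤ circleAverage (fun z => ‖f z‖ ^ p) c r := by
  have hcont : ContinuousOn (fun z => ‖f z‖ ^ p) (Metric.sphere c |r|) := by
    rw [abs_of_pos hr]
    exact ((hf.continuousOn.mono Metric.sphere_subset_closedBall).norm).rpow_const
      fun _ _ => Or.inr hp.le
  have hinteg : CircleIntegrable (fun z => ‖f z‖ ^ p) c r := hcont.circleIntegrable'
  by_cases hc : f c = 0
  · rw [hc, norm_zero, Real.zero_rpow hp.ne']
    rw [circleAverage_def]
    refine smul_nonneg (by positivity) (intervalIntegral.integral_nonneg (by positivity) ?_)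
    intro _ _
    positivity
  -- rescale so that the value at the centre is large
  set a : ℝ := Real.exp p⁻¹ / ‖f c‖ with ha
  have hc' : 0 < ‖f c‖ := norm_pos_iff.2 hc
  have hapos : 0 < a := by positivity
  have hg : AnalyticOnNhd ℂ (fun z => (a : ℂ) * f z) (Metric.closedBall c r) :=
    analyticOnNhd_const.mul hf
  have key := log_norm_le_circleAverage hr hg (by simp [hc, hapos.ne'])
  have hm : ‖(a : ℂ) * f c‖ = Real.exp p⁻¹ := by
    rw [norm_mul, Complex.norm_real, Real.norm_of_nonneg hapos.le, ha]
    field_simp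
  rw [hm, Real.log_exp] at key
  have hlogint : CircleIntegrable (fun z => Real.log ‖(a : ℂ) * f z‖) c r := by
    apply MeromorphicOn.circleIntegrable_log_norm
    rw [abs_of_pos hr]
    exact (hg.mono Metric.sphere_subset_closedBall).meromorphicOn
  have hpt : ∀ z ∈ Metric.sphere c |r|,
      (Real.exp 1 * p * a ^ (-p)) * Real.log ‖(a : ℂ) * f z‖ ≤ ‖f z‖ ^ p := by
    intro z _
    rcases eq_or_ne (f z) 0 with h0 | h0
    · simp [h0, Real.zero_rpow hp.ne']
    · have hz : 0 < ‖f z‖ := norm_pos_iff.2 h0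
      have h1 : Real.exp 1 * (p * Real.log (a * ‖f z‖)) ≤ (a * ‖f z‖) ^ p := by
        rw [Real.rpow_def_of_pos (by positivity)]
        have := Real.add_one_le_exp (Real.log (a * ‖f z‖) * p - 1)
        have h2 : Real.exp (Real.log (a * ‖f z‖) * p) =
            Real.exp 1 * Real.exp (Real.log (a * ‖f z‖) * p - 1) := by
          rw [← Real.exp_add]; ring_nf
        rw [h2]
        gcongr
        linarith
      rw [Real.mul_rpow hapos.le hz.le] at h1
      rw [norm_mul, Complex.norm_real, Real.norm_of_nonneg hapos.le, Real.rpow_neg hapos.le]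
      have h3 : 0 < a ^ p := by positivity
      calc _ = (a ^ p)⁻¹ * (Real.exp 1 * (p * Real.log (a * ‖f z‖))) := by ring
        _ ≤ (a ^ p)⁻¹ * (a ^ p * ‖f z‖ ^ p) := by gcongr
        _ = _ := by field_simp
  have havg := circleAverage_mono (f₁ := fun z => (Real.exp 1 * p * a ^ (-p)) *
    Real.log ‖(a : ℂ) * f z‖) (by exact hlogint.const_fun_smul) hinteg hpt
  refine le_trans ?_ havg
  have hsm : circleAverage (fun z => (Real.exp 1 * p * a ^ (-p)) *
      Real.log ‖(a : ℂ) * f z‖) c r = (Real.exp 1 * p * a ^ (-p)) *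
      circleAverage (fun z => Real.log ‖(a : ℂ) * f z‖) c r := by
    simpa using circleAverage_fun_smul (a := Real.exp 1 * p * a ^ (-p))
      (f := fun z => Real.log ‖(a : ℂ) * f z‖) (c := c) (R := r)
  rw [hsm]
  calc ‖f c‖ ^ p = (Real.exp 1 * p * a ^ (-p)) * p⁻¹ := by
        rw [Real.rpow_neg hapos.le, ha, Real.div_rpow (by positivity) (by positivity),
          ← Real.exp_mul]
        field_simp
    _ ≤ _ := by gcongr

theorem line_re (x y : ℝ) : ((x : ℂ) + (y : ℂ) * I).re = x := by simp

theorem line_im (x y : ℝ) : ((x : ℂ) + (y : ℂ) * I).im = y := by simp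

/-- A continuous function on an interval with the sub-mean property along projected circles is
bounded by its boundary values. -/
theorem le_max_of_projected_submean {ψ : ℝ → ℝ} {a b M : ℝ} (hab : a < b)
    (hψ : ContinuousOn ψ (Icc a b)) (ha : ψ a ≤ M) (hb : ψ b ≤ M)
    (hsub : ∀ σ r : ℝ, 0 < r → a ≤ σ - r → σ + r ≤ b →
      2 * π * ψ σ ≤ ∫ θ in (0:ℝ)..2 * π, ψ (σ + r * Real.cos θ)) :
    ∀ σ ∈ Icc a b, ψ σ ≤ M := by
  have key : ∀ ε : ℝ, 0 < ε → ∀ σ ∈ Icc a b, ψ σ + ε * σ ^ 2 ≤ M + ε * (a ^ 2 + b ^ 2) := by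
    intro ε hε
    have hcont : ContinuousOn (fun σ => ψ σ + ε * σ ^ 2) (Icc a b) := by fun_prop
    obtain ⟨σ₀, hσ₀, hmax⟩ := isCompact_Icc.exists_isMaxOn (nonempty_Icc.2 hab.le) hcont
    intro σ hσ
    refine (hmax hσ).trans ?_
    rcases eq_or_lt_of_le hσ₀.1 with h | h1
    · simp only [← h]; nlinarith [sq_nonneg b]
    rcases eq_or_lt_of_le hσ₀.2 with h | h2
    · simp only [h]; nlinarith [sq_nonneg a]
    exfalso
    set r := min (σ₀ - a) (b - σ₀) with hr
    have hr0 : 0 < r := lt_min (by linarith) (by linarith)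
    have hra : r ≤ σ₀ - a := min_le_left _ _
    have hrb : r ≤ b - σ₀ := min_le_right _ _
    have hs := hsub σ₀ r hr0 (by linarith) (by linarith)
    have hmem : ∀ θ : ℝ, σ₀ + r * Real.cos θ ∈ Icc a b := fun θ => by
      constructor <;> nlinarith [Real.cos_le_one θ, Real.neg_one_le_cos θ]
    have hpt : ∀ θ : ℝ, ψ (σ₀ + r * Real.cos θ) ≤
        ψ σ₀ - ε * (2 * σ₀ * r * Real.cos θ + r ^ 2 * Real.cos θ ^ 2) := by
      intro θ
      have := hmax (hmem θ)
      simp only [mem_ofPred_eq] at this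
      nlinarith
    have hc1 : Continuous fun θ : ℝ => ψ (σ₀ + r * Real.cos θ) :=
      hψ.comp_continuous (by fun_prop) hmem
    have hinteg : ∫ θ in (0:ℝ)..2 * π, ψ (σ₀ + r * Real.cos θ) ≤
        ∫ θ in (0:ℝ)..2 * π,
          (ψ σ₀ - ε * (2 * σ₀ * r * Real.cos θ + r ^ 2 * Real.cos θ ^ 2)) := by
      refine intervalIntegral.integral_mono_on (by positivity) (hc1.intervalIntegrable _ _)
        (Continuous.intervalIntegrable (by fun_prop) _ _) fun θ _ => hpt θ
    have hval : ∫ θ in (0:ℝ)..2 * π,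
        (ψ σ₀ - ε * (2 * σ₀ * r * Real.cos θ + r ^ 2 * Real.cos θ ^ 2)) =
        2 * π * ψ σ₀ - ε * (r ^ 2 * π) := by
      rw [intervalIntegral.integral_sub (by simp) (Continuous.intervalIntegrable (by fun_prop) _ _),
        intervalIntegral.integral_const_mul,
        intervalIntegral.integral_add (Continuous.intervalIntegrable (by fun_prop) _ _)
          (Continuous.intervalIntegrable (by fun_prop) _ _),
        intervalIntegral.integral_const_mul, intervalIntegral.integral_const_mul,
        integral_cos, integral_cos_sq]
      simp
    have : 0 < ε * (r ^ 2 * π) := by positivity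
    linarith
  intro σ hσ
  refine le_of_forall_pos_le_add fun ε hε => ?_
  have h := key (ε / (a ^ 2 + b ^ 2 + 1)) (by positivity) σ hσ
  have h2 : ε / (a ^ 2 + b ^ 2 + 1) * (a ^ 2 + b ^ 2) ≤ ε := by
    rw [div_mul_eq_mul_div, div_le_iff₀ (by positivity)]
    nlinarith [sq_nonneg a, sq_nonneg b]
  have h3 : 0 ≤ ε / (a ^ 2 + b ^ 2 + 1) * σ ^ 2 := by positivity
  linarith

section Strip
variable {F : ℂ → ℂ} {a b p A : ℝ}

theorem integrable_strip_line (hp : 0 < p)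
    (hF : ∀ s : ℂ, a ≤ s.re → s.re ≤ b → AnalyticAt ℂ F s)
    (hA : ∀ s : ℂ, a ≤ s.re → s.re ≤ b → ‖F s‖ ^ p ≤ A * (1 + s.im ^ 2)⁻¹)
    {σ : ℝ} (h1 : a ≤ σ) (h2 : σ ≤ b) :
    Integrable fun t : ℝ => ‖F (σ + t * I)‖ ^ p := by
  have hc : Continuous fun t : ℝ => ‖F (σ + t * I)‖ ^ p := by
    refine continuous_iff_continuousAt.2 fun t => ?_
    have : ContinuousAt F (σ + t * I) := (hF _ (by simpa) (by simpa)).continuousAt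
    have h3 : ContinuousAt (fun t : ℝ => F (σ + t * I)) t :=
      ContinuousAt.comp (f := fun t : ℝ => (σ + t * I : ℂ)) this (by fun_prop)
    exact h3.norm.rpow_const (Or.inr hp.le)
  refine (integrable_inv_one_add_sq.const_mul A).mono' hc.aestronglyMeasurable ?_
  refine Eventually.of_forall fun t => ?_
  rw [Real.norm_of_nonneg (by positivity)]
  simpa using hA (σ + t * I) (by simpa) (by simpa)

theorem continuousOn_strip_integral (hp : 0 < p)
    (hF : ∀ s : ℂ, a ≤ s.re → s.re ≤ b → AnalyticAt ℂ F s)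
    (hA : ∀ s : ℂ, a ≤ s.re → s.re ≤ b → ‖F s‖ ^ p ≤ A * (1 + s.im ^ 2)⁻¹) :
    ContinuousOn (fun σ : ℝ => ∫ t : ℝ, ‖F (σ + t * I)‖ ^ p) (Icc a b) := by
  refine continuousOn_of_dominated (bound := fun t => A * (1 + t ^ 2)⁻¹) ?_ ?_
    (integrable_inv_one_add_sq.const_mul A) ?_
  · intro σ hσ
    exact (integrable_strip_line hp hF hA hσ.1 hσ.2).aestronglyMeasurable
  · intro σ hσ
    refine Eventually.of_forall fun t => ?_
    rw [Real.norm_of_nonneg (by positivity)]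
    simpa using hA (σ + t * I) (by simpa using hσ.1) (by simpa using hσ.2)
  · refine Eventually.of_forall fun t => ?_
    intro σ hσ
    have : ContinuousAt F (σ + t * I) :=
      (hF _ (by simpa using hσ.1) (by simpa using hσ.2)).continuousAt
    have h3 : ContinuousAt (fun σ : ℝ => F (σ + t * I)) σ :=
      ContinuousAt.comp (f := fun σ : ℝ => (σ + t * I : ℂ)) this (by fun_prop)
    exact (h3.norm.rpow_const (Or.inr hp.le)).continuousWithinAt

theorem strip_integral_submean (hp : 0 < p)
    (hF : ∀ s : ℂ, a ≤ s.re → s.re ≤ b → AnalyticAt ℂ F s)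
    (hA : ∀ s : ℂ, a ≤ s.re → s.re ≤ b → ‖F s‖ ^ p ≤ A * (1 + s.im ^ 2)⁻¹)
    {σ r : ℝ} (hr : 0 < r) (h1 : a ≤ σ - r) (h2 : σ + r ≤ b) :
    2 * π * ∫ t : ℝ, ‖F (σ + t * I)‖ ^ p ≤
      ∫ θ in (0:ℝ)..2 * π, ∫ t : ℝ, ‖F ((σ + r * Real.cos θ : ℝ) + t * I)‖ ^ p := by
  have hA0 : 0 ≤ A := by
    have := hA σ (by simp; linarith) (by simp; linarith)
    simp at this
    exact le_trans (by positivity) this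
  have hmem : ∀ θ : ℝ, a ≤ σ + r * Real.cos θ ∧ σ + r * Real.cos θ ≤ b := fun θ => by
    constructor <;> nlinarith [Real.cos_le_one θ, Real.neg_one_le_cos θ]
  -- the circle inequality
  have hcirc : ∀ t : ℝ, 2 * π * ‖F (σ + t * I)‖ ^ p ≤
      ∫ θ in (0:ℝ)..2 * π, ‖F ((σ + r * Real.cos θ : ℝ) + (t + r * Real.sin θ : ℝ) * I)‖ ^ p := by
    intro t
    have h := norm_rpow_le_circleAverage (f := F) (c := σ + t * I) hr hp (fun s hs => by
      have h3 : |(s - (σ + t * I)).re| ≤ r := (Complex.abs_re_le_norm _).trans (by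
        simpa [dist_eq_norm] using hs)
      have h4 := abs_le.1 h3
      simp at h4
      exact hF s (by linarith [h4.1]) (by linarith [h4.2]))
    rw [circleAverage_def, smul_eq_mul, inv_mul_eq_div, le_div_iff₀ (by positivity)] at h
    rw [mul_comm]
    refine h.trans (le_of_eq ?_)
    refine intervalIntegral.integral_congr fun θ _ => ?_
    have : circleMap (σ + t * I) r θ =
        ((σ + r * Real.cos θ : ℝ) : ℂ) + ((t + r * Real.sin θ : ℝ) : ℂ) * I := by
      rw [circleMap, Complex.exp_mul_I]; push_cast; ring
    simp only [this]
  set G : ℝ → ℝ → ℝ := fun θ t =>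
    ‖F ((σ + r * Real.cos θ : ℝ) + (t + r * Real.sin θ : ℝ) * I)‖ ^ p with hG
  have hGc : Continuous (Function.uncurry G) := by
    refine continuous_iff_continuousAt.2 fun x => ?_
    have h3 : ContinuousAt F (((σ + r * Real.cos x.1 : ℝ) : ℂ) +
        ((x.2 + r * Real.sin x.1 : ℝ) : ℂ) * I) :=
      (hF _ (by rw [line_re]; exact (hmem x.1).1) (by rw [line_re]; exact (hmem x.1).2)).continuousAt
    have h4 : ContinuousAt (fun x : ℝ × ℝ => F (((σ + r * Real.cos x.1 : ℝ) : ℂ) +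
        ((x.2 + r * Real.sin x.1 : ℝ) : ℂ) * I)) x :=
      ContinuousAt.comp (f := fun x : ℝ × ℝ => (((σ + r * Real.cos x.1 : ℝ) : ℂ) +
        ((x.2 + r * Real.sin x.1 : ℝ) : ℂ) * I)) h3 (by fun_prop)
    exact h4.norm.rpow_const (Or.inr hp.le)
  have hsq : ∀ t u : ℝ, |u| ≤ r → (1 + (t + u) ^ 2)⁻¹ ≤ 2 * (1 + r ^ 2) * (1 + t ^ 2)⁻¹ := by
    intro t u hu
    rw [← div_eq_mul_inv, inv_eq_one_div, div_le_div_iff₀ (by positivity) (by positivity)]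
    have : u ^ 2 ≤ r ^ 2 := sq_le_sq' (by linarith [abs_le.1 hu]) (abs_le.1 hu).2
    nlinarith [sq_nonneg (t + 2 * u), sq_nonneg (t + u), mul_nonneg (sq_nonneg r) (sq_nonneg (t+u))]
  have hGb : ∀ θ t, G θ t ≤ A * (2 * (1 + r ^ 2)) * (1 + t ^ 2)⁻¹ := by
    intro θ t
    have h3 := hA (((σ + r * Real.cos θ : ℝ) : ℂ) + ((t + r * Real.sin θ : ℝ) : ℂ) * I)
      (by rw [line_re]; exact (hmem θ).1) (by rw [line_re]; exact (hmem θ).2)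
    refine h3.trans ?_
    have him : (((σ + r * Real.cos θ : ℝ) : ℂ) + ((t + r * Real.sin θ : ℝ) : ℂ) * I).im =
      t + r * Real.sin θ := line_im _ _
    rw [him, mul_assoc]
    refine mul_le_mul_of_nonneg_left (hsq t _ ?_) hA0
    rw [abs_mul, abs_of_pos hr]
    nlinarith [Real.abs_sin_le_one θ]
  have hGint : Integrable (Function.uncurry G)
      ((volume.restrict (Ioc 0 (2 * π))).prod volume) := by
    have hb : Integrable (fun x : ℝ × ℝ => (1:ℝ) * (A * (2 * (1 + r ^ 2)) * (1 + x.2 ^ 2)⁻¹))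
        ((volume.restrict (Ioc 0 (2 * π))).prod volume) :=
      Integrable.mul_prod (f := fun _ : ℝ => (1:ℝ))
        (g := fun t : ℝ => A * (2 * (1 + r ^ 2)) * (1 + t ^ 2)⁻¹)
        (integrable_const _) (integrable_inv_one_add_sq.const_mul _)
    refine hb.mono' hGc.aestronglyMeasurable (Eventually.of_forall fun x => ?_)
    rw [Real.norm_of_nonneg (by simp only [Function.uncurry, hG]; positivity), one_mul]
    exact hGb x.1 x.2
  have hswap := integral_integral_swap hGint
  have hle : ∫ t : ℝ, 2 * π * ‖F (σ + t * I)‖ ^ p ≤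
      ∫ t : ℝ, ∫ θ in Ioc 0 (2 * π), G θ t := by
    refine integral_mono ((integrable_strip_line hp hF hA (by linarith) (by linarith)).const_mul _)
      hGint.integral_prod_right fun t => ?_
    rw [← intervalIntegral.integral_of_le (by positivity)]
    exact hcirc t
  rw [integral_const_mul] at hle
  refine hle.trans ?_
  rw [← hswap, intervalIntegral.integral_of_le (by positivity)]
  refine le_of_eq (integral_congr_ae (Eventually.of_forall fun θ => ?_))
  exact integral_add_right_eq_self
    (fun t : ℝ => ‖F ((σ + r * Real.cos θ : ℝ) + (t : ℝ) * I)‖ ^ p) (r * Real.sin θ)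

/-- Convexity of the `p`-th mean values of an analytic function in a vertical strip. -/
theorem strip_convexity (hab : a < b) (hp : 0 < p)
    (hF : ∀ s : ℂ, a ≤ s.re → s.re ≤ b → AnalyticAt ℂ F s)
    (hA : ∀ s : ℂ, a ≤ s.re → s.re ≤ b → ‖F s‖ ^ p ≤ A * (1 + s.im ^ 2)⁻¹)
    {A₀ B₀ : ℝ} (hA₀ : 0 < A₀) (hB₀ : 0 < B₀)
    (ha : ∫ t : ℝ, ‖F (a + t * I)‖ ^ p ≤ A₀) (hb : ∫ t : ℝ, ‖F (b + t * I)‖ ^ p ≤ B₀)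
    {x : ℝ} (hx0 : 0 ≤ x) (hx1 : x ≤ 1) :
    ∫ t : ℝ, ‖F (((1 - x) * a + x * b : ℝ) + t * I)‖ ^ p ≤ A₀ ^ (1 - x) * B₀ ^ x := by
  have hba : 0 < b - a := sub_pos.2 hab
  set l : ℝ := (Real.log A₀ - Real.log B₀) / (b - a) with hl
  have hlab : l * (b - a) = Real.log A₀ - Real.log B₀ := by rw [hl]; field_simp
  set M : ℝ := Real.exp (l * a) * A₀ with hM
  have hMb : M = Real.exp (l * b) * B₀ := by
    have h3 : Real.exp (l * a + Real.log A₀) = Real.exp (l * b + Real.log B₀) := by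
      congr 1; linarith
    rwa [Real.exp_add, Real.exp_add, Real.exp_log hA₀, Real.exp_log hB₀] at h3
  have key := le_max_of_projected_submean
    (ψ := fun σ => Real.exp (l * σ) * ∫ t : ℝ, ‖F (σ + t * I)‖ ^ p) (M := M) hab
    ?_ (by simp only [hM]; gcongr) (by simp only [hMb]; gcongr) ?_
    ((1 - x) * a + x * b) ⟨by nlinarith, by nlinarith⟩
  · have h2 : A₀ ^ (1 - x) * B₀ ^ x = M * Real.exp (-(l * ((1 - x) * a + x * b))) := by
      rw [Real.rpow_def_of_pos hA₀, Real.rpow_def_of_pos hB₀, hM]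
      nth_rewrite 2 [← Real.exp_log hA₀]
      rw [← Real.exp_add, ← Real.exp_add, ← Real.exp_add]
      congr 1
      linear_combination x * hlab
    rw [h2, Real.exp_neg, ← div_eq_mul_inv, le_div_iff₀ (Real.exp_pos _), mul_comm]
    exact key
  · exact ContinuousOn.mul (by fun_prop) (continuousOn_strip_integral hp hF hA)
  · intro σ r hr h1 h2
    set H : ℂ → ℂ := fun s => Complex.exp ((l / p : ℝ) * s) * F s with hH
    have hnorm : ∀ s : ℂ, ‖H s‖ ^ p = Real.exp (l * s.re) * ‖F s‖ ^ p := by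
      intro s
      rw [hH, norm_mul, Real.mul_rpow (norm_nonneg _) (norm_nonneg _), Complex.norm_exp,
        ← Real.exp_mul, Complex.re_ofReal_mul]
      congr 2
      field_simp
    have hsub := strip_integral_submean (F := H) (a := a) (b := b)
      (A := Real.exp (|l| * (|a| + |b|)) * A) hp
      (fun s hs1 hs2 => AnalyticAt.mul (by fun_prop) (hF s hs1 hs2)) ?_ hr h1 h2
    · simp only [hnorm, line_re, integral_const_mul] at hsub
      exact hsub
    · intro s hs1 hs2
      rw [hnorm, mul_assoc]
      have hs : |s.re| ≤ |a| + |b| := by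
        rw [abs_le]; constructor
        · linarith [neg_abs_le a, abs_nonneg b]
        · linarith [le_abs_self b, abs_nonneg a]
      have : l * s.re ≤ |l| * (|a| + |b|) := by
        calc l * s.re ≤ |l * s.re| := le_abs_self _
          _ = |l| * |s.re| := abs_mul _ _
          _ ≤ _ := by gcongr
      gcongr
      exact hA s hs1 hs2

end Strip

theorem poly_mul_gauss_le {T D K : ℝ} (hD : 0 < D) (hK : 0 ≤ K) (t : ℝ) :
    (1 + |t|) ^ K * Real.exp (-((t - T) / D) ^ 2) ≤
      (1 + |T| + D) ^ K * Real.exp (K ^ 2 / 4) := by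
  set u := (t - T) / D with hu
  have htu : t = T + D * u := by rw [hu]; field_simp; ring
  have h1 : 1 + |t| ≤ (1 + |T| + D) * Real.exp |u| := by
    have h2 : |t| ≤ |T| + D * |u| := by
      rw [htu]; refine (abs_add_le _ _).trans ?_; rw [abs_mul, abs_of_pos hD]
    have h3 := Real.add_one_le_exp |u|
    nlinarith [abs_nonneg T, abs_nonneg u, mul_nonneg (abs_nonneg T) (abs_nonneg u)]
  calc (1 + |t|) ^ K * Real.exp (-u ^ 2)
      ≤ ((1 + |T| + D) * Real.exp |u|) ^ K * Real.exp (-u ^ 2) := by gcongr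
    _ = (1 + |T| + D) ^ K * Real.exp (|u| * K - |u| ^ 2) := by
        rw [Real.mul_rpow (by positivity) (by positivity), ← Real.exp_mul, mul_assoc,
          ← Real.exp_add, sq_abs]; rfl
    _ ≤ _ := by
        gcongr
        nlinarith [sq_nonneg (|u| - K / 2)]

/-- Analytic functions of at most polynomial growth in a closed vertical strip. -/
structure StripGrowth (F : ℂ → ℂ) (a b : ℝ) : Prop where
  analytic : ∀ s : ℂ, a ≤ s.re → s.re ≤ b → AnalyticAt ℂ F s
  growth : ∃ A : ℝ, ∃ k : ℕ, 0 ≤ A ∧ ∀ s : ℂ, a ≤ s.re → s.re ≤ b → ‖F s‖ ≤ A * (1 + |s.im|) ^ k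

namespace StripGrowth
variable {F G : ℂ → ℂ} {a b : ℝ}

theorem mono (hF : StripGrowth F a b) {a' b' : ℝ} (ha : a ≤ a') (hb : b' ≤ b) :
    StripGrowth F a' b' := by
  obtain ⟨A, k, hA, h⟩ := hF.growth
  exact ⟨fun s h1 h2 => hF.analytic s (ha.trans h1) (h2.trans hb),
    A, k, hA, fun s h1 h2 => h s (ha.trans h1) (h2.trans hb)⟩

theorem mul (hF : StripGrowth F a b) (hG : StripGrowth G a b) :
    StripGrowth (fun s => F s * G s) a b := by
  obtain ⟨A, k, hA, h⟩ := hF.growth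
  obtain ⟨B, l, hB, h'⟩ := hG.growth
  refine ⟨fun s h1 h2 => (hF.analytic s h1 h2).mul (hG.analytic s h1 h2),
    A * B, k + l, by positivity, fun s h1 h2 => ?_⟩
  rw [norm_mul, pow_add]
  calc _ ≤ (A * (1 + |s.im|) ^ k) * (B * (1 + |s.im|) ^ l) := by
        gcongr
        · exact h s h1 h2
        · exact h' s h1 h2
    _ = _ := by ring

theorem add (hF : StripGrowth F a b) (hG : StripGrowth G a b) :
    StripGrowth (fun s => F s + G s) a b := by
  obtain ⟨A, k, hA, h⟩ := hF.growth
  obtain ⟨B, l, hB, h'⟩ := hG.growth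
  refine ⟨fun s h1 h2 => (hF.analytic s h1 h2).add (hG.analytic s h1 h2),
    A + B, k + l, by positivity, fun s h1 h2 => ?_⟩
  have h3 : (1:ℝ) ≤ 1 + |s.im| := by linarith [abs_nonneg s.im]
  calc ‖F s + G s‖ ≤ ‖F s‖ + ‖G s‖ := norm_add_le _ _
    _ ≤ A * (1 + |s.im|) ^ (k + l) + B * (1 + |s.im|) ^ (k + l) := by
        gcongr
        · exact (h s h1 h2).trans (by gcongr; first | exact h3 | omega)
        · exact (h' s h1 h2).trans (by gcongr; first | exact h3 | omega)
    _ = _ := by ring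

theorem const (c : ℂ) (a b : ℝ) : StripGrowth (fun _ => c) a b :=
  ⟨fun _ _ _ => analyticAt_const, ‖c‖, 0, norm_nonneg _, by simp⟩

theorem neg (hF : StripGrowth F a b) : StripGrowth (fun s => - F s) a b := by
  simpa using (const (-1) a b).mul hF

theorem sub (hF : StripGrowth F a b) (hG : StripGrowth G a b) :
    StripGrowth (fun s => F s - G s) a b := by
  simpa [sub_eq_add_neg] using hF.add hG.neg

theorem pow (hF : StripGrowth F a b) (n : ℕ) : StripGrowth (fun s => F s ^ n) a b := by
  induction n with
  | zero => simpa using const 1 a b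
  | succ n ih => simpa [pow_succ] using ih.mul hF

theorem continuous_line (hF : StripGrowth F a b) {σ : ℝ} (h1 : a ≤ σ) (h2 : σ ≤ b) :
    Continuous fun t : ℝ => F (σ + t * I) := by
  refine continuous_iff_continuousAt.2 fun t => ?_
  have : ContinuousAt F (σ + t * I) := (hF.analytic _ (by simpa) (by simpa)).continuousAt
  exact ContinuousAt.comp (f := fun t : ℝ => (σ + t * I : ℂ)) this (by fun_prop)

theorem sum {ι : Type*} (u : Finset ι) {f : ι → ℂ → ℂ} (h : ∀ i ∈ u, StripGrowth (f i) a b) :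
    StripGrowth (fun s => ∑ i ∈ u, f i s) a b := by
  classical
  induction u using Finset.induction_on with
  | empty => simpa using const 0 a b
  | insert i u hi ih =>
    simp only [Finset.sum_insert hi]
    exact (h i (by simp)).add (ih fun j hj => h j (by simp [hj]))

end StripGrowth

/-- The Gaussian-weighted `p`-th mean value of `F` on the line of real part `σ`. -/
def gaussMean (F : ℂ → ℂ) (p T D σ : ℝ) : ℝ :=
  ∫ t : ℝ, ‖F (σ + t * I)‖ ^ p * Real.exp (-((t - T) / D) ^ 2)

theorem gaussMean_nonneg (F : ℂ → ℂ) (p T D σ : ℝ) : 0 ≤ gaussMean F p T D σ :=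
  integral_nonneg fun _ => by positivity

section
variable {F : ℂ → ℂ} {a b p T D : ℝ}

theorem StripGrowth.exists_bound (hF : StripGrowth F a b) (hp : 0 < p) (hD : 0 < D) :
    ∃ A : ℝ, ∀ s : ℂ, a ≤ s.re → s.re ≤ b →
      ‖F s‖ ^ p * Real.exp (-((s.im - T) / D) ^ 2) ≤ A * (1 + s.im ^ 2)⁻¹ := by
  obtain ⟨A, k, hA, h⟩ := hF.growth
  refine ⟨A ^ p * ((1 + |T| + D) ^ (k * p + 2) * Real.exp ((k * p + 2) ^ 2 / 4)),
    fun s h1 h2 => ?_⟩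
  rw [← div_eq_mul_inv, le_div_iff₀ (by positivity)]
  have h3 : ‖F s‖ ^ p ≤ A ^ p * (1 + |s.im|) ^ (k * p) := by
    calc ‖F s‖ ^ p ≤ (A * (1 + |s.im|) ^ k) ^ p := by
          gcongr
          exact h s h1 h2
      _ = _ := by
          rw [Real.mul_rpow hA (by positivity), ← Real.rpow_natCast, ← Real.rpow_mul (by positivity)]
  have h4 : 1 + s.im ^ 2 ≤ (1 + |s.im|) ^ (2:ℝ) := by
    rw [Real.rpow_two]; nlinarith [abs_nonneg s.im, sq_abs s.im]
  calc _ ≤ A ^ p * (1 + |s.im|) ^ (k * p) * Real.exp (-((s.im - T) / D) ^ 2) *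
        (1 + |s.im|) ^ (2:ℝ) := by gcongr
    _ = A ^ p * ((1 + |s.im|) ^ (k * p + 2) * Real.exp (-((s.im - T) / D) ^ 2)) := by
        rw [Real.rpow_add (by positivity)]; ring
    _ ≤ _ := by
        exact mul_le_mul_of_nonneg_left (poly_mul_gauss_le hD (by positivity) _) (by positivity)

theorem StripGrowth.integrable (hF : StripGrowth F a b) (hp : 0 < p) (hD : 0 < D) {σ : ℝ}
    (h1 : a ≤ σ) (h2 : σ ≤ b) :
    Integrable fun t : ℝ => ‖F (σ + t * I)‖ ^ p * Real.exp (-((t - T) / D) ^ 2) := by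
  obtain ⟨A, hA⟩ := hF.exists_bound (T := T) hp hD
  refine (integrable_inv_one_add_sq.const_mul A).mono' ?_ ?_
  · have hc : Continuous fun t : ℝ => ‖F (σ + t * I)‖ ^ p :=
      (hF.continuous_line h1 h2).norm.rpow_const fun _ => Or.inr hp.le
    exact (hc.mul (by fun_prop)).aestronglyMeasurable
  · refine Eventually.of_forall fun t => ?_
    rw [Real.norm_of_nonneg (by positivity)]
    simpa using hA (σ + t * I) (by simpa) (by simpa)

/-- Convexity of Gaussian-weighted mean values. -/
theorem gaussMean_convex (hF : StripGrowth F a b) (hab : a < b) (hp : 0 < p) (hD : 0 < D)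
    (ha5 : |a| ≤ D) (hb5 : |b| ≤ D)
    {A₀ B₀ : ℝ} (hA₀ : 0 < A₀) (hB₀ : 0 < B₀)
    (ha : gaussMean F p T D a ≤ A₀) (hb : gaussMean F p T D b ≤ B₀)
    {x : ℝ} (hx0 : 0 ≤ x) (hx1 : x ≤ 1) :
    gaussMean F p T D ((1 - x) * a + x * b) ≤ Real.exp 1 * (A₀ ^ (1 - x) * B₀ ^ x) := by
  set H : ℂ → ℂ := fun s => Complex.exp (((p * D ^ 2)⁻¹ : ℝ) * (s - T * I) ^ 2) * F s with hH
  have hnorm : ∀ s : ℂ, ‖H s‖ ^ p = Real.exp ((s.re / D) ^ 2) *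
      (‖F s‖ ^ p * Real.exp (-((s.im - T) / D) ^ 2)) := by
    intro s
    rw [hH, norm_mul, Real.mul_rpow (norm_nonneg _) (norm_nonneg _), Complex.norm_exp,
      ← Real.exp_mul, Complex.re_ofReal_mul]
    have : ((s - T * I) ^ 2).re = s.re ^ 2 - (s.im - T) ^ 2 := by
      simp [pow_two]
    rw [this, mul_comm (‖F s‖ ^ p), ← mul_assoc, ← Real.exp_add]
    congr 2
    field_simp
    ring
  have habs : ∀ s : ℝ, a ≤ s → s ≤ b → Real.exp ((s / D) ^ 2) ≤ Real.exp 1 := by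
    intro s h1 h2
    gcongr
    rw [div_pow, div_le_one (by positivity)]
    refine sq_le_sq' ?_ ?_
    · linarith [(abs_le.1 ha5).1]
    · linarith [(abs_le.1 hb5).2]
  have hone : ∀ s : ℝ, 1 ≤ Real.exp ((s / D) ^ 2) := fun s => Real.one_le_exp (by positivity)
  obtain ⟨A, hA⟩ := hF.exists_bound (T := T) hp hD
  have hinteg : ∀ σ : ℝ, ∫ t : ℝ, ‖H (σ + t * I)‖ ^ p =
      Real.exp ((σ / D) ^ 2) * gaussMean F p T D σ := by
    intro σ
    simp only [hnorm, line_re, line_im, integral_const_mul, gaussMean]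
  have key := strip_convexity (F := H) (p := p) (A := Real.exp 1 * A)
    (A₀ := Real.exp 1 * A₀) (B₀ := Real.exp 1 * B₀) hab hp
    (fun s h1 h2 => AnalyticAt.mul (by fun_prop) (hF.analytic s h1 h2)) ?_
    (by positivity) (by positivity) ?_ ?_ hx0 hx1
  · rw [hinteg, Real.mul_rpow (by positivity) hA₀.le, Real.mul_rpow (by positivity) hB₀.le] at key
    refine le_trans (le_mul_of_one_le_left (gaussMean_nonneg ..) (hone _)) (key.trans (le_of_eq ?_))
    have h3 : Real.exp 1 ^ (1 - x) * Real.exp 1 ^ x = Real.exp 1 := by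
      rw [← Real.rpow_add (by positivity)]; simp
    calc _ = (Real.exp 1 ^ (1 - x) * Real.exp 1 ^ x) * (A₀ ^ (1 - x) * B₀ ^ x) := by ring
      _ = _ := by rw [h3]
  · intro s h1 h2
    rw [hnorm, mul_assoc]
    have := hA s h1 h2
    calc _ ≤ Real.exp 1 * (‖F s‖ ^ p * Real.exp (-((s.im - T) / D) ^ 2)) :=
          mul_le_mul_of_nonneg_right (habs _ h1 h2) (by positivity)
      _ ≤ _ := by gcongr
  · rw [hinteg]
    exact mul_le_mul (habs _ le_rfl hab.le) ha (gaussMean_nonneg ..) (by positivity)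
  · rw [hinteg]
    exact mul_le_mul (habs _ hab.le le_rfl) hb (gaussMean_nonneg ..) (by positivity)

end

theorem norm_rpow_le_polar_integral {f : ℂ → ℂ} {c : ℂ} {r p : ℝ} (hr : 0 < r) (hp : 0 < p)
    (hf : AnalyticOnNhd ℂ f (Metric.closedBall c r)) :
    ENNReal.ofReal (2 * π * ‖f c‖ ^ p) ≤
      ∫⁻ θ in Ioo (-π) π, ENNReal.ofReal
        (‖f (c + ((r * Real.cos θ : ℝ) + (r * Real.sin θ : ℝ) * I))‖ ^ p) := by
  have h := norm_rpow_le_circleAverage hr hp hf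
  have hcm : ∀ θ : ℝ, circleMap c r θ =
      c + (((r * Real.cos θ : ℝ) : ℂ) + ((r * Real.sin θ : ℝ) : ℂ) * I) := by
    intro θ
    rw [circleMap, Complex.exp_mul_I]; push_cast; ring
  have hc : Continuous fun θ : ℝ => ‖f (circleMap c r θ)‖ ^ p := by
    have h1 : ContinuousOn (fun z => ‖f z‖ ^ p) (Metric.closedBall c r) :=
      hf.continuousOn.norm.rpow_const fun _ _ => Or.inr hp.le
    exact h1.comp_continuous (continuous_circleMap c r) fun θ =>
      circleMap_mem_closedBall c hr.le θ
  rw [circleAverage_def, smul_eq_mul, inv_mul_eq_div, le_div_iff₀ (by positivity)] at h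
  have hper : Function.Periodic (fun θ : ℝ => ‖f (circleMap c r θ)‖ ^ p) (2 * π) := fun θ => by
    simp only [periodic_circleMap c r θ]
  have hshift := hper.intervalIntegral_add_eq 0 (-π)
  rw [zero_add, show -π + 2 * π = π by ring] at hshift
  rw [hshift, intervalIntegral.integral_of_le (by linarith [Real.pi_pos]),
    integral_Ioc_eq_integral_Ioo] at h
  simp only [← hcm]
  rw [← ofReal_integral_eq_lintegral_ofReal _ (Eventually.of_forall fun _ => by positivity)]
  · refine ENNReal.ofReal_le_ofReal ?_
    linarith
  · exact (hc.integrableOn_Icc (a := -π) (b := π)).mono_set Ioo_subset_Icc_self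

theorem norm_rpow_le_square_integral {f : ℂ → ℂ} {c : ℂ} {r p : ℝ} (hr : 0 < r) (hp : 0 < p)
    (hm : Measurable f) (hf : AnalyticOnNhd ℂ f (Metric.closedBall c r)) :
    ENNReal.ofReal (π * r ^ 2 * ‖f c‖ ^ p) ≤
      ∫⁻ σ in Icc (-r) r, ∫⁻ t in Icc (-r) r, ENNReal.ofReal (‖f (c + (σ + t * I))‖ ^ p) := by
  set g : ℝ × ℝ → ENNReal := fun q => (Icc (-r) r ×ˢ Icc (-r) r).indicator
    (fun q => ENNReal.ofReal (‖f (c + (q.1 + q.2 * I))‖ ^ p)) q with hg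
  have hm2 : Measurable fun q : ℝ × ℝ => ENNReal.ofReal (‖f (c + (q.1 + q.2 * I))‖ ^ p) := by
    have : Measurable fun q : ℝ × ℝ => f (c + (q.1 + q.2 * I)) :=
      hm.comp (Continuous.measurable (by fun_prop))
    exact (this.norm.pow_const p).ennreal_ofReal
  have hgm : Measurable g := hm2.indicator (measurableSet_Icc.prod measurableSet_Icc)
  have hR : ∫⁻ q, g q = ∫⁻ σ in Icc (-r) r, ∫⁻ t in Icc (-r) r,
      ENNReal.ofReal (‖f (c + (σ + t * I))‖ ^ p) := by
    rw [hg, lintegral_indicator (measurableSet_Icc.prod measurableSet_Icc), Measure.volume_eq_prod,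
      ← Measure.prod_restrict, lintegral_prod _ hm2.aemeasurable]
  rw [← hR, ← lintegral_comp_polarCoord_symm]
  have hsub : Ioo 0 r ×ˢ Ioo (-π) π ⊆ polarCoord.target := by
    rw [polarCoord_target]
    exact prod_mono Ioo_subset_Ioi_self le_rfl
  refine le_trans ?_ (lintegral_mono_set hsub)
  have hmeas : Measurable fun q : ℝ × ℝ => ENNReal.ofReal q.1 • g (polarCoord.symm q) := by
    simp only [smul_eq_mul]
    have h3 : Measurable fun q : ℝ × ℝ => polarCoord.symm q := by
      simp only [polarCoord_symm_apply]
      exact Continuous.measurable (by fun_prop)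
    exact (measurable_fst.ennreal_ofReal).mul (hgm.comp h3)
  rw [Measure.volume_eq_prod, ← Measure.prod_restrict, lintegral_prod _ hmeas.aemeasurable]
  have hinner : ∀ ρ ∈ Ioo 0 r, ENNReal.ofReal (ρ * (2 * π * ‖f c‖ ^ p)) ≤
      ∫⁻ θ in Ioo (-π) π, ENNReal.ofReal ρ • g (polarCoord.symm (ρ, θ)) := by
    intro ρ hρ
    have h1 := norm_rpow_le_polar_integral (f := f) (c := c) hρ.1 hp
      (hf.mono (Metric.closedBall_subset_closedBall hρ.2.le))
    rw [ENNReal.ofReal_mul hρ.1.le]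
    refine (mul_le_mul_right h1 _).trans (le_of_eq ?_)
    rw [← lintegral_const_mul']
    · refine lintegral_congr fun θ => ?_
      rw [smul_eq_mul]
      congr 1
      have : (ρ * Real.cos θ, ρ * Real.sin θ) ∈ Icc (-r) r ×ˢ Icc (-r) r := by
        have := hρ.1
        have := hρ.2
        refine ⟨⟨?_, ?_⟩, ?_, ?_⟩ <;>
        nlinarith [Real.cos_le_one θ, Real.neg_one_le_cos θ, Real.sin_le_one θ,
          Real.neg_one_le_sin θ]
      simp only [hg, polarCoord_symm_apply]
      rw [indicator_of_mem this]
    · exact ENNReal.ofReal_ne_top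
  refine le_trans ?_ (setLIntegral_mono' measurableSet_Ioo hinner)
  rw [← ofReal_integral_eq_lintegral_ofReal]
  · rw [← integral_Ioc_eq_integral_Ioo, ← intervalIntegral.integral_of_le hr.le,
      intervalIntegral.integral_mul_const, integral_id]
    refine ENNReal.ofReal_le_ofReal (le_of_eq ?_)
    ring
  · exact ((Continuous.integrableOn_Icc (by fun_prop)).mono_set
      (Ioo_subset_Icc_self (a := (0:ℝ)) (b := r)))
  · filter_upwards [ae_restrict_mem measurableSet_Ioo] with ρ hρ
    have := hρ.1
    positivity

section
variable {F : ℂ → ℂ} {a b p T D : ℝ}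

theorem lintegral_gaussMean (hF : StripGrowth F a b) (hp : 0 < p) (hD : 0 < D) {σ : ℝ}
    (h1 : a ≤ σ) (h2 : σ ≤ b) :
    ∫⁻ t : ℝ, ENNReal.ofReal (‖F (σ + t * I)‖ ^ p * Real.exp (-((t - T) / D) ^ 2)) =
      ENNReal.ofReal (gaussMean F p T D σ) := by
  rw [gaussMean, ofReal_integral_eq_lintegral_ofReal (hF.integrable hp hD h1 h2)]
  exact Eventually.of_forall fun t => by positivity

theorem exp_weight_le {t : ℝ} (h : |(t - T) / D| ≤ 2) :
    1 ≤ Real.exp 4 * Real.exp (-((t - T) / D) ^ 2) := by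
  rw [← Real.exp_add]
  refine Real.one_le_exp ?_
  have := abs_le.1 h
  nlinarith

/-- The measure of the set where `F` is large at a single height. -/
theorem volume_point_large_le (hF : StripGrowth F a b) (hp : 0 < p) (hD : 0 < D) {σ v M : ℝ}
    (h1 : a ≤ σ) (h2 : σ ≤ b) (hv : 0 < v) (hM : gaussMean F p T D σ ≤ M) :
    volume {t : ℝ | t ∈ Icc T (T + D) ∧ v ≤ ‖F (σ + t * I)‖ ^ p} ≤
      ENNReal.ofReal (Real.exp 4 * M / v) := by
  have hinteg := (hF.integrable (T := T) hp hD h1 h2)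
  have hmk := mul_meas_ge_le_lintegral₀ (μ := volume)
    (f := fun t : ℝ => ENNReal.ofReal (‖F (σ + t * I)‖ ^ p * Real.exp (-((t - T) / D) ^ 2)))
    hinteg.aestronglyMeasurable.aemeasurable.ennreal_ofReal (ENNReal.ofReal (Real.exp (-4) * v))
  rw [lintegral_gaussMean hF hp hD h1 h2] at hmk
  have hsub : {t : ℝ | t ∈ Icc T (T + D) ∧ v ≤ ‖F (σ + t * I)‖ ^ p} ⊆
      {t : ℝ | ENNReal.ofReal (Real.exp (-4) * v) ≤
        ENNReal.ofReal (‖F (σ + t * I)‖ ^ p * Real.exp (-((t - T) / D) ^ 2))} := by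
    rintro t ⟨ht, hvt⟩
    refine ENNReal.ofReal_le_ofReal ?_
    have h4 := exp_weight_le (T := T) (D := D) (t := t) (by
      rw [abs_le]
      constructor
      · rw [le_div_iff₀ hD]; linarith [ht.1]
      · rw [div_le_iff₀ hD]; linarith [ht.2])
    rw [Real.exp_neg, inv_mul_le_iff₀ (by positivity)]
    calc v ≤ ‖F (σ + t * I)‖ ^ p * 1 := by simpa using hvt
      _ ≤ ‖F (σ + t * I)‖ ^ p * (Real.exp 4 * Real.exp (-((t - T) / D) ^ 2)) := by gcongr
      _ = _ := by ring
  refine (measure_mono hsub).trans ?_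
  have hpos : 0 < Real.exp (-4) * v := by positivity
  rw [mul_comm, ← ENNReal.le_div_iff_mul_le (Or.inl (by simpa using hpos))
    (Or.inl ENNReal.ofReal_ne_top), ← ENNReal.ofReal_div_of_pos hpos] at hmk
  refine hmk.trans (ENNReal.ofReal_le_ofReal ?_)
  rw [Real.exp_neg, div_le_div_iff₀ (by positivity) hv]
  have : Real.exp 4 * M * ((Real.exp 4)⁻¹ * v) = M * v := by field_simp
  rw [this]
  gcongr

/-- The measure of the set where `F` is large somewhere in a box around height `t`. -/
theorem volume_box_large_le {r h v M : ℝ} (hr : 0 < r) (hh : 0 ≤ h) (hrh : h + r ≤ D) (hab : a ≤ b)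
    (hm : Measurable F) (hF : StripGrowth F (a - r) (b + r)) (hp : 0 < p) (hD : 0 < D)
    (hv : 0 < v) (hM : ∀ σ ∈ Icc (a - r) (b + r), gaussMean F p T D σ ≤ M) :
    volume {t : ℝ | t ∈ Icc T (T + D) ∧
        ∃ s : ℂ, a ≤ s.re ∧ s.re ≤ b ∧ |s.im - t| ≤ h ∧ v ≤ ‖F s‖ ^ p} ≤
      ENNReal.ofReal (Real.exp 4 * (2 * (h + r) * (b - a + 2 * r) * M) / (π * r ^ 2 * v)) := by
  set u : ℝ × ℝ → ENNReal := fun q => ENNReal.ofReal (‖F (q.1 + q.2 * I)‖ ^ p) with hu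
  have hum : Measurable u := by
    have : Measurable fun q : ℝ × ℝ => F (q.1 + q.2 * I) :=
      hm.comp (Continuous.measurable (by fun_prop))
    exact (this.norm.pow_const p).ennreal_ofReal
  set K : ℝ → ℝ → ENNReal := fun t t' => (Icc (t - (h + r)) (t + (h + r))).indicator 1 t' with hK
  have hKm : Measurable (Function.uncurry K) := by
    have : (Function.uncurry K) = {q : ℝ × ℝ | |q.2 - q.1| ≤ h + r}.indicator 1 := by
      ext q
      simp only [hK, Function.uncurry]
      by_cases hq : |q.2 - q.1| ≤ h + r
      · rw [indicator_of_mem, indicator_of_mem]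
        · rfl
        · exact hq
        · have := abs_le.1 hq; exact ⟨by linarith, by linarith⟩
      · rw [indicator_of_notMem, indicator_of_notMem]
        · exact hq
        · intro hc; exact hq (abs_le.2 ⟨by linarith [hc.1], by linarith [hc.2]⟩)
    rw [this]
    refine measurable_one.indicator ?_
    exact measurableSet_le (by fun_prop) (by fun_prop)
  set Φ : ℝ → ENNReal := fun t => ∫⁻ σ in Icc (a - r) (b + r), ∫⁻ t', K t t' * u (σ, t') with hΦ
  have hKum : Measurable fun q : (ℝ × ℝ) × ℝ => K q.1.1 q.2 * u (q.1.2, q.2) :=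
    (hKm.comp (f := fun q : (ℝ × ℝ) × ℝ => (q.1.1, q.2)) (by fun_prop)).mul
      (hum.comp (f := fun q : (ℝ × ℝ) × ℝ => (q.1.2, q.2)) (by fun_prop))
  have hin : Measurable fun q : ℝ × ℝ => ∫⁻ t', K q.1 t' * u (q.2, t') :=
    hKum.lintegral_prod_right'
  have hΦm : Measurable Φ := hin.lintegral_prod_right'
  -- the local sub-mean inequality
  have hloc : ∀ t : ℝ, (∃ s : ℂ, a ≤ s.re ∧ s.re ≤ b ∧ |s.im - t| ≤ h ∧ v ≤ ‖F s‖ ^ p) →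
      ENNReal.ofReal (π * r ^ 2 * v) ≤ Φ t := by
    rintro t ⟨s, hs1, hs2, hs3, hs4⟩
    have h1 := norm_rpow_le_square_integral (f := F) (c := s) hr hp hm (fun z hz => by
      have h3 : |(z - s).re| ≤ r := (Complex.abs_re_le_norm _).trans (by
        simpa [dist_eq_norm] using hz)
      have h4 := abs_le.1 h3
      rw [Complex.sub_re] at h4
      exact hF.analytic z (by linarith [h4.1]) (by linarith [h4.2]))
    refine le_trans (ENNReal.ofReal_le_ofReal (by gcongr)) (h1.trans ?_)
    have e1 : ∀ σ t' : ℝ, ENNReal.ofReal (‖F (s + (σ + t' * I))‖ ^ p) =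
        u (s.re + σ, s.im + t') := by
      intro σ t'
      simp only [hu]
      congr 4
      apply Complex.ext <;> simp
    simp only [e1]
    have hpre : ∀ c : ℝ, ∀ w : ℝ → ENNReal, ∫⁻ x in Icc (-r) r, w (c + x) =
        ∫⁻ x in Icc (c - r) (c + r), w x := by
      intro c w
      have hmp : MeasurePreserving (fun x : ℝ => c + x) volume volume :=
        measurePreserving_add_left volume c
      have := hmp.setLIntegral_comp_emb (measurableEmbedding_addLeft c) w (Icc (-r) r)
      rw [this]
      simp [sub_eq_add_neg, add_comm]
    rw [hpre s.re (fun x => ∫⁻ t' in Icc (-r) r, u (x, s.im + t'))]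
    have hpre2 : ∀ x : ℝ, ∫⁻ t' in Icc (-r) r, u (x, s.im + t') =
        ∫⁻ t' in Icc (s.im - r) (s.im + r), u (x, t') := fun x => hpre s.im fun y => u (x, y)
    simp only [hpre2]
    have hss : Icc (s.re - r) (s.re + r) ⊆ Icc (a - r) (b + r) :=
      Icc_subset_Icc (by linarith) (by linarith)
    refine (lintegral_mono_set hss).trans ?_
    refine lintegral_mono fun σ => ?_
    rw [← lintegral_indicator measurableSet_Icc]
    refine lintegral_mono fun t' => ?_
    by_cases ht : t' ∈ Icc (s.im - r) (s.im + r)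
    · rw [indicator_of_mem ht]
      have hh3 := abs_le.1 hs3
      have : t' ∈ Icc (t - (h + r)) (t + (h + r)) :=
        ⟨by linarith [ht.1, hh3.1], by linarith [ht.2, hh3.2]⟩
      simp only [hK, indicator_of_mem this, Pi.one_apply, one_mul]
      exact le_rfl
    · rw [indicator_of_notMem ht]
      exact zero_le
  -- the global bound
  have hKint : ∀ t' : ℝ, ∫⁻ t in Icc T (T + D), K t t' ≤
      ENNReal.ofReal (2 * (h + r)) * ENNReal.ofReal (Real.exp 4 * Real.exp (-((t' - T) / D) ^ 2)) := by
    intro t'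
    by_cases ht : |(t' - T) / D| ≤ 2
    · have h1 : ∫⁻ t in Icc T (T + D), K t t' ≤ ENNReal.ofReal (2 * (h + r)) := by
        calc ∫⁻ t in Icc T (T + D), K t t' ≤ ∫⁻ t, K t t' := setLIntegral_le_lintegral _ _
          _ = ∫⁻ t, (Icc (t' - (h + r)) (t' + (h + r))).indicator 1 t := by
              refine lintegral_congr fun t => ?_
              simp only [hK, indicator_apply, mem_Icc]
              congr 1
              rw [eq_iff_iff]
              constructor <;> rintro ⟨h1, h2⟩ <;> constructor <;> linarith
          _ = ENNReal.ofReal (2 * (h + r)) := by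
              rw [lintegral_indicator_one measurableSet_Icc, Real.volume_Icc]
              congr 1; ring
      refine h1.trans (le_mul_of_one_le_right' ?_)
      rw [← ENNReal.ofReal_one]
      exact ENNReal.ofReal_le_ofReal (exp_weight_le ht)
    · have : ∫⁻ t in Icc T (T + D), K t t' = 0 := by
        have hmm : Measurable fun t => K t t' :=
          hKm.comp (f := fun t : ℝ => (t, t')) (by fun_prop)
        rw [lintegral_eq_zero_iff hmm]
        filter_upwards [ae_restrict_mem measurableSet_Icc] with t htt
        simp only [hK, Pi.zero_apply]
        refine indicator_of_notMem (fun hc => ht ?_) _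
        rw [abs_le]
        constructor
        · rw [le_div_iff₀ hD]; linarith [hc.1, htt.1]
        · rw [div_le_iff₀ hD]; linarith [hc.2, htt.2]
      rw [this]; exact zero_le
  have hglob : ∫⁻ t in Icc T (T + D), Φ t ≤
      ENNReal.ofReal (Real.exp 4 * (2 * (h + r) * (b - a + 2 * r) * M)) := by
    have hsw : ∫⁻ t in Icc T (T + D), Φ t = ∫⁻ σ in Icc (a - r) (b + r), ∫⁻ t',
        (∫⁻ t in Icc T (T + D), K t t') * u (σ, t') := by
      simp only [hΦ]
      rw [lintegral_lintegral_swap hin.aemeasurable]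
      refine lintegral_congr fun σ => ?_
      rw [lintegral_lintegral_swap]
      · refine lintegral_congr fun t' => ?_
        rw [lintegral_mul_const]
        exact hKm.comp (f := fun t : ℝ => (t, t')) (by fun_prop)
      · exact (hKum.comp (f := fun q : ℝ × ℝ => ((q.1, σ), q.2)) (by fun_prop)).aemeasurable
    rw [hsw]
    have hM0 : 0 ≤ M := (gaussMean_nonneg F p T D a).trans
      (hM a ⟨by linarith, by linarith⟩)
    have hσ : ∀ σ ∈ Icc (a - r) (b + r), ∫⁻ t', (∫⁻ t in Icc T (T + D), K t t') * u (σ, t') ≤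
        ENNReal.ofReal (2 * (h + r) * Real.exp 4 * M) := by
      intro σ hσ
      calc ∫⁻ t', (∫⁻ t in Icc T (T + D), K t t') * u (σ, t')
          ≤ ∫⁻ t' : ℝ, ENNReal.ofReal (2 * (h + r) * Real.exp 4) *
            ENNReal.ofReal (‖F (σ + t' * I)‖ ^ p * Real.exp (-((t' - T) / D) ^ 2)) := by
            refine lintegral_mono fun t' => ?_
            refine (mul_le_mul_left (hKint t') _).trans (le_of_eq ?_)
            simp only [hu]
            rw [← ENNReal.ofReal_mul (by positivity), ← ENNReal.ofReal_mul (by positivity),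
              ← ENNReal.ofReal_mul (by positivity)]
            congr 1; ring
        _ = ENNReal.ofReal (2 * (h + r) * Real.exp 4) *
              ENNReal.ofReal (gaussMean F p T D σ) := by
            rw [lintegral_const_mul' _ _ ENNReal.ofReal_ne_top,
              lintegral_gaussMean hF hp hD hσ.1 hσ.2]
        _ ≤ _ := by
            rw [← ENNReal.ofReal_mul (by positivity)]
            exact ENNReal.ofReal_le_ofReal (by gcongr; exact hM σ hσ)
    refine (setLIntegral_mono' measurableSet_Icc hσ).trans ?_
    rw [setLIntegral_const, Real.volume_Icc, ← ENNReal.ofReal_mul (by positivity)]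
    refine ENNReal.ofReal_le_ofReal (le_of_eq ?_)
    ring
  have hpos : 0 < π * r ^ 2 * v := by positivity
  have hmk := mul_meas_ge_le_lintegral₀ (μ := volume.restrict (Icc T (T + D))) (f := Φ)
    hΦm.aemeasurable (ENNReal.ofReal (π * r ^ 2 * v))
  have hle := hmk.trans hglob
  rw [mul_comm, ← ENNReal.le_div_iff_mul_le (Or.inl (by simpa using hpos))
    (Or.inl ENNReal.ofReal_ne_top), ← ENNReal.ofReal_div_of_pos hpos] at hle
  refine le_trans ?_ hle
  rw [Measure.restrict_apply' measurableSet_Icc]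
  exact measure_mono fun t ht => ⟨hloc t ht.2, ht.1⟩

end

/-- The fractional part function, cut off to `(1, ∞)`. -/
def fractTail (u : ℝ) : ℂ := (Ioi (1:ℝ)).indicator (fun u => ((Int.fract u : ℝ) : ℂ)) u

theorem norm_fractTail_le (u : ℝ) : ‖fractTail u‖ ≤ 1 := by
  unfold fractTail
  refine (norm_indicator_le_norm_self _ _).trans ?_
  rw [Complex.norm_real, Real.norm_of_nonneg (Int.fract_nonneg u)]
  exact (Int.fract_lt_one u).le

theorem measurable_fractTail : Measurable fractTail :=
  (Complex.measurable_ofReal.comp measurable_fract).indicator measurableSet_Ioi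

theorem differentiableAt_mellin_fractTail {s : ℂ} (hs : 0 < s.re) :
    DifferentiableAt ℂ (fun s => mellin fractTail (-s)) s := by
  have h : DifferentiableAt ℂ (mellin fractTail) (-s) := by
    refine mellin_differentiableAt_of_isBigO_rpow (a := 0) (b := -s.re - 1) ?_ ?_ ?_ ?_ ?_
    · refine LocallyIntegrable.locallyIntegrableOn ?_ _
      refine (locallyIntegrable_const (1:ℝ)).mono measurable_fractTail.aestronglyMeasurable ?_
      exact Eventually.of_forall fun u => by simpa using norm_fractTail_le u
    · refine Asymptotics.IsBigO.of_bound 1 (Eventually.of_forall fun u => ?_)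
      simpa using norm_fractTail_le u
    · simpa using hs
    · refine Asymptotics.IsBigO.of_bound 1 ?_
      have : ∀ᶠ u : ℝ in nhdsWithin 0 (Ioi 0), u < 1 :=
        nhdsWithin_le_nhds (Iio_mem_nhds one_pos)
      filter_upwards [this] with u hu
      have : fractTail u = 0 := indicator_of_notMem (by simpa using hu.le) _
      rw [this]; simp
    · simp
  exact h.comp s (by fun_prop)

theorem mellin_fractTail (s : ℂ) : mellin fractTail (-s) =
    ∫ t : ℝ in Ioi 1, ((Int.fract t : ℝ) : ℂ) * (t : ℂ) ^ (-(s + 1)) := by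
  rw [mellin, ← integral_indicator measurableSet_Ioi, ← integral_indicator measurableSet_Ioi]
  refine integral_congr_ae (Eventually.of_forall fun t => ?_)
  simp only [indicator, fractTail, mem_Ioi]
  by_cases h1 : 1 < t
  · have h0 : 0 < t := by linarith
    rw [if_pos h0, if_pos h1, if_pos h1, smul_eq_mul, mul_comm]
    congr 2; ring
  · simp [h1]

theorem norm_mellin_fractTail_le {s : ℂ} (hs : 1 / 4 ≤ s.re) : ‖mellin fractTail (-s)‖ ≤ 4 := by
  rw [mellin_fractTail]
  have hinteg : IntegrableOn (fun t : ℝ => t ^ (-(s.re + 1))) (Ioi 1) :=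
    integrableOn_Ioi_rpow_of_lt (by linarith) one_pos
  refine (norm_integral_le_of_norm_le hinteg ?_).trans ?_
  · filter_upwards [ae_restrict_mem measurableSet_Ioi] with t ht
    have h0 : (0:ℝ) < t := by linarith [mem_Ioi.1 ht]
    rw [norm_mul, Complex.norm_real, Real.norm_of_nonneg (Int.fract_nonneg t),
      Complex.norm_cpow_eq_rpow_re_of_pos h0]
    simp only [neg_re, add_re, one_re]
    exact mul_le_of_le_one_left (by positivity) (Int.fract_lt_one t).le
  · rw [integral_Ioi_rpow_of_lt (by linarith) one_pos]
    simp only [Real.one_rpow]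
    rw [show -(s.re + 1) + 1 = -s.re by ring, neg_div_neg_eq, div_le_iff₀ (by linarith)]
    linarith

theorem riemannZeta₁_eq {s : ℂ} (hs : s ≠ 1) : riemannZeta₁ s = (s - 1) * riemannZeta s := by
  rw [riemannZeta_eq_inv_sub_mul hs, mul_inv_cancel_left₀ (sub_ne_zero.2 hs)]

theorem riemannZeta₁_eq_of_one_lt {s : ℂ} (hs : 1 < s.re) :
    riemannZeta₁ s = s - s * (s - 1) * mellin fractTail (-s) := by
  have hs1 : s ≠ 1 := by rintro rfl; simp at hs
  have hs0 : s - 1 ≠ 0 := sub_ne_zero.2 hs1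
  rw [riemannZeta₁_eq hs1, ← LSeries_one_eq_riemannZeta hs,
    LSeries_eq_mul_integral' 1 zero_le_one hs (by
      simp only [Pi.one_apply, norm_one, Finset.sum_const, Nat.card_Icc, add_tsub_cancel_right,
        nsmul_eq_mul, mul_one, Real.rpow_one]
      exact Asymptotics.isBigO_refl _ _), mellin_fractTail]
  have h1 : IntegrableOn (fun t : ℝ => (t : ℂ) ^ (-s)) (Ioi 1) :=
    integrableOn_Ioi_cpow_of_lt (by simpa using hs) one_pos
  have h2 : IntegrableOn (fun t : ℝ => ((Int.fract t : ℝ) : ℂ) * (t : ℂ) ^ (-(s + 1))) (Ioi 1) := by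
    have h3 : IntegrableOn (fun t : ℝ => (t : ℂ) ^ (-(s + 1))) (Ioi 1) :=
      integrableOn_Ioi_cpow_of_lt (by simp; linarith) one_pos
    refine Integrable.mono h3 ?_ ?_
    · exact (Complex.measurable_ofReal.comp measurable_fract).aestronglyMeasurable.mul
        h3.aestronglyMeasurable
    · refine Eventually.of_forall fun t => ?_
      rw [norm_mul, Complex.norm_real, Real.norm_of_nonneg (Int.fract_nonneg t)]
      exact mul_le_of_le_one_left (norm_nonneg _) (Int.fract_lt_one t).le
  have h4 : ∫ t in Ioi (1:ℝ), (∑ k ∈ Finset.Icc 1 ⌊t⌋₊, (1 : ℕ → ℂ) k) * (t : ℂ) ^ (-(s + 1)) =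
      (∫ t in Ioi (1:ℝ), (t : ℂ) ^ (-s)) -
      ∫ t in Ioi (1:ℝ), ((Int.fract t : ℝ) : ℂ) * (t : ℂ) ^ (-(s + 1)) := by
    rw [← integral_sub h1 h2]
    refine setIntegral_congr_fun measurableSet_Ioi fun t ht => ?_
    have h0 : (0:ℝ) < t := by linarith [mem_Ioi.1 ht]
    have h5 : ((⌊t⌋₊ : ℝ)) = t - Int.fract t := by
      rw [natCast_floor_eq_intCast_floor h0.le, ← Int.self_sub_fract]
    have h6 : (t : ℂ) ^ (-s) = t * (t : ℂ) ^ (-(s + 1)) := by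
      rw [show -s = 1 + -(s + 1) by ring,
        Complex.cpow_add _ _ (by exact_mod_cast h0.ne'), Complex.cpow_one]
    simp only [Pi.one_apply, Finset.sum_const, Nat.card_Icc, add_tsub_cancel_right,
      nsmul_eq_mul, mul_one]
    rw [show ((⌊t⌋₊ : ℂ)) = ((⌊t⌋₊ : ℝ) : ℂ) by simp, h5, h6]
    push_cast; ring
  rw [h4, integral_Ioi_cpow_of_lt (by simpa using hs) one_pos]
  simp only [ofReal_one, one_cpow]
  have h7 : -s + 1 ≠ 0 := by intro h; apply hs0; linear_combination -h
  field_simp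
  ring

theorem riemannZeta₁_eq_of_pos {s : ℂ} (hs : 0 < s.re) :
    riemannZeta₁ s = s - s * (s - 1) * mellin fractTail (-s) := by
  have hopen : IsOpen {s : ℂ | 0 < s.re} := isOpen_lt continuous_const Complex.continuous_re
  have hconn : IsPreconnected {s : ℂ | 0 < s.re} := (convex_halfSpace_re_gt 0).isPreconnected
  have h1 : AnalyticOnNhd ℂ riemannZeta₁ {s : ℂ | 0 < s.re} :=
    differentiable_riemannZeta₁.differentiableOn.analyticOnNhd hopen
  have h2 : AnalyticOnNhd ℂ (fun s => s - s * (s - 1) * mellin fractTail (-s))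
      {s : ℂ | 0 < s.re} := by
    refine DifferentiableOn.analyticOnNhd (fun z hz => ?_) hopen
    have := differentiableAt_mellin_fractTail (s := z) hz
    exact DifferentiableAt.differentiableWithinAt (by fun_prop)
  refine h1.eqOn_of_preconnected_of_eventuallyEq h2 hconn (z₀ := 2) (by simp) ?_ hs
  have : {s : ℂ | 1 < s.re} ∈ nhds (2:ℂ) :=
    (isOpen_lt continuous_const Complex.continuous_re).mem_nhds (by simp)
  filter_upwards [this] with z hz using riemannZeta₁_eq_of_one_lt hz

theorem norm_riemannZeta₁_le {s : ℂ} (hs : 1 / 4 ≤ s.re) :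
    ‖riemannZeta₁ s‖ ≤ 5 * (1 + ‖s‖) ^ 2 := by
  rw [riemannZeta₁_eq_of_pos (by linarith)]
  have h1 : ‖s - 1‖ ≤ ‖s‖ + 1 := by simpa using norm_sub_le s 1
  calc ‖s - s * (s - 1) * mellin fractTail (-s)‖
      ≤ ‖s‖ + ‖s‖ * ‖s - 1‖ * ‖mellin fractTail (-s)‖ := by
        refine (norm_sub_le _ _).trans ?_; rw [norm_mul, norm_mul]
    _ ≤ ‖s‖ + ‖s‖ * (‖s‖ + 1) * 4 := by
        gcongr
        exact norm_mellin_fractTail_le hs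
    _ ≤ _ := by nlinarith [norm_nonneg s]

open scoped ComplexConjugate


theorem norm_Gamma_le_Gamma_re {s : ℂ} (hs : 0 < s.re) : ‖Complex.Gamma s‖ ≤ Real.Gamma s.re := by
  rw [Complex.Gamma_eq_integral hs, Complex.GammaIntegral, Real.Gamma_eq_integral hs]
  refine (norm_integral_le_of_norm_le (Real.GammaIntegral_convergent hs) ?_)
  filter_upwards [ae_restrict_mem measurableSet_Ioi] with x hx
  rw [norm_mul, Complex.norm_cpow_eq_rpow_re_of_pos hx, Complex.norm_real,
    Real.norm_of_nonneg (Real.exp_pos _).le]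
  simp

theorem exists_norm_Gamma_le : ∃ C : ℝ, 0 ≤ C ∧ ∀ s : ℂ, 1 / 2 ≤ s.re → s.re ≤ 1 →
    ‖Complex.Gamma s‖ ≤ C := by
  have hc : ContinuousOn Real.Gamma (Icc (1/2) 1) := fun x hx =>
    (Real.differentiableAt_Gamma fun m => by
      have := hx.1
      have : (0:ℝ) ≤ m := Nat.cast_nonneg m
      linarith).continuousAt.continuousWithinAt
  obtain ⟨C, hC⟩ := isCompact_Icc.exists_bound_of_continuousOn hc
  refine ⟨|C|, abs_nonneg _, fun s h1 h2 => ?_⟩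
  refine (norm_Gamma_le_Gamma_re (by linarith)).trans ?_
  exact (le_abs_self _).trans ((hC s.re ⟨h1, h2⟩).trans (le_abs_self _))

theorem norm_cos_le_exp (z : ℂ) : ‖Complex.cos z‖ ≤ Real.exp |z.im| := by
  have h1 : ‖Complex.exp (z * I)‖ ≤ Real.exp |z.im| := by
    rw [Complex.norm_exp]; simpa using neg_le_abs z.im
  have h2 : ‖Complex.exp (-z * I)‖ ≤ Real.exp |z.im| := by
    rw [Complex.norm_exp]; simpa using le_abs_self z.im
  rw [Complex.cos, norm_div, Complex.norm_ofNat, div_le_iff₀ two_pos]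
  linarith [norm_add_le (Complex.exp (z * I)) (Complex.exp (-z * I))]

/-- The factor in the functional equation `ζ (1 - s) = χ(s) ζ(s)`. -/
def funcEqFactor (s : ℂ) : ℂ :=
  2 * (2 * (π : ℂ)) ^ (-s) * Complex.Gamma s * Complex.cos (π * s / 2)

theorem two_pi_arg_ne : ((2 : ℂ) * (π : ℂ)).arg ≠ π := by
  have : ((2 : ℂ) * (π : ℂ)) = ((2 * π : ℝ) : ℂ) := by push_cast; ring
  rw [this, Complex.arg_ofReal_of_nonneg (by positivity)]
  exact Real.pi_pos.ne

theorem funcEqFactor_conj (s : ℂ) : funcEqFactor (conj s) = conj (funcEqFactor s) := by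
  unfold funcEqFactor
  have c2 : conj (2 : ℂ) = 2 := Complex.conj_ofNat 2
  have h1 : conj ((2 * (π : ℂ)) ^ (-s)) = (2 * (π : ℂ)) ^ (-conj s) := by
    rw [← map_neg, Complex.cpow_conj _ _ two_pi_arg_ne]
    simp [Complex.conj_ofReal, c2]
  have h2 : conj (Complex.cos (π * s / 2)) = Complex.cos (π * conj s / 2) := by
    rw [← Complex.cos_conj]; simp [Complex.conj_ofReal, c2]
  rw [map_mul, map_mul, map_mul, h1, h2, ← Complex.Gamma_conj, c2]

theorem norm_funcEqFactor_half (t : ℝ) : ‖funcEqFactor ((1 / 2 : ℝ) + t * I)‖ = 1 := by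
  set s : ℂ := (1 / 2 : ℝ) + t * I with hs
  have hsin : Complex.sin (π * s) ≠ 0 := by
    have : Complex.sin (π * s) = Complex.cosh (π * t) := by
      rw [hs, show (π : ℂ) * (((1 / 2 : ℝ) : ℂ) + t * I) = (π * t) * I + π / 2 by push_cast; ring,
        Complex.sin_add_pi_div_two, Complex.cos_mul_I]
    rw [this]
    exact_mod_cast (Real.cosh_pos (π * t)).ne'
  have hconj : conj s = 1 - s := by
    apply Complex.ext
    · simp [hs]; norm_num
    · simp [hs]
  have hpi : (2 * (π : ℂ)) ≠ 0 := by simp [Real.pi_ne_zero]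
  have h1 : funcEqFactor s * conj (funcEqFactor s) = 1 := by
    rw [← funcEqFactor_conj, hconj]
    unfold funcEqFactor
    have h2 : (2 * (π : ℂ)) ^ (-s) * (2 * (π : ℂ)) ^ (-(1 - s)) = (2 * (π : ℂ))⁻¹ := by
      rw [← Complex.cpow_add _ _ hpi, show -s + -(1 - s) = -1 by ring, Complex.cpow_neg_one]
    have h3 := Complex.Gamma_mul_Gamma_one_sub s
    have h4 : Complex.cos (π * (1 - s) / 2) = Complex.sin (π * s / 2) := by
      rw [show (π : ℂ) * (1 - s) / 2 = π / 2 - π * s / 2 by ring, Complex.cos_pi_div_two_sub]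
    have h5 : Complex.sin (π * s) = 2 * Complex.sin (π * s / 2) * Complex.cos (π * s / 2) := by
      rw [← Complex.sin_two_mul]; congr 1; ring
    rw [h4]
    calc _ = 4 * ((2 * (π : ℂ)) ^ (-s) * (2 * (π : ℂ)) ^ (-(1 - s))) *
          (Complex.Gamma s * Complex.Gamma (1 - s)) *
          (Complex.sin (π * s / 2) * Complex.cos (π * s / 2)) := by ring
      _ = 4 * (2 * (π : ℂ))⁻¹ * (π / Complex.sin (π * s)) * (Complex.sin (π * s) / 2) := by
          rw [h2, h3, h5]; ring
      _ = 1 := by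
          have : (π : ℂ) ≠ 0 := by simp [Real.pi_ne_zero]
          field_simp
          norm_num
  rw [Complex.mul_conj, Complex.normSq_eq_norm_sq] at h1
  have h6 : ‖funcEqFactor s‖ ^ 2 = 1 := by exact_mod_cast h1
  nlinarith [norm_nonneg (funcEqFactor s)]

theorem norm_funcEqFactor_one (t : ℝ) : ‖funcEqFactor ((1 : ℝ) + t * I)‖ ^ 2 ≤ |t| := by
  set s : ℂ := (1 : ℝ) + t * I with hs
  have hpi0 : (π : ℂ) ≠ 0 := by simp [Real.pi_ne_zero]
  rcases eq_or_ne t 0 with ht | ht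
  · have : Complex.cos ((π : ℂ) * s / 2) = 0 := by
      rw [hs, ht]; simp [Complex.cos_pi_div_two]
    unfold funcEqFactor
    rw [this]; simp [ht]
  have hcosv : Complex.cos (π * s / 2) = -(Complex.sinh (π * t / 2) * I) := by
    rw [hs, show (π : ℂ) * (((1 : ℝ) : ℂ) + t * I) / 2 = (π * t / 2) * I + π / 2 by push_cast; ring,
      Complex.cos_add_pi_div_two, Complex.sin_mul_I]
  have hsinv : Complex.sin (π * s / 2) = Complex.cosh (π * t / 2) := by
    rw [hs, show (π : ℂ) * (((1 : ℝ) : ℂ) + t * I) / 2 = (π * t / 2) * I + π / 2 by push_cast; ring,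
      Complex.sin_add_pi_div_two, Complex.cos_mul_I]
  have hsin0 : Complex.sin (π * s / 2) ≠ 0 := by
    rw [hsinv]; exact_mod_cast (Real.cosh_pos (π * t / 2)).ne'
  have hcos0 : Complex.cos (π * s / 2) ≠ 0 := by
    rw [hcosv]
    simp only [ne_eq, neg_eq_zero, mul_eq_zero, I_ne_zero, or_false]
    have : Real.sinh (π * t / 2) ≠ 0 := by
      rw [Ne, Real.sinh_eq_zero]; have := Real.pi_pos; positivity
    exact_mod_cast this
  have hratio : ‖Complex.cos (π * s / 2)‖ ≤ ‖Complex.sin (π * s / 2)‖ := by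
    rw [hsinv, hcosv, norm_neg, norm_mul, Complex.norm_I, mul_one]
    have h1 : Complex.sinh (π * t / 2) = (Real.sinh (π * t / 2) : ℝ) := by push_cast; rfl
    have h2 : Complex.cosh (π * t / 2) = (Real.cosh (π * t / 2) : ℝ) := by push_cast; rfl
    rw [h1, h2, Complex.norm_real, Complex.norm_real]
    rw [Real.norm_eq_abs, Real.norm_eq_abs, ← sq_le_sq]
    nlinarith [Real.cosh_sq (π * t / 2)]
  have hconj : conj s = 2 - s := by
    apply Complex.ext
    · simp [hs]; norm_num
    · simp [hs]
  have hpi : (2 * (π : ℂ)) ≠ 0 := by simp [Real.pi_ne_zero]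
  have h1s : 1 - s ≠ 0 := by
    rw [hs]; intro h
    have := congrArg Complex.im h
    simp at this
    exact ht this
  have h1 : funcEqFactor s * conj (funcEqFactor s) =
      -(1 - s) / (2 * π) * (Complex.cos (π * s / 2) / Complex.sin (π * s / 2)) := by
    rw [← funcEqFactor_conj, hconj]
    unfold funcEqFactor
    have h2 : (2 * (π : ℂ)) ^ (-s) * (2 * (π : ℂ)) ^ (-(2 - s)) = ((2 * (π : ℂ)) ^ 2)⁻¹ := by
      rw [← Complex.cpow_add _ _ hpi, show -s + -(2 - s) = -(2 : ℕ) by push_cast; ring,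
        Complex.cpow_neg, Complex.cpow_natCast]
    have h3 := Complex.Gamma_mul_Gamma_one_sub s
    have h3' : Complex.Gamma (2 - s) = (1 - s) * Complex.Gamma (1 - s) := by
      rw [← Complex.Gamma_add_one _ h1s]; congr 1; ring
    have h4 : Complex.cos (π * (2 - s) / 2) = - Complex.cos (π * s / 2) := by
      rw [show (π : ℂ) * (2 - s) / 2 = π - π * s / 2 by ring, Complex.cos_pi_sub]
    have h5 : Complex.sin (π * s) = 2 * Complex.sin (π * s / 2) * Complex.cos (π * s / 2) := by
      rw [← Complex.sin_two_mul]; congr 1; ring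
    rw [h4, h3']
    calc _ = -4 * ((2 * (π : ℂ)) ^ (-s) * (2 * (π : ℂ)) ^ (-(2 - s))) *
          (Complex.Gamma s * Complex.Gamma (1 - s)) * (1 - s) *
          Complex.cos (π * s / 2) ^ 2 := by ring
      _ = -4 * ((2 * (π : ℂ)) ^ 2)⁻¹ * (π / (2 * Complex.sin (π * s / 2) * Complex.cos (π * s / 2)))
          * (1 - s) * Complex.cos (π * s / 2) ^ 2 := by
          rw [h2, h3, h5]
      _ = _ := by
          field_simp
          norm_num
  have h6 := congrArg norm h1
  rw [norm_mul, RCLike.norm_conj, ← pow_two] at h6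
  rw [h6, norm_mul, norm_div, norm_div, norm_neg]
  have h7 : ‖(1:ℂ) - s‖ = |t| := by
    rw [hs]; push_cast
    rw [show (1:ℂ) - (1 + t * I) = -(t * I) by ring, norm_neg, norm_mul, Complex.norm_I,
      Complex.norm_real, mul_one, Real.norm_eq_abs]
  have h8 : ‖(2 * (π:ℂ))‖ = 2 * π := by
    rw [norm_mul, Complex.norm_real, Real.norm_of_nonneg Real.pi_pos.le]; simp
  have h9 : ‖Complex.cos (π * s / 2)‖ / ‖Complex.sin (π * s / 2)‖ ≤ 1 :=
    div_le_one_of_le₀ hratio (norm_nonneg _)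
  rw [h7, h8]
  calc |t| / (2 * π) * (‖Complex.cos (π * s / 2)‖ / ‖Complex.sin (π * s / 2)‖)
      ≤ |t| / (2 * π) * 1 := by gcongr
    _ ≤ |t| := by
      rw [mul_one, div_le_iff₀ (by positivity)]
      nlinarith [abs_nonneg t, Real.pi_gt_three]

theorem norm_two_pi_cpow_le {s : ℂ} (hs : 0 ≤ s.re) : ‖(2 * (π : ℂ)) ^ (-s)‖ ≤ 1 := by
  have : ((2 : ℂ) * (π : ℂ)) = ((2 * π : ℝ) : ℂ) := by push_cast; ring
  rw [this, Complex.norm_cpow_eq_rpow_re_of_pos (by positivity)]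
  apply Real.rpow_le_one_of_one_le_of_nonpos
  · nlinarith [Real.pi_gt_three]
  · simpa using hs

theorem differentiableAt_funcEqFactor {s : ℂ} (hs : 0 < s.re) :
    DifferentiableAt ℂ funcEqFactor s := by
  unfold funcEqFactor
  have hpi : (2 * (π : ℂ)) ≠ 0 := by simp [Real.pi_ne_zero]
  have h1 : DifferentiableAt ℂ Complex.Gamma s := Complex.differentiableAt_Gamma _ fun m h => by
    rw [h] at hs; simp at hs
    linarith [(Nat.cast_nonneg m : (0:ℝ) ≤ m)]
  have h2 : DifferentiableAt ℂ (fun s : ℂ => (2 * (π : ℂ)) ^ (-s)) s :=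
    DifferentiableAt.const_cpow (by fun_prop) (Or.inl hpi)
  exact ((h2.const_mul 2).mul h1).mul (by fun_prop)

theorem norm_funcEqFactor_le {s : ℂ} (h1 : 1 / 2 ≤ s.re) (h2 : s.re ≤ 1) (ht : 1 ≤ |s.im|) :
    ‖funcEqFactor s‖ ≤ Real.exp 1 * |s.im| ^ (s.re - 1 / 2) := by
  set τ := |s.im| with hτ
  have hτ0 : 0 < τ := by linarith
  obtain ⟨C, hC0, hC⟩ := exists_norm_Gamma_le
  set g : ℂ → ℂ := fun z => funcEqFactor z * (Complex.exp ((z - s) ^ 2) * (τ : ℂ) ^ (-(z - 1 / 2)))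
    with hg
  have hexp : ∀ z : ℂ, ‖Complex.exp ((z - s) ^ 2)‖ =
      Real.exp ((z.re - s.re) ^ 2 - (z.im - s.im) ^ 2) := by
    intro z
    rw [Complex.norm_exp]; congr 1
    simp [pow_two]
  have hpow : ∀ z : ℂ, ‖(τ : ℂ) ^ (-(z - 1 / 2))‖ = τ ^ (1 / 2 - z.re) := by
    intro z
    rw [Complex.norm_cpow_eq_rpow_re_of_pos hτ0]
    congr 1; simp
  have hgn : ∀ z : ℂ, ‖g z‖ = ‖funcEqFactor z‖ *
      (Real.exp ((z.re - s.re) ^ 2 - (z.im - s.im) ^ 2) * τ ^ (1 / 2 - z.re)) := by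
    intro z; rw [hg, norm_mul, norm_mul, hexp, hpow]
  have hdiff : ∀ z : ℂ, 0 < z.re → DifferentiableAt ℂ g z := by
    intro z hz
    have h3 : DifferentiableAt ℂ (fun z : ℂ => (τ : ℂ) ^ (-(z - 1 / 2))) z :=
      DifferentiableAt.const_cpow (by fun_prop) (Or.inl (by exact_mod_cast hτ0.ne'))
    exact (differentiableAt_funcEqFactor hz).mul (DifferentiableAt.mul (by fun_prop) h3)
  have hbd : ∃ B : ℝ, ∀ z : ℂ, 1 / 2 ≤ z.re → z.re ≤ 1 → ‖g z‖ ≤ B := by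
    refine ⟨2 * C * Real.exp (π * τ / 2 + π ^ 2 / 16) * (Real.exp 1 * 1), fun z h3 h4 => ?_⟩
    have h5 : ‖funcEqFactor z‖ ≤ 2 * C * Real.exp (π * |z.im| / 2) := by
      unfold funcEqFactor
      rw [norm_mul, norm_mul, norm_mul]
      have h6 := norm_two_pi_cpow_le (s := z) (by linarith)
      have h7 := hC z h3 h4
      have h8 : ‖Complex.cos (π * z / 2)‖ ≤ Real.exp (π * |z.im| / 2) := by
        refine (norm_cos_le_exp _).trans_eq ?_
        congr 1
        have : ((π : ℂ) * z / 2).im = π * z.im / 2 := by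
          rw [show (π : ℂ) * z / 2 = ((π / 2 : ℝ) : ℂ) * z by push_cast; ring,
            Complex.im_ofReal_mul]; ring
        rw [this, abs_div, abs_mul, abs_of_pos Real.pi_pos, abs_two]
      calc _ ≤ ‖(2:ℂ)‖ * 1 * C * Real.exp (π * |z.im| / 2) := by gcongr
        _ = _ := by simp
    have h6 : τ ^ (1 / 2 - z.re) ≤ 1 :=
      Real.rpow_le_one_of_one_le_of_nonpos ht (by linarith)
    have h7 : |z.im| ≤ τ + |z.im - s.im| := by
      have := abs_add_le s.im (z.im - s.im); simp only [add_sub_cancel] at this; linarith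
    have h9 : (z.re - s.re) ^ 2 ≤ 1 := by nlinarith
    rw [hgn]
    calc _ ≤ 2 * C * Real.exp (π * |z.im| / 2) *
          (Real.exp ((z.re - s.re) ^ 2 - (z.im - s.im) ^ 2) * 1) := by gcongr
      _ ≤ 2 * C * (Real.exp (π * |z.im| / 2) * Real.exp ((z.re - s.re) ^ 2 - (z.im - s.im) ^ 2)) :=
          by rw [mul_one, mul_assoc (2 * C)]
      _ ≤ 2 * C * (Real.exp (π * τ / 2 + π ^ 2 / 16) * Real.exp 1) := by
          rw [← Real.exp_add, ← Real.exp_add]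
          gcongr 2 * C * Real.exp ?_
          rw [← sq_abs (z.im - s.im)]
          nlinarith [sq_nonneg (|z.im - s.im| - π / 4), Real.pi_pos]
      _ = _ := by ring
  obtain ⟨B, hB⟩ := hbd
  have hline : ∀ z : ℂ, z.re = 1 / 2 ∨ z.re = 1 → ‖g z‖ ≤ Real.exp 1 := by
    intro z hz
    rw [hgn]
    set u := |z.im - s.im| with hu
    rw [← sq_abs (z.im - s.im), ← hu]
    have hu0 : 0 ≤ u := abs_nonneg _
    have h9 : (z.re - s.re) ^ 2 ≤ 1 / 4 := by
      rcases hz with h | h <;> rw [h] <;> nlinarith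
    rcases hz with h | h
    · have h3 : ‖funcEqFactor z‖ = 1 := by
        have := norm_funcEqFactor_half z.im
        rwa [← h, Complex.re_add_im] at this
      rw [h3, h]; simp only [sub_self, Real.rpow_zero, one_mul, mul_one]
      rw [h] at h9
      gcongr
      nlinarith
    · have h3 : ‖funcEqFactor z‖ ^ 2 ≤ |z.im| := by
        have := norm_funcEqFactor_one z.im
        rwa [← h, Complex.re_add_im] at this
      have h4 : ‖funcEqFactor z‖ ≤ |z.im| ^ (1 / 2 : ℝ) := by
        rw [← Real.sqrt_eq_rpow]; exact Real.le_sqrt_of_sq_le h3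
      have h7 : |z.im| ≤ τ + u := by
        have := abs_add_le s.im (z.im - s.im); simp only [add_sub_cancel] at this; linarith
      have h8 : |z.im| ≤ τ * Real.exp u := by nlinarith [Real.add_one_le_exp u]
      have h10 : |z.im| ^ (1 / 2 : ℝ) ≤ τ ^ (1 / 2 : ℝ) * Real.exp (u / 2) := by
        calc _ ≤ (τ * Real.exp u) ^ (1 / 2 : ℝ) := by gcongr
          _ = _ := by
            rw [Real.mul_rpow hτ0.le (Real.exp_pos _).le, ← Real.exp_mul]
            congr 2; ring
      calc _ ≤ (τ ^ (1 / 2 : ℝ) * Real.exp (u / 2)) *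
            (Real.exp (1 / 4 - u ^ 2) * τ ^ (1 / 2 - z.re)) := by
              gcongr
              exact h4.trans h10
        _ = (τ ^ (1 / 2 : ℝ) * τ ^ (1 / 2 - z.re)) * (Real.exp (u / 2) * Real.exp (1 / 4 - u ^ 2)) := by
            ring
        _ = Real.exp (u / 2 + (1 / 4 - u ^ 2)) := by
            rw [← Real.rpow_add hτ0, h, ← Real.exp_add]; norm_num
        _ ≤ Real.exp 1 := by
            gcongr; nlinarith [sq_nonneg (u - 1 / 4)]
  have key : ‖g s‖ ≤ Real.exp 1 := by
    refine PhragmenLindelof.vertical_strip (a := 1 / 2) (b := 1) ?_ ?_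
      (fun z hz => hline z (Or.inl hz)) (fun z hz => hline z (Or.inr hz)) h1 h2
    · refine DifferentiableOn.diffContOnCl fun z hz => ?_
      rw [Complex.closure_preimage_re, closure_Ioo (by norm_num)] at hz
      exact (hdiff z (by have := hz.1; linarith)).differentiableWithinAt
    · refine ⟨0, by have := Real.pi_pos; norm_num; exact this, 0, ?_⟩
      refine Asymptotics.IsBigO.of_bound B ?_
      refine eventually_inf_principal.2 (Eventually.of_forall fun z hz => ?_)
      simpa using hB z hz.1.le hz.2.le
  rw [hgn] at key
  simp only [sub_self, ne_eq, OfNat.ofNat_ne_zero, not_false_eq_true, zero_pow, Real.exp_zero,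
    one_mul] at key
  have h3 : τ ^ (1 / 2 - s.re) * τ ^ (s.re - 1 / 2) = 1 := by
    rw [← Real.rpow_add hτ0]; simp
  calc ‖funcEqFactor s‖ = ‖funcEqFactor s‖ * τ ^ (1 / 2 - s.re) * τ ^ (s.re - 1 / 2) := by
        rw [mul_assoc, h3, mul_one]
    _ ≤ _ := by gcongr

theorem norm_riemannZeta_reflect {x t : ℝ} (hx : 0 ≤ x) (hx' : x ≤ 1 / 2) (ht : 1 ≤ |t|) :
    ‖riemannZeta ((1 / 2 - x : ℝ) + t * I)‖ ≤
      Real.exp 1 * |t| ^ x * ‖riemannZeta ((1 / 2 + x : ℝ) + t * I)‖ := by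
  set s : ℂ := (1 / 2 + x : ℝ) + (-t : ℝ) * I with hs
  have hre : s.re = 1 / 2 + x := by rw [hs]; exact line_re _ _
  have him : s.im = -t := by rw [hs]; exact line_im _ _
  have him0 : s.im ≠ 0 := by
    rw [him]; intro h
    have : t = 0 := by linarith
    rw [this] at ht; norm_num at ht
  have h1 : riemannZeta (1 - s) = funcEqFactor s * riemannZeta s := by
    refine riemannZeta_one_sub (fun n h => ?_) fun h => ?_
    · rw [h] at hre; simp at hre; linarith [(Nat.cast_nonneg n : (0:ℝ) ≤ n)]
    · apply him0; rw [h]; simp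
  have h2 : (((1 / 2 - x : ℝ) : ℂ) + t * I) = 1 - s := by
    rw [hs]; push_cast; ring
  have h3 : s = conj (((1 / 2 + x : ℝ) : ℂ) + t * I) := by
    apply Complex.ext
    · simp [hre]
    · simp [him]
  have h4 : ‖riemannZeta s‖ = ‖riemannZeta ((1 / 2 + x : ℝ) + t * I)‖ := by
    rw [h3, riemannZeta_conj, RCLike.norm_conj]
  rw [h2, h1, norm_mul, h4]
  gcongr
  have h5 := norm_funcEqFactor_le (s := s) (by linarith) (by linarith) (by rw [him, abs_neg]; exact ht)
  rwa [hre, him, abs_neg, show 1 / 2 + x - 1 / 2 = x by ring] at h5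

/-- A bounded factor on the right half plane cancelling the pole of `ζ`. -/
def poleFactor (s : ℂ) : ℂ := (s - 1) / (s + 1)

/-- The Riemann zeta function with its pole removed. -/
def zetaStar (s : ℂ) : ℂ := riemannZeta₁ s / (s + 1)

theorem zetaStar_eq {s : ℂ} (hs : s ≠ 1) : zetaStar s = poleFactor s * riemannZeta s := by
  rw [zetaStar, poleFactor, riemannZeta₁_eq hs]; ring

theorem add_one_ne_zero_of_re {s : ℂ} (hs : 0 ≤ s.re) : s + 1 ≠ 0 := by
  intro h
  have := congrArg Complex.re h
  simp at this; linarith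

theorem one_le_norm_add_one {s : ℂ} (hs : 0 ≤ s.re) : 1 ≤ ‖s + 1‖ := by
  have := Complex.re_le_norm (s + 1)
  simp at this; linarith

theorem norm_poleFactor_le {s : ℂ} (hs : 0 ≤ s.re) : ‖poleFactor s‖ ≤ 1 := by
  rw [poleFactor, norm_div]
  refine div_le_one_of_le₀ ?_ (norm_nonneg _)
  rw [← sq_le_sq₀ (norm_nonneg _) (norm_nonneg _), Complex.sq_norm, Complex.sq_norm,
    Complex.normSq_apply, Complex.normSq_apply]
  simp; nlinarith

theorem half_le_norm_poleFactor {s : ℂ} (hs : 0 ≤ s.re) (ht : 4 ≤ |s.im|) :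
    1 / 2 ≤ ‖poleFactor s‖ := by
  have h1 := add_one_ne_zero_of_re hs
  have h2 : 4 ≤ ‖s + 1‖ := by
    have := Complex.abs_im_le_norm (s + 1)
    simp at this; linarith
  have h3 : poleFactor s = 1 - 2 / (s + 1) := by
    rw [poleFactor]; field_simp; ring
  have h4 : ‖(2:ℂ) / (s + 1)‖ ≤ 1 / 2 := by
    rw [norm_div, Complex.norm_ofNat, div_le_iff₀ (by linarith)]; linarith
  rw [h3]
  have := norm_sub_norm_le (1:ℂ) (2 / (s + 1))
  rw [norm_one] at this
  linarith

theorem ne_one_of_im {s : ℂ} (hs : s.im ≠ 0) : s ≠ 1 := fun h => hs (by rw [h]; simp)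

theorem norm_zetaStar_le_norm_riemannZeta {s : ℂ} (hs : 0 ≤ s.re) (ht : s.im ≠ 0) :
    ‖zetaStar s‖ ≤ ‖riemannZeta s‖ := by
  rw [zetaStar_eq (ne_one_of_im ht), norm_mul]
  exact mul_le_of_le_one_left (norm_nonneg _) (norm_poleFactor_le hs)

theorem norm_riemannZeta_le_zetaStar {s : ℂ} (hs : 0 ≤ s.re) (ht : 4 ≤ |s.im|) :
    ‖riemannZeta s‖ ≤ 2 * ‖zetaStar s‖ := by
  have h0 : s.im ≠ 0 := by intro h; rw [h] at ht; norm_num at ht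
  rw [zetaStar_eq (ne_one_of_im h0), norm_mul]
  nlinarith [half_le_norm_poleFactor hs ht, norm_nonneg (riemannZeta s)]

theorem measurable_zetaStar : Measurable zetaStar :=
  differentiable_riemannZeta₁.continuous.measurable.div (by fun_prop)

theorem stripGrowth_poleFactor {a b : ℝ} (ha : 0 ≤ a) : StripGrowth poleFactor a b := by
  refine ⟨fun s h1 _ => ?_, 1, 0, zero_le_one, fun s h1 _ => ?_⟩
  · unfold poleFactor
    exact (analyticAt_id.sub analyticAt_const).div (analyticAt_id.add analyticAt_const)
      (add_one_ne_zero_of_re (ha.trans h1))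
  · simpa using norm_poleFactor_le (ha.trans h1)

theorem norm_zetaStar_le {s : ℂ} (hs : 1 / 4 ≤ s.re) :
    ‖zetaStar s‖ ≤ 5 * (1 + ‖s‖) ^ 2 := by
  rw [zetaStar, norm_div]
  exact (div_le_self (norm_nonneg _) (one_le_norm_add_one (by linarith))).trans
    (norm_riemannZeta₁_le hs)

theorem stripGrowth_zetaStar {a b : ℝ} (ha : 1 / 4 ≤ a) : StripGrowth zetaStar a b := by
  refine ⟨fun s h1 _ => ?_, 5 * (1 + |b|) ^ 2, 2, by positivity, fun s h1 h2 => ?_⟩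
  · unfold zetaStar
    exact (differentiable_riemannZeta₁.analyticAt s).div (analyticAt_id.add analyticAt_const)
      (add_one_ne_zero_of_re (by linarith))
  · have h3 : ‖s‖ ≤ |b| + |s.im| := by
      refine (Complex.norm_le_abs_re_add_abs_im s).trans ?_
      rw [abs_of_nonneg (by linarith : 0 ≤ s.re)]
      linarith [le_abs_self b]
    refine (norm_zetaStar_le (ha.trans h1)).trans ?_
    rw [mul_assoc, ← mul_pow]
    gcongr
    nlinarith [mul_nonneg (abs_nonneg b) (abs_nonneg s.im)]

theorem norm_zetaStar_reflect {x t : ℝ} (hx : 0 ≤ x) (hx' : x ≤ 1 / 2) (ht : 4 ≤ |t|) :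
    ‖zetaStar ((1 / 2 - x : ℝ) + t * I)‖ ≤
      2 * Real.exp 1 * |t| ^ x * ‖zetaStar ((1 / 2 + x : ℝ) + t * I)‖ := by
  have h0 : t ≠ 0 := by intro h; rw [h] at ht; norm_num at ht
  refine (norm_zetaStar_le_norm_riemannZeta (by rw [line_re]; linarith)
    (by rw [line_im]; exact h0)).trans ?_
  refine (norm_riemannZeta_reflect hx hx' (by linarith)).trans ?_
  have := norm_riemannZeta_le_zetaStar (s := (1 / 2 + x : ℝ) + t * I)
    (by rw [line_re]; linarith) (by rw [line_im]; exact ht)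
  calc _ ≤ Real.exp 1 * |t| ^ x * (2 * ‖zetaStar ((1 / 2 + x : ℝ) + t * I)‖) := by gcongr
    _ = _ := by ring

theorem norm_gaussian_fourier_le {T D : ℝ} (hD : 0 < D) (μ : ℝ) :
    ‖∫ t : ℝ, Complex.exp (I * μ * t) * (Real.exp (-((t - T) / D) ^ 2) : ℝ)‖ ≤
      2 * D * Real.exp (-(μ * D) ^ 2 / 4) := by
  have hb : 0 < (((1 / D ^ 2 : ℝ)) : ℂ).re := by rw [Complex.ofReal_re]; positivity
  have h1 := fourierIntegral_gaussian hb (μ : ℂ)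
  have h2 : ∫ t : ℝ, Complex.exp (I * μ * t) * (Real.exp (-((t - T) / D) ^ 2) : ℝ) =
      Complex.exp (I * μ * T) *
        ∫ x : ℝ, Complex.exp (I * μ * x) * Complex.exp (-((1 / D ^ 2 : ℝ) : ℂ) * x ^ 2) := by
    rw [← integral_const_mul, ← integral_add_right_eq_self _ T]
    congr 1; funext x
    rw [← mul_assoc, ← Complex.exp_add, Complex.ofReal_exp]
    congr 1
    · congr 1; push_cast; ring
    · congr 1; push_cast; simp only [add_sub_cancel_right]; ring
  rw [h2, norm_mul, h1, norm_mul]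
  have h3 : ‖Complex.exp (I * μ * T)‖ = 1 := by
    rw [show I * (μ : ℂ) * T = ((μ * T : ℝ) : ℂ) * I by push_cast; ring, Complex.norm_exp_ofReal_mul_I]
  have h4 : ‖((π : ℂ) / ((1 / D ^ 2 : ℝ) : ℂ)) ^ (1 / 2 : ℂ)‖ ≤ 2 * D := by
    rw [← Complex.ofReal_div, Complex.norm_cpow_eq_rpow_re_of_pos (by positivity)]
    have : (1 / 2 : ℂ).re = 1 / 2 := by norm_num
    rw [this, ← Real.sqrt_eq_rpow, Real.sqrt_le_left (by positivity)]
    rw [div_div_eq_mul_div, div_one]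
    nlinarith [Real.pi_lt_four, sq_nonneg D]
  have h5 : ‖Complex.exp (-(μ : ℂ) ^ 2 / (4 * ((1 / D ^ 2 : ℝ) : ℂ)))‖ =
      Real.exp (-(μ * D) ^ 2 / 4) := by
    have : -(μ : ℂ) ^ 2 / (4 * ((1 / D ^ 2 : ℝ) : ℂ)) = ((-(μ * D) ^ 2 / 4 : ℝ) : ℂ) := by
      push_cast; field_simp
    rw [this, ← Complex.ofReal_exp, Complex.norm_real, Real.norm_of_nonneg (Real.exp_pos _).le]
  rw [h3, h5, one_mul]
  gcongr

theorem sum_geometric_le (M : ℕ) : ∑ j ∈ Finset.range M, (1 / 2 : ℝ) ^ j ≤ 2 := by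
  rw [geom_sum_eq (by norm_num)]
  have : (0:ℝ) ≤ (1 / 2) ^ M := by positivity
  rw [div_le_iff_of_neg (by norm_num)]; linarith

theorem sum_half_pow_le_of_injOn {u : Finset ℕ} {d : ℕ → ℕ} (hd : Set.InjOn d u) :
    ∑ k ∈ u, (1 / 2 : ℝ) ^ d k ≤ 2 := by
  rw [← Finset.sum_image (f := fun j : ℕ => (1 / 2 : ℝ) ^ j) (g := d) hd]
  obtain ⟨M, hM⟩ := (u.image d).exists_nat_subset_range
  exact (Finset.sum_le_sum_of_subset_of_nonneg hM fun _ _ _ => by positivity).trans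
    (sum_geometric_le M)

theorem sum_half_pow_dist_le (m : ℕ) (u : Finset ℕ) :
    ∑ k ∈ u, (1 / 2 : ℝ) ^ (Nat.dist m k) ≤ 4 := by
  classical
  rw [← Finset.sum_filter_add_sum_filter_not _ (fun k => k ≤ m)]
  have h1 : ∑ k ∈ u.filter (fun k => k ≤ m), (1 / 2 : ℝ) ^ (Nat.dist m k) ≤ 2 :=
    sum_half_pow_le_of_injOn fun k hk l hl h => by
      simp only [Finset.coe_filter, Set.mem_setOf_eq, Nat.dist] at hk hl h; omega
  have h2 : ∑ k ∈ u.filter (fun k => ¬ k ≤ m), (1 / 2 : ℝ) ^ (Nat.dist m k) ≤ 2 :=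
    sum_half_pow_le_of_injOn fun k hk l hl h => by
      simp only [Finset.coe_filter, Set.mem_setOf_eq, Nat.dist] at hk hl h; omega
  linarith

theorem dist_le_mul_abs_log_sub {m k N : ℕ} (hm : 1 ≤ m) (hk : 1 ≤ k) (hmN : m ≤ N) (hkN : k ≤ N) :
    (Nat.dist m k : ℝ) ≤ N * |Real.log m - Real.log k| := by
  have key : ∀ a b : ℕ, 1 ≤ a → a ≤ b → b ≤ N → ((b : ℝ) - a) ≤ N * (Real.log b - Real.log a) := by
    intro a b ha hab hb
    have ha0 : (0:ℝ) < a := by exact_mod_cast ha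
    have hb0 : (0:ℝ) < b := by exact_mod_cast ha.trans hab
    have h1 := Real.one_sub_inv_le_log_of_pos (div_pos hb0 ha0)
    rw [Real.log_div hb0.ne' ha0.ne', inv_div] at h1
    have h2 : 0 ≤ Real.log b - Real.log a := by
      have := Real.log_le_log ha0 (by exact_mod_cast hab : (a:ℝ) ≤ b)
      linarith
    have h3 : (b : ℝ) ≤ N := by exact_mod_cast hb
    have h4 : (b : ℝ) - a = b * (1 - a / b) := by field_simp
    calc (b : ℝ) - a = b * (1 - a / b) := h4
      _ ≤ b * (Real.log b - Real.log a) := by gcongr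
      _ ≤ _ := by gcongr
  rcases le_total m k with h | h
  · rw [Nat.dist_eq_sub_of_le h, abs_sub_comm, Nat.cast_sub h]
    exact (key m k hm h hkN).trans (by gcongr; exact le_abs_self _)
  · rw [Nat.dist_eq_sub_of_le_right h, Nat.cast_sub h]
    exact (key k m hk h hmN).trans (by gcongr; exact le_abs_self _)

theorem gauss_kernel_le {m k N : ℕ} {D e : ℝ} (hm : 1 ≤ m) (hk : 1 ≤ k) (hmN : m ≤ N) (hkN : k ≤ N)
    (hD : 2 * N ≤ D) (he : 1 ≤ e) :
    Real.exp (-(e * (Real.log m - Real.log k) * D) ^ 2 / 4) ≤ (1 / 2) ^ Nat.dist m k := by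
  have h1 := dist_le_mul_abs_log_sub hm hk hmN hkN
  set d := Nat.dist m k
  set l := Real.log m - Real.log k
  have h2 : 2 * (d : ℝ) ≤ e * |l| * D := by
    calc 2 * (d : ℝ) ≤ 2 * (N * |l|) := by linarith
      _ = 1 * |l| * (2 * N) := by ring
      _ ≤ e * |l| * D := by gcongr
  have h3 : (2 * (d : ℝ)) ^ 2 ≤ (e * l * D) ^ 2 := by
    rw [← sq_abs (e * l * D), abs_mul, abs_mul, abs_of_nonneg (by linarith : 0 ≤ e),
      abs_of_nonneg (by have : (0:ℝ) ≤ N := Nat.cast_nonneg N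
                        linarith : 0 ≤ D)]
    gcongr
  have h4 : (d : ℝ) ≤ d ^ 2 := by exact_mod_cast Nat.le_self_pow two_ne_zero d
  calc Real.exp (-(e * l * D) ^ 2 / 4) ≤ Real.exp (-1 * d) := by gcongr; nlinarith
    _ = Real.exp (-1) ^ d := by rw [← Real.exp_nat_mul]; ring_nf
    _ ≤ (1 / 2) ^ d := by
      gcongr
      rw [Real.exp_neg, one_div]
      gcongr
      linarith [Real.add_one_le_exp 1]

/-- The finite Dirichlet polynomial with coefficients `a`. -/
def dirPoly (a : ℕ → ℂ) (N : ℕ) (s : ℂ) : ℂ := ∑ m ∈ Finset.Icc 1 N, a m * (m : ℂ) ^ (-s)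

theorem norm_natCast_cpow_neg {m : ℕ} (hm : 1 ≤ m) (s : ℂ) :
    ‖(m : ℂ) ^ (-s)‖ = (m : ℝ) ^ (-s.re) := by
  rw [Complex.norm_natCast_cpow_of_pos hm, Complex.neg_re]

theorem differentiable_dirPoly (a : ℕ → ℂ) (N : ℕ) : Differentiable ℂ (dirPoly a N) := by
  unfold dirPoly
  refine Differentiable.fun_sum fun m hm => ?_
  have hm0 : (m : ℂ) ≠ 0 := by
    have := (Finset.mem_Icc.1 hm).1
    exact_mod_cast (by omega : m ≠ 0)
  exact (differentiable_const _).mul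
    (Differentiable.const_cpow differentiable_id.neg (Or.inl hm0))

theorem norm_dirPoly_le (a : ℕ → ℂ) (N : ℕ) (s : ℂ) :
    ‖dirPoly a N s‖ ≤ ∑ m ∈ Finset.Icc 1 N, ‖a m‖ * (m : ℝ) ^ (-s.re) := by
  refine (norm_sum_le _ _).trans (Finset.sum_le_sum fun m hm => ?_)
  rw [norm_mul, norm_natCast_cpow_neg (Finset.mem_Icc.1 hm).1]

/-- Mean value theorem for Dirichlet polynomials with Gaussian weight. -/
theorem dirPoly_mean_value (a : ℕ → ℂ) {N : ℕ} {T D e : ℝ} (hD0 : 0 < D) (hD : 2 * N ≤ D)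
    (he : 1 ≤ e) (σ : ℝ) :
    gaussMean (fun s => dirPoly a N (e * s)) 2 T D σ ≤
      8 * D * ∑ m ∈ Finset.Icc 1 N, ‖a m‖ ^ 2 * (m : ℝ) ^ (-(2 * e * σ)) := by
  classical
  set b : ℕ → ℂ := fun m => a m * ((m : ℝ) ^ (-(e * σ)) : ℝ) with hb
  have hpoly : ∀ t : ℝ, dirPoly a N (e * (σ + t * I)) =
      ∑ m ∈ Finset.Icc 1 N, b m * Complex.exp (-(I * (e * Real.log m) * t)) := by
    intro t
    refine Finset.sum_congr rfl fun m hm => ?_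
    have hm1 := (Finset.mem_Icc.1 hm).1
    have hm0 : (m : ℂ) ≠ 0 := by exact_mod_cast (by omega : m ≠ 0)
    have h2 : (m : ℂ) = ((m : ℝ) : ℂ) := by push_cast; rfl
    rw [hb, mul_assoc]
    congr 1
    rw [show -((e : ℂ) * (σ + t * I)) = ((-(e * σ) : ℝ) : ℂ) + (-(e * t) : ℝ) * I by push_cast; ring,
      Complex.cpow_add _ _ hm0, h2, ← Complex.ofReal_cpow (Nat.cast_nonneg m)]
    congr 1
    rw [Complex.cpow_def_of_ne_zero (by rw [← h2]; exact hm0), ← Complex.ofReal_log (Nat.cast_nonneg m)]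
    congr 1; push_cast; ring
  have hsq : ∀ t : ℝ, ((‖dirPoly a N (e * (σ + t * I))‖ ^ (2:ℝ) *
        Real.exp (-((t - T) / D) ^ 2) : ℝ) : ℂ) =
      ∑ m ∈ Finset.Icc 1 N, ∑ k ∈ Finset.Icc 1 N, (b m * conj (b k)) *
        (Complex.exp (I * ((e * (Real.log k - Real.log m) : ℝ) : ℂ) * t) *
          (Real.exp (-((t - T) / D) ^ 2) : ℝ)) := by
    intro t
    rw [Complex.ofReal_mul, Real.rpow_two, ← Complex.normSq_eq_norm_sq, ← Complex.mul_conj, hpoly,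
      map_sum, Finset.sum_mul_sum, Finset.sum_mul]
    refine Finset.sum_congr rfl fun m _ => ?_
    rw [Finset.sum_mul]
    refine Finset.sum_congr rfl fun k _ => ?_
    rw [map_mul, ← Complex.exp_conj]
    have : conj (-(I * (e * (Real.log k : ℂ)) * t)) = I * (e * Real.log k) * t := by
      rw [map_neg, map_mul, map_mul, map_mul, Complex.conj_I, Complex.conj_ofReal,
        Complex.conj_ofReal, Complex.conj_ofReal]; ring
    rw [this]
    have h9 : Complex.exp (I * ((e * (Real.log k - Real.log m) : ℝ) : ℂ) * t) =
        Complex.exp (-(I * (e * (Real.log m : ℂ)) * t)) *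
          Complex.exp (I * (e * (Real.log k : ℂ)) * t) := by
      rw [← Complex.exp_add]; congr 1; push_cast; ring
    rw [h9]; ring
  have hinteg : ∀ μ : ℝ, Integrable fun t : ℝ => Complex.exp (I * (μ : ℂ) * t) *
      (Real.exp (-((t - T) / D) ^ 2) : ℝ) := by
    intro μ
    have h1 : Integrable fun t : ℝ => Real.exp (-((t - T) / D) ^ 2) := by
      have := ((integrable_exp_neg_mul_sq (b := 1) one_pos).comp_div hD0.ne').comp_sub_right T
      simpa using this
    refine h1.mono' (by fun_prop) (Eventually.of_forall fun t => ?_)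
    rw [norm_mul, show I * (μ : ℂ) * t = ((μ * t : ℝ) : ℂ) * I by push_cast; ring,
      Complex.norm_exp_ofReal_mul_I, Complex.norm_real, Real.norm_of_nonneg (Real.exp_pos _).le, one_mul]
  have hint2 : ((gaussMean (fun s => dirPoly a N (e * s)) 2 T D σ : ℝ) : ℂ) =
      ∑ m ∈ Finset.Icc 1 N, ∑ k ∈ Finset.Icc 1 N, (b m * conj (b k)) *
        ∫ t : ℝ, Complex.exp (I * ((e * (Real.log k - Real.log m) : ℝ) : ℂ) * t) *
          (Real.exp (-((t - T) / D) ^ 2) : ℝ) := by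
    rw [gaussMean, ← integral_complex_ofReal]
    simp_rw [hsq]
    rw [integral_finsetSum _ fun m _ => integrable_finset_sum _ fun k _ => (hinteg _).const_mul _]
    refine Finset.sum_congr rfl fun m _ => ?_
    rw [integral_finsetSum _ fun k _ => (hinteg _).const_mul _]
    refine Finset.sum_congr rfl fun k _ => ?_
    rw [integral_const_mul]
  have hnorm : gaussMean (fun s => dirPoly a N (e * s)) 2 T D σ ≤
      ∑ m ∈ Finset.Icc 1 N, ∑ k ∈ Finset.Icc 1 N,
        (‖b m‖ * ‖b k‖) * (2 * D * (1 / 2) ^ Nat.dist m k) := by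
    have h1 := congrArg norm hint2
    rw [Complex.norm_real, Real.norm_of_nonneg (gaussMean_nonneg _ _ _ _ _)] at h1
    rw [h1]
    refine (norm_sum_le _ _).trans (Finset.sum_le_sum fun m hm => ?_)
    refine (norm_sum_le _ _).trans (Finset.sum_le_sum fun k hk => ?_)
    rw [norm_mul, norm_mul, RCLike.norm_conj]
    have hm' := Finset.mem_Icc.1 hm
    have hk' := Finset.mem_Icc.1 hk
    gcongr
    refine (norm_gaussian_fourier_le hD0 _).trans ?_
    gcongr
    rw [Nat.dist_comm]
    exact gauss_kernel_le hk'.1 hm'.1 hk'.2 hm'.2 hD he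
  refine hnorm.trans ?_
  have h5 : ∀ m ∈ Finset.Icc 1 N, ∀ k ∈ Finset.Icc 1 N,
      (‖b m‖ * ‖b k‖) * (2 * D * (1 / 2) ^ Nat.dist m k) ≤
      D * (‖b m‖ ^ 2 * (1 / 2) ^ Nat.dist m k) + D * (‖b k‖ ^ 2 * (1 / 2) ^ Nat.dist k m) := by
    intro m _ k _
    rw [Nat.dist_comm k m]
    have h6 : (0:ℝ) ≤ D * (1 / 2) ^ Nat.dist m k := by positivity
    nlinarith [mul_nonneg h6 (sq_nonneg (‖b m‖ - ‖b k‖))]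
  have h7 : ∑ m ∈ Finset.Icc 1 N, ∑ k ∈ Finset.Icc 1 N, D * (‖b m‖ ^ 2 * (1 / 2) ^ Nat.dist m k) ≤
      4 * D * ∑ m ∈ Finset.Icc 1 N, ‖b m‖ ^ 2 := by
    rw [Finset.mul_sum]
    refine Finset.sum_le_sum fun m _ => ?_
    rw [← Finset.mul_sum, ← Finset.mul_sum]
    have := sum_half_pow_dist_le m (Finset.Icc 1 N)
    calc _ ≤ D * (‖b m‖ ^ 2 * 4) := by gcongr
      _ = _ := by ring
  have h8 : ∀ m ∈ Finset.Icc 1 N, ‖b m‖ ^ 2 = ‖a m‖ ^ 2 * (m : ℝ) ^ (-(2 * e * σ)) := by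
    intro m _
    rw [hb, norm_mul, mul_pow, Complex.norm_real, Real.norm_of_nonneg (by positivity),
      ← Real.rpow_natCast, ← Real.rpow_natCast, ← Real.rpow_mul (Nat.cast_nonneg m)]
    congr 2; push_cast; ring
  rw [← Finset.sum_congr rfl h8]
  calc _ ≤ ∑ m ∈ Finset.Icc 1 N, ∑ k ∈ Finset.Icc 1 N,
        (D * (‖b m‖ ^ 2 * (1 / 2) ^ Nat.dist m k) + D * (‖b k‖ ^ 2 * (1 / 2) ^ Nat.dist k m)) :=
        Finset.sum_le_sum fun m hm => Finset.sum_le_sum fun k hk => h5 m hm k hk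
    _ = ∑ m ∈ Finset.Icc 1 N, ∑ k ∈ Finset.Icc 1 N, D * (‖b m‖ ^ 2 * (1 / 2) ^ Nat.dist m k) +
        ∑ k ∈ Finset.Icc 1 N, ∑ m ∈ Finset.Icc 1 N, D * (‖b k‖ ^ 2 * (1 / 2) ^ Nat.dist k m) := by
        simp_rw [Finset.sum_add_distrib]
        congr 1
        exact Finset.sum_comm
    _ ≤ _ := by linarith

/-- The coefficient of `q ^ j` in `(1 - q) ^ (-z)`. -/
def binomCoeff (z : ℝ) (j : ℕ) : ℝ := ∏ i ∈ Finset.range j, (z + i) / (i + 1)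

theorem choose_neg_eq_binomCoeff (z : ℝ) (j : ℕ) :
    Ring.choose (-(z : ℂ)) j * (-1) ^ j = binomCoeff z j := by
  have h1 : (descPochhammer ℤ j).smeval (-(z : ℂ)) = ∏ i ∈ Finset.range j, (-(z : ℂ) - i) := by
    rw [← descPochhammer_eval_eq_prod_range, ← Polynomial.aeval_eq_smeval,
      ← Polynomial.eval_map_algebraMap, descPochhammer_map]
  rw [Ring.choose_eq_smul, h1, binomCoeff]
  push_cast
  rw [Finset.prod_div_distrib]
  have h2 : ∏ i ∈ Finset.range j, ((i : ℂ) + 1) = (j.factorial : ℂ) := by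
    rw [← Finset.prod_range_add_one_eq_factorial]; push_cast; rfl
  have h3 : ∏ i ∈ Finset.range j, (-(z : ℂ) - i) = (-1) ^ j * ∏ i ∈ Finset.range j, ((z : ℂ) + i) := by
    have h4 := Finset.prod_const (-1 : ℂ) (s := Finset.range j)
    rw [Finset.card_range] at h4
    rw [← h4, ← Finset.prod_mul_distrib]
    exact Finset.prod_congr rfl fun i _ => by ring
  rw [h2, h3, smul_eq_mul]
  have h5 : (-1 : ℂ) ^ j * (-1) ^ j = 1 := by rw [← mul_pow]; simp
  calc _ = ((-1 : ℂ) ^ j * (-1) ^ j) * ((j.factorial : ℂ)⁻¹ * ∏ i ∈ Finset.range j, ((z : ℂ) + i)) := by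
        ring
    _ = _ := by rw [h5]; ring

theorem hasSum_binomCoeff (z : ℝ) {q : ℂ} (hq : ‖q‖ < 1) :
    HasSum (fun j : ℕ => (binomCoeff z j : ℂ) * q ^ j) (Complex.exp (z * -Complex.log (1 - q))) := by
  have h := (Complex.one_add_cpow_hasFPowerSeriesOnBall_zero (a := -(z : ℂ))).hasSum
    (y := -q) (by
      rw [Metric.mem_eball, edist_zero_right, enorm_eq_nnnorm, nnnorm_neg]
      exact_mod_cast hq)
  have hne : (1 - q) ≠ 0 := by
    intro h; have : q = 1 := by linear_combination -h
    rw [this] at hq; simp at hq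
  simp only [zero_add, binomialSeries, FormalMultilinearSeries.ofScalars_apply_eq, smul_eq_mul] at h
  rw [← sub_eq_add_neg, Complex.cpow_def_of_ne_zero hne] at h
  have h2 : (fun j : ℕ => (binomCoeff z j : ℂ) * q ^ j) =
      fun n => Ring.choose (-(z : ℂ)) n * (-q) ^ n := by
    funext j
    rw [← choose_neg_eq_binomCoeff, neg_pow q j]; ring
  rw [h2, show (z : ℂ) * -Complex.log (1 - q) = Complex.log (1 - q) * -z by ring]
  exact h

theorem binomCoeff_nonneg {z : ℝ} (hz : 0 ≤ z) (j : ℕ) : 0 ≤ binomCoeff z j :=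
  Finset.prod_nonneg fun _ _ => by positivity

theorem binomCoeff_le_one {z : ℝ} (hz : 0 ≤ z) (hz1 : z ≤ 1) (j : ℕ) : binomCoeff z j ≤ 1 :=
  Finset.prod_le_one (fun _ _ => by positivity) fun i _ =>
    div_le_one_of_le₀ (by linarith) (by positivity)

theorem abs_binomCoeff_neg_le {z : ℝ} (hz : 0 ≤ z) (j : ℕ) :
    |binomCoeff (-z) j| ≤ binomCoeff z j := by
  rw [binomCoeff, Finset.abs_prod]
  refine Finset.prod_le_prod (fun _ _ => abs_nonneg _) fun i _ => ?_
  have hi : (0:ℝ) ≤ i := Nat.cast_nonneg i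
  rw [abs_div, abs_of_pos (by positivity : (0:ℝ) < i + 1)]
  gcongr
  rw [abs_le]; constructor <;> linarith

theorem binomCoeff_sq_le {z : ℝ} (hz : 0 ≤ z) (j : ℕ) :
    binomCoeff z j ^ 2 ≤ binomCoeff (z ^ 2) j := by
  rw [binomCoeff, ← Finset.prod_pow]
  refine Finset.prod_le_prod (fun _ _ => by positivity) fun i _ => ?_
  have hi : (0:ℝ) ≤ i := Nat.cast_nonneg i
  rw [div_pow, div_le_div_iff₀ (by positivity) (by positivity)]
  have h1 : (z + i) ^ 2 ≤ (z ^ 2 + i) * (i + 1) := by nlinarith [mul_nonneg hi (sq_nonneg (z - 1))]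
  nlinarith

/-- The generalized divisor function: the coefficients of `ζ(s) ^ z`. -/
def genDivisor (z : ℝ) (m : ℕ) : ℝ := m.factorization.prod fun _ j => binomCoeff z j

theorem genDivisor_one (z : ℝ) : genDivisor z 1 = 1 := by simp [genDivisor]

theorem genDivisor_mul (z : ℝ) {m n : ℕ} (h : m.Coprime n) :
    genDivisor z (m * n) = genDivisor z m * genDivisor z n := by
  rw [genDivisor, Nat.factorization_mul_of_coprime h]
  exact Finsupp.prod_add_index_of_disjoint h.disjoint_primeFactors _

theorem genDivisor_prime_pow (z : ℝ) {p : ℕ} (hp : p.Prime) (j : ℕ) :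
    genDivisor z (p ^ j) = binomCoeff z j := by
  rw [genDivisor, hp.factorization_pow, Finsupp.prod_single_index (by simp [binomCoeff])]

theorem genDivisor_nonneg {z : ℝ} (hz : 0 ≤ z) (m : ℕ) : 0 ≤ genDivisor z m := by
  rw [genDivisor, Finsupp.prod]
  exact Finset.prod_nonneg fun _ _ => binomCoeff_nonneg hz _

theorem abs_genDivisor_neg_le {z : ℝ} (hz : 0 ≤ z) (m : ℕ) :
    |genDivisor (-z) m| ≤ genDivisor z m := by
  rw [genDivisor, Finsupp.prod, Finset.abs_prod]
  exact Finset.prod_le_prod (fun _ _ => abs_nonneg _) fun i _ => abs_binomCoeff_neg_le hz _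

theorem genDivisor_le_one {z : ℝ} (hz : 0 ≤ z) (hz1 : z ≤ 1) (m : ℕ) : genDivisor z m ≤ 1 := by
  rw [genDivisor, Finsupp.prod]
  exact Finset.prod_le_one (fun _ _ => binomCoeff_nonneg hz _) fun i _ => binomCoeff_le_one hz hz1 _

theorem genDivisor_sq_le {z : ℝ} (hz : 0 ≤ z) (m : ℕ) :
    genDivisor z m ^ 2 ≤ genDivisor (z ^ 2) m := by
  rw [genDivisor, Finsupp.prod, ← Finset.prod_pow]
  exact Finset.prod_le_prod (fun _ _ => by positivity) fun i _ => binomCoeff_sq_le hz _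

theorem abs_genDivisor_le_one {z : ℝ} (hz : |z| ≤ 1) (m : ℕ) : |genDivisor z m| ≤ 1 := by
  rcases le_total 0 z with h | h
  · rw [abs_of_nonneg (genDivisor_nonneg h m)]
    exact genDivisor_le_one h ((le_abs_self z).trans hz) m
  · have h1 := abs_genDivisor_neg_le (z := -z) (by linarith) m
    rw [neg_neg] at h1
    rw [abs_of_nonpos h] at hz
    exact h1.trans (genDivisor_le_one (by linarith) hz m)

theorem summable_norm_natCast_cpow {s : ℂ} (hs : 1 < s.re) :
    Summable fun m : ℕ => ‖(m : ℂ) ^ (-s)‖ := by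
  have := Complex.summable_one_div_nat_cpow.2 hs
  refine this.norm.congr fun m => ?_
  rw [Complex.cpow_neg, one_div]

theorem summable_norm_genDivisor {z : ℝ} (hz : |z| ≤ 1) {s : ℂ} (hs : 1 < s.re) :
    Summable fun m : ℕ => ‖(genDivisor z m : ℂ) * (m : ℂ) ^ (-s)‖ := by
  refine (summable_norm_natCast_cpow hs).of_nonneg_of_le (fun _ => norm_nonneg _) fun m => ?_
  rw [norm_mul, Complex.norm_real]
  exact mul_le_of_le_one_left (norm_nonneg _) (abs_genDivisor_le_one hz m)

/-- The logarithm of the zeta function in the half plane of absolute convergence. -/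
def logZeta (s : ℂ) : ℂ := ∑' p : Nat.Primes, -Complex.log (1 - (p : ℂ) ^ (-s))

theorem exp_logZeta {s : ℂ} (hs : 1 < s.re) : Complex.exp (logZeta s) = riemannZeta s :=
  riemannZeta_eulerProduct_exp_log hs

theorem summable_prime_cpow {s : ℂ} (hs : 1 < s.re) :
    Summable fun p : Nat.Primes => (p : ℂ) ^ (-s) :=
  ((summable_norm_natCast_cpow hs).of_norm).subtype {p : ℕ | p.Prime}

theorem summable_logZeta {s : ℂ} (hs : 1 < s.re) :
    Summable fun p : Nat.Primes => -Complex.log (1 - (p : ℂ) ^ (-s)) :=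
  (summable_prime_cpow hs).clog_one_sub.neg

theorem norm_prime_cpow_lt_one {p : ℕ} (hp : p.Prime) {s : ℂ} (hs : 0 < s.re) :
    ‖(p : ℂ) ^ (-s)‖ < 1 := by
  rw [norm_natCast_cpow_neg hp.one_lt.le]
  exact Real.rpow_lt_one_of_one_lt_of_neg (by exact_mod_cast hp.one_lt) (by linarith)

theorem tsum_genDivisor {z : ℝ} (hz : |z| ≤ 1) {s : ℂ} (hs : 1 < s.re) :
    ∑' m : ℕ, (genDivisor z m : ℂ) * (m : ℂ) ^ (-s) = Complex.exp (z * logZeta s) := by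
  have hs0 : -s ≠ 0 := by
    intro h
    have := congrArg Complex.re h
    simp at this; linarith
  have h1 := EulerProduct.eulerProduct_hasProd
    (f := fun m : ℕ => (genDivisor z m : ℂ) * (m : ℂ) ^ (-s))
    (by simp [genDivisor_one]) (fun {m n} hmn => by
      rw [genDivisor_mul z hmn, Nat.cast_mul, Complex.natCast_mul_natCast_cpow]; push_cast; ring)
    (summable_norm_genDivisor hz hs) (by simp [Complex.zero_cpow hs0])
  have h2 : HasProd (fun p : Nat.Primes =>
      Complex.exp (z * -Complex.log (1 - (p : ℂ) ^ (-s)))) (Complex.exp (z * logZeta s)) :=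
    ((summable_logZeta hs).hasSum.mul_left (z : ℂ)).cexp
  refine h1.unique ?_
  convert h2 using 1
  funext p
  rw [← (hasSum_binomCoeff z (norm_prime_cpow_lt_one p.2 (by linarith : 0 < s.re))).tsum_eq]
  refine tsum_congr fun j => ?_
  rw [genDivisor_prime_pow z p.2]
  congr 1
  rw [← Complex.cpow_nat_mul, Nat.cast_pow, ← Complex.natCast_cpow_natCast_mul]

theorem tsum_inv_sq_le_two : ∑' m : ℕ, 1 / (m : ℝ) ^ 2 ≤ 2 := by
  rw [hasSum_zeta_two.tsum_eq]
  nlinarith [Real.pi_lt_d2, Real.pi_pos]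

theorem norm_natCast_cpow_le {s : ℂ} (hs : s.re = 8) (m : ℕ) :
    ‖(m : ℂ) ^ (-s)‖ ≤ 1 / (m : ℝ) ^ 8 := by
  rcases Nat.eq_zero_or_pos m with h | h
  · have : -s ≠ 0 := by
      intro h
      have := congrArg Complex.re h
      simp at this; linarith
    simp [h, Complex.zero_cpow this]
  · rw [norm_natCast_cpow_neg h, hs, Real.rpow_neg (Nat.cast_nonneg m), one_div]
    norm_cast

theorem norm_tsum_sub_dirPoly_le {a : ℕ → ℂ} (ha : ∀ m, ‖a m‖ ≤ 1) {N : ℕ} (hN : 1 ≤ N) {s : ℂ}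
    (hs : s.re = 8) : ‖∑' m : ℕ, a m * (m : ℂ) ^ (-s) - dirPoly a N s‖ ≤ 2 / (N : ℝ) ^ 6 := by
  have hs0 : -s ≠ 0 := by
    intro h
    have := congrArg Complex.re h
    simp at this; linarith
  have hle : ∀ m : ℕ, ‖a m * (m : ℂ) ^ (-s)‖ ≤ 1 / (m : ℝ) ^ 8 := fun m => by
    rw [norm_mul]
    exact (mul_le_of_le_one_left (norm_nonneg _) (ha m)).trans (norm_natCast_cpow_le hs m)
  have hsum : Summable fun m : ℕ => a m * (m : ℂ) ^ (-s) :=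
    (Summable.of_nonneg_of_le (fun _ => norm_nonneg _) hle
      (Real.summable_one_div_nat_pow.2 (by norm_num))).of_norm
  have h1 : dirPoly a N s = ∑ m ∈ Finset.range (N + 1), a m * (m : ℂ) ^ (-s) := by
    rw [dirPoly, Finset.range_eq_Ico, Finset.sum_eq_sum_Ico_succ_bot (by omega)]
    simp only [Nat.cast_zero, Complex.zero_cpow hs0, mul_zero, zero_add,
      Finset.Ico_add_one_right_eq_Icc]
  obtain ⟨k, hk⟩ : ∃ k, k = N + 1 := ⟨_, rfl⟩
  have hNk : (N : ℝ) ≤ k := Nat.cast_le.2 (by omega)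
  rw [h1, ← hk, ← hsum.sum_add_tsum_nat_add k, add_sub_cancel_left]
  clear h1 hk
  have hS := Real.summable_one_div_nat_pow.2 (by norm_num : 1 < 2)
  have hsq : Summable fun m : ℕ => 1 / ((m + k : ℕ) : ℝ) ^ 2 := (summable_nat_add_iff k).2 hS
  have hN0 : (0:ℝ) < N := Nat.cast_pos.2 hN
  have h2 : ∀ m : ℕ, ‖a (m + k) * ((m + k : ℕ) : ℂ) ^ (-s)‖ ≤
      1 / (N : ℝ) ^ 6 * (1 / ((m + k : ℕ) : ℝ) ^ 2) := by
    intro m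
    refine (hle _).trans ?_
    rw [div_mul_div_comm, one_mul]
    have h3 : (N : ℝ) ≤ ((m + k : ℕ) : ℝ) := hNk.trans (Nat.cast_le.2 (Nat.le_add_left _ _))
    have hw : 0 < ((m + k : ℕ) : ℝ) := hN0.trans_le h3
    apply one_div_le_one_div_of_le (by positivity)
    calc (N : ℝ) ^ 6 * ((m + k : ℕ) : ℝ) ^ 2 ≤ ((m + k : ℕ) : ℝ) ^ 6 * ((m + k : ℕ) : ℝ) ^ 2 :=
          mul_le_mul_of_nonneg_right (pow_le_pow_left₀ hN0.le h3 6) (sq_nonneg _)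
      _ = ((m + k : ℕ) : ℝ) ^ 8 := (pow_add _ 6 2).symm
  refine (tsum_of_norm_bounded (hsq.hasSum.mul_left _) h2).trans ?_
  have h5 := hS.sum_add_tsum_nat_add k
  have h6 : 0 ≤ ∑ i ∈ Finset.range k, 1 / (i : ℝ) ^ 2 :=
    Finset.sum_nonneg fun _ _ => by positivity
  have h7 : ∑' m : ℕ, 1 / ((m + k : ℕ) : ℝ) ^ 2 ≤ 2 :=
    (le_add_of_nonneg_left h6).trans (h5.le.trans tsum_inv_sq_le_two)
  calc 1 / (N : ℝ) ^ 6 * ∑' m : ℕ, 1 / ((m + k : ℕ) : ℝ) ^ 2 ≤ 1 / (N : ℝ) ^ 6 * 2 :=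
        mul_le_mul_of_nonneg_left h7 (by positivity)
    _ = 2 / (N : ℝ) ^ 6 := by ring

theorem norm_riemannZeta_eight_le {s : ℂ} (hs : s.re = 8) : ‖riemannZeta s‖ ≤ 2 := by
  rw [zeta_eq_tsum_one_div_nat_cpow (by rw [hs]; norm_num)]
  refine (tsum_of_norm_bounded (Real.summable_one_div_nat_pow.2 (by norm_num : 1 < 2)).hasSum
    fun m => ?_).trans tsum_inv_sq_le_two
  rw [one_div, ← Complex.cpow_neg]
  refine (norm_natCast_cpow_le hs m).trans ?_
  rcases Nat.eq_zero_or_pos m with h | h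
  · simp [h]
  · have : (1:ℝ) ≤ m := by exact_mod_cast h
    gcongr
    norm_num

theorem norm_exp_mul_logZeta (z : ℝ) {s : ℂ} (hs : 1 < s.re) :
    ‖Complex.exp (z * logZeta s)‖ = ‖riemannZeta s‖ ^ z := by
  rw [Complex.norm_exp, Complex.re_ofReal_mul, ← exp_logZeta hs, Complex.norm_exp, ← Real.exp_mul]
  ring_nf

theorem hasSum_genDivisor_real {z : ℝ} (hz : |z| ≤ 1) (hz0 : 0 ≤ z) {σ : ℝ} (hσ : 1 < σ) :
    HasSum (fun m : ℕ => genDivisor z m * ‖(m : ℂ) ^ (-(σ : ℂ))‖) (‖riemannZeta σ‖ ^ z) := by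
  have hs : 1 < (σ : ℂ).re := by simpa
  have h1 := (summable_norm_genDivisor hz hs).of_norm.hasSum
  rw [tsum_genDivisor hz hs] at h1
  have h2 : ∀ m : ℕ, (genDivisor z m : ℂ) * (m : ℂ) ^ (-(σ : ℂ)) =
      ((genDivisor z m * ‖(m : ℂ) ^ (-(σ : ℂ))‖ : ℝ) : ℂ) := by
    intro m
    rw [Complex.ofReal_mul]
    congr 1
    have : (m : ℂ) ^ (-(σ : ℂ)) = (((m : ℝ) ^ (-σ) : ℝ) : ℂ) := by
      rw [Complex.ofReal_cpow (Nat.cast_nonneg m)]; push_cast; rfl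
    rw [this, Complex.norm_real, Real.norm_of_nonneg (by positivity)]
  simp_rw [h2] at h1
  have h3 := (Complex.hasSum_iff _ _).1 h1
  have h4 := h3.1
  simp only [Complex.ofReal_re] at h4
  rw [h4.tsum_eq.symm] at h4
  have h5 : (∑' m : ℕ, genDivisor z m * ‖(m : ℂ) ^ (-(σ : ℂ))‖) = ‖riemannZeta σ‖ ^ z := by
    rw [← norm_exp_mul_logZeta z hs, ← h1.tsum_eq, ← Complex.ofReal_tsum, Complex.norm_real,
      Real.norm_of_nonneg]
    exact tsum_nonneg fun m => mul_nonneg (genDivisor_nonneg hz0 m) (norm_nonneg _)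
  rwa [h5] at h4

theorem norm_riemannZeta_one_add_le {η : ℝ} (h0 : 0 < η) (h1 : η ≤ 1) :
    ‖riemannZeta ((1 + η : ℝ) : ℂ)‖ ≤ 45 / η := by
  have hne : ((1 + η : ℝ) : ℂ) ≠ 1 := by
    intro h
    have : (1 + η : ℝ) = 1 := by exact_mod_cast h
    linarith
  have h2 := norm_riemannZeta₁_le (s := ((1 + η : ℝ) : ℂ)) (by rw [Complex.ofReal_re]; linarith)
  rw [riemannZeta₁_eq hne, norm_mul] at h2
  have h3 : ((1 + η : ℝ) : ℂ) - 1 = (η : ℂ) := by push_cast; ring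
  rw [h3, Complex.norm_real, Complex.norm_real, Real.norm_of_nonneg h0.le,
    Real.norm_of_nonneg (by linarith)] at h2
  rw [le_div_iff₀ h0]
  nlinarith

theorem sum_genDivisor_le {z : ℝ} (hz : 0 ≤ z) (hz1 : z ≤ 1) {N : ℕ} (hN : 3 ≤ N) :
    ∑ m ∈ Finset.Icc 1 N, genDivisor z m * (m : ℝ) ^ (-1 : ℝ) ≤
      Real.exp 1 * (45 * Real.log N) ^ z := by
  have hN0 : (3:ℝ) ≤ N := by exact_mod_cast hN
  have hlog : 1 ≤ Real.log N := by
    rw [Real.le_log_iff_exp_le (by linarith)]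
    linarith [Real.exp_one_lt_d9]
  set η := 1 / Real.log N with hη
  have hη0 : 0 < η := by positivity
  have hη1 : η ≤ 1 := by rw [hη, div_le_one (by linarith)]; exact hlog
  have h1 := hasSum_genDivisor_real (abs_le.2 ⟨by linarith, hz1⟩) hz (σ := 1 + η) (by linarith)
  have h2 : ∑ m ∈ Finset.Icc 1 N, genDivisor z m * (m : ℝ) ^ (-1 : ℝ) ≤
      ∑ m ∈ Finset.Icc 1 N, Real.exp 1 * (genDivisor z m * ‖(m : ℂ) ^ (-((1 + η : ℝ) : ℂ))‖) := by
    refine Finset.sum_le_sum fun m hm => ?_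
    have hm' := Finset.mem_Icc.1 hm
    have hm0 : (0:ℝ) < m := by exact_mod_cast hm'.1
    rw [norm_natCast_cpow_neg hm'.1, mul_left_comm]
    gcongr
    · exact genDivisor_nonneg hz m
    · have h3 : (m : ℝ) ^ η ≤ Real.exp 1 := by
        rw [Real.rpow_def_of_pos hm0]
        gcongr
        rw [hη, mul_one_div, div_le_one (by linarith)]
        exact Real.log_le_log hm0 (by exact_mod_cast hm'.2)
      rw [Complex.ofReal_re, neg_add, Real.rpow_add hm0, Real.rpow_neg hm0.le η]
      have h5 : 0 < (m : ℝ) ^ η := by positivity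
      calc (m : ℝ) ^ (-1 : ℝ) = (m : ℝ) ^ (-1 : ℝ) * ((m : ℝ) ^ η * ((m : ℝ) ^ η)⁻¹) := by
            rw [mul_inv_cancel₀ h5.ne', mul_one]
        _ ≤ (m : ℝ) ^ (-1 : ℝ) * (Real.exp 1 * ((m : ℝ) ^ η)⁻¹) := by gcongr
        _ = _ := by ring
  refine h2.trans ?_
  rw [← Finset.mul_sum]
  gcongr
  refine (sum_le_hasSum _ (fun m _ => mul_nonneg (genDivisor_nonneg hz m) (norm_nonneg _)) h1).trans ?_
  gcongr
  refine (norm_riemannZeta_one_add_le hη0 hη1).trans_eq ?_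
  rw [hη]; field_simp

theorem sum_genDivisor_sq_le {z : ℝ} (hz1 : |z| ≤ 1) {N : ℕ} (hN : 3 ≤ N) {σ : ℝ} (hσ : 1 / 2 ≤ σ) :
    ∑ m ∈ Finset.Icc 1 N, ‖(genDivisor z m : ℂ)‖ ^ 2 * (m : ℝ) ^ (-(2 * 1 * σ)) ≤
      Real.exp 1 * (45 * Real.log N) ^ (z ^ 2) := by
  refine le_trans (Finset.sum_le_sum fun m hm => ?_)
    (sum_genDivisor_le (sq_nonneg z) ((sq_le_one_iff_abs_le_one z).2 hz1) hN)
  have hm' := Finset.mem_Icc.1 hm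
  have hm1 : (1:ℝ) ≤ m := by exact_mod_cast hm'.1
  rw [Complex.norm_real, Real.norm_eq_abs]
  gcongr
  · exact genDivisor_nonneg (sq_nonneg z) m
  · have h1 : |genDivisor z m| ≤ genDivisor |z| m := by
      rcases le_total 0 z with h | h
      · rw [abs_of_nonneg h, abs_of_nonneg (genDivisor_nonneg h m)]
      · rw [abs_of_nonpos h]
        have := abs_genDivisor_neg_le (z := -z) (by linarith) m
        rwa [neg_neg] at this
    calc |genDivisor z m| ^ 2 ≤ genDivisor |z| m ^ 2 := by gcongr
      _ ≤ genDivisor (|z| ^ 2) m := genDivisor_sq_le (abs_nonneg z) m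
      _ = _ := by rw [sq_abs]
  · linarith

/-- The truncated Dirichlet series of `ζ ^ z`. -/
def zetaPowPoly (z : ℝ) (N : ℕ) (s : ℂ) : ℂ := dirPoly (fun m => (genDivisor z m : ℂ)) N s

theorem norm_zetaPowPoly_le {z : ℝ} (hz1 : |z| ≤ 1) (N : ℕ) {s : ℂ} (hs : s.re = 8) :
    ‖zetaPowPoly z N s‖ ≤ 2 ^ |z| := by
  have h1 := hasSum_genDivisor_real (z := |z|) (by rwa [abs_abs]) (abs_nonneg z) (σ := 8) (by norm_num)
  have h2 : ‖riemannZeta ((8 : ℝ) : ℂ)‖ ^ |z| ≤ 2 ^ |z| := by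
    gcongr
    exact norm_riemannZeta_eight_le (Complex.ofReal_re _)
  refine le_trans ?_ h2
  refine le_trans (norm_dirPoly_le _ N s) ?_
  refine le_trans (Finset.sum_le_sum fun m hm => ?_)
    (sum_le_hasSum (Finset.Icc 1 N)
      (fun m _ => mul_nonneg (genDivisor_nonneg (abs_nonneg z) m) (norm_nonneg _)) h1)
  rw [norm_natCast_cpow_neg (Finset.mem_Icc.1 hm).1, Complex.ofReal_re, hs, Complex.norm_real]
  gcongr
  rcases le_total 0 z with h | h
  · rw [abs_of_nonneg h, Real.norm_of_nonneg (genDivisor_nonneg h m)]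
  · rw [abs_of_nonpos h]
    have := abs_genDivisor_neg_le (z := -z) (by linarith) m
    rwa [neg_neg] at this

theorem norm_pow_sub_pow_le {a b : ℂ} {B : ℝ} (ha : ‖a‖ ≤ B) (hb : ‖b‖ ≤ B) (n : ℕ) :
    ‖a ^ n - b ^ n‖ ≤ n * B ^ (n - 1) * ‖a - b‖ := by
  have hB : 0 ≤ B := (norm_nonneg a).trans ha
  rw [← Commute.geom_sum₂_mul (Commute.all a b), norm_mul]
  gcongr
  refine (norm_sum_le _ _).trans ?_
  have hc : (n : ℝ) * B ^ (n - 1) = ∑ _i ∈ Finset.range n, B ^ (n - 1) := by simp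
  rw [hc]
  refine Finset.sum_le_sum fun i hi => ?_
  rw [norm_mul, norm_pow, norm_pow]
  have hi' := Finset.mem_range.1 hi
  calc ‖a‖ ^ i * ‖b‖ ^ (n - 1 - i) ≤ B ^ i * B ^ (n - 1 - i) := by gcongr
    _ = B ^ (n - 1) := by rw [← pow_add]; congr 1; omega

theorem norm_exp_pow_sub_zetaPowPoly_pow_le {z : ℝ} {n : ℕ} (hn : 1 ≤ n) (hz : |z| = 1 / n)
    {N : ℕ} (hN : 1 ≤ N) {s : ℂ} (hs : s.re = 8) :
    ‖Complex.exp (z * logZeta s) ^ n - zetaPowPoly z N s ^ n‖ ≤ 4 * n / (N : ℝ) ^ 6 := by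
  have hn0 : (1:ℝ) ≤ n := by exact_mod_cast hn
  have hz1 : |z| ≤ 1 := by rw [hz]; exact div_le_one_of_le₀ hn0 (by positivity)
  have hs1 : 1 < s.re := by rw [hs]; norm_num
  have h1 := norm_tsum_sub_dirPoly_le (a := fun m => (genDivisor z m : ℂ))
    (fun m => by rw [Complex.norm_real]; exact abs_genDivisor_le_one hz1 m) hN hs
  rw [tsum_genDivisor hz1 hs1] at h1
  have hb := norm_zetaPowPoly_le hz1 N hs
  have ha : ‖Complex.exp (z * logZeta s)‖ ≤ 2 ^ |z| := by
    rw [← tsum_genDivisor hz1 hs1]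
    have h2 := hasSum_genDivisor_real (z := |z|) (by rwa [abs_abs]) (abs_nonneg z) (σ := 8)
      (by norm_num)
    refine (tsum_of_norm_bounded h2 fun m => ?_).trans ?_
    · rw [norm_mul, Complex.norm_real]
      have h3 : ‖(m : ℂ) ^ (-s)‖ = ‖(m : ℂ) ^ (-((8 : ℝ) : ℂ))‖ := by
        rcases Nat.eq_zero_or_pos m with h | h
        · have h0 : -s ≠ 0 := by
            intro h
            have := congrArg Complex.re h
            simp at this; linarith
          simp [h, Complex.zero_cpow h0]
        · rw [norm_natCast_cpow_neg h, norm_natCast_cpow_neg h, hs, Complex.ofReal_re]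
      rw [h3]
      gcongr
      rcases le_total 0 z with h | h
      · rw [abs_of_nonneg h, Real.norm_of_nonneg (genDivisor_nonneg h m)]
      · rw [abs_of_nonpos h]
        have := abs_genDivisor_neg_le (z := -z) (by linarith) m
        rwa [neg_neg] at this
    · gcongr
      exact norm_riemannZeta_eight_le (Complex.ofReal_re _)
  refine (norm_pow_sub_pow_le ha hb n).trans ?_
  have h4 : ((2:ℝ) ^ |z|) ^ (n - 1) ≤ 2 := by
    have h5 : (1:ℝ) ≤ 2 ^ |z| := Real.one_le_rpow (by norm_num) (abs_nonneg z)
    calc ((2:ℝ) ^ |z|) ^ (n - 1) ≤ ((2:ℝ) ^ |z|) ^ n := by gcongr; omega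
      _ = 2 := by
        rw [← Real.rpow_natCast, ← Real.rpow_mul (by norm_num), hz, one_div,
          inv_mul_cancel₀ (by positivity), Real.rpow_one]
  calc _ ≤ n * 2 * (2 / (N : ℝ) ^ 6) := by
        gcongr
        exact h1
    _ = _ := by ring

theorem norm_riemannZeta_sub_zetaPowPoly_pow_le {n : ℕ} (hn : 1 ≤ n) {N : ℕ} (hN : 1 ≤ N) {s : ℂ}
    (hs : s.re = 8) : ‖riemannZeta s - zetaPowPoly (1 / n) N s ^ n‖ ≤ 4 * n / (N : ℝ) ^ 6 := by
  have hn0 : (n : ℂ) ≠ 0 := by exact_mod_cast (by omega : n ≠ 0)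
  have h := norm_exp_pow_sub_zetaPowPoly_pow_le (z := 1 / n) hn (abs_of_nonneg (by positivity)) hN hs
  rwa [← Complex.exp_nat_mul, ← mul_assoc, show (n : ℂ) * ((1 / n : ℝ) : ℂ) = 1 by
    push_cast; field_simp, one_mul, exp_logZeta (by rw [hs]; norm_num)] at h

theorem norm_riemannZeta_mul_zetaPowPoly_pow_sub_one_le {n : ℕ} (hn : 1 ≤ n) {N : ℕ} (hN : 1 ≤ N)
    {s : ℂ} (hs : s.re = 8) :
    ‖riemannZeta s * zetaPowPoly (-(1 / n)) N s ^ n - 1‖ ≤ 8 * n / (N : ℝ) ^ 6 := by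
  have hn0 : (n : ℂ) ≠ 0 := by exact_mod_cast (by omega : n ≠ 0)
  have hs1 : 1 < s.re := by rw [hs]; norm_num
  have h := norm_exp_pow_sub_zetaPowPoly_pow_le (z := -(1 / n)) hn
    (by rw [abs_neg, abs_of_nonneg (by positivity)]) hN hs
  rw [← Complex.exp_nat_mul, ← mul_assoc, show (n : ℂ) * ((-(1 / n) : ℝ) : ℂ) = -1 by
    push_cast; field_simp, neg_one_mul] at h
  have h1 : riemannZeta s * zetaPowPoly (-(1 / n)) N s ^ n - 1 =
      -(riemannZeta s * (Complex.exp (-logZeta s) - zetaPowPoly (-(1 / n)) N s ^ n)) := by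
    have h2 : riemannZeta s * Complex.exp (-logZeta s) = 1 := by
      rw [← exp_logZeta hs1, ← Complex.exp_add]; simp
    rw [mul_sub, h2]; ring
  rw [h1, norm_neg, norm_mul]
  calc _ ≤ 2 * (4 * n / (N : ℝ) ^ 6) := by
        gcongr
        exact norm_riemannZeta_eight_le hs
    _ = _ := by ring

theorem integrable_gauss_weight {T D : ℝ} (hD : 0 < D) :
    Integrable fun t : ℝ => Real.exp (-((t - T) / D) ^ 2) := by
  have h := (integrable_exp_neg_mul_sq (b := (D ^ 2)⁻¹) (by positivity)).comp_sub_right T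
  refine h.congr (Eventually.of_forall fun t => ?_)
  simp only
  congr 1
  field_simp

theorem integral_gauss_weight_le {T D : ℝ} (hD : 0 < D) :
    ∫ t : ℝ, Real.exp (-((t - T) / D) ^ 2) ≤ 2 * D := by
  have h1 : ∀ t : ℝ, Real.exp (-((t - T) / D) ^ 2) =
      (fun u : ℝ => Real.exp (-(D ^ 2)⁻¹ * u ^ 2)) (t - T) := by
    intro t
    simp only
    congr 1
    field_simp
  simp_rw [h1]
  rw [integral_sub_right_eq_self (fun u : ℝ => Real.exp (-(D ^ 2)⁻¹ * u ^ 2)) T, integral_gaussian,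
    Real.sqrt_le_left (by positivity)]
  rw [div_inv_eq_mul]
  nlinarith [Real.pi_lt_four, sq_nonneg D]

theorem rpow_add_le {x y p : ℝ} (hx : 0 ≤ x) (hy : 0 ≤ y) (hp : 0 < p) (hp2 : p ≤ 2) :
    (x + y) ^ p ≤ 4 * (x ^ p + y ^ p) := by
  have h2 : (2:ℝ) ^ p ≤ 4 := by
    calc (2:ℝ) ^ p ≤ 2 ^ (2:ℝ) := Real.rpow_le_rpow_of_exponent_le (by norm_num) hp2
      _ = 4 := by norm_num
  have key : ∀ {x y : ℝ}, 0 ≤ x → x ≤ y → (x + y) ^ p ≤ 4 * y ^ p := by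
    intro x y hx hxy
    have hy : 0 ≤ y := hx.trans hxy
    calc (x + y) ^ p ≤ (2 * y) ^ p :=
          Real.rpow_le_rpow (by positivity) (by linarith) hp.le
      _ = 2 ^ p * y ^ p := Real.mul_rpow (by norm_num) (hx.trans hxy)
      _ ≤ _ := by gcongr
  have hx' : 0 ≤ x ^ p := by positivity
  have hy' : 0 ≤ y ^ p := by positivity
  rcases le_total x y with h | h
  · linarith [key hx h]
  · rw [add_comm x y]; linarith [key hy h]

section
variable {F G : ℂ → ℂ} {a b p q T D σ : ℝ}

theorem gaussMean_mono (hG : StripGrowth G a b) (hq : 0 < q) (hD : 0 < D) (h1 : a ≤ σ) (h2 : σ ≤ b)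
    (h : ∀ t : ℝ, ‖F (σ + t * I)‖ ^ p ≤ ‖G (σ + t * I)‖ ^ q) :
    gaussMean F p T D σ ≤ gaussMean G q T D σ :=
  integral_mono_of_nonneg (Eventually.of_forall fun _ => by positivity)
    (hG.integrable hq hD h1 h2)
    (Eventually.of_forall fun t => mul_le_mul_of_nonneg_right (h t) (by positivity))

theorem gaussMean_le_of_norm_le {B : ℝ} (hp : 0 < p) (hD : 0 < D)
    (h : ∀ t : ℝ, ‖F (σ + t * I)‖ ≤ B) : gaussMean F p T D σ ≤ 2 * D * B ^ p := by
  have hB : 0 ≤ B := (norm_nonneg _).trans (h 0)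
  calc gaussMean F p T D σ ≤ ∫ t : ℝ, B ^ p * Real.exp (-((t - T) / D) ^ 2) := by
        refine integral_mono_of_nonneg (Eventually.of_forall fun _ => by positivity)
          ((integrable_gauss_weight hD).const_mul _) (Eventually.of_forall fun t => ?_)
        exact mul_le_mul_of_nonneg_right
          (Real.rpow_le_rpow (norm_nonneg _) (h t) hp.le) (by positivity)
    _ = B ^ p * ∫ t : ℝ, Real.exp (-((t - T) / D) ^ 2) := integral_const_mul _ _
    _ ≤ B ^ p * (2 * D) :=
        mul_le_mul_of_nonneg_left (integral_gauss_weight_le hD) (by positivity)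
    _ = _ := by ring

theorem gaussMean_add_le (hF : StripGrowth F a b) (hG : StripGrowth G a b) (hp : 0 < p)
    (hp2 : p ≤ 2) (hD : 0 < D) (h1 : a ≤ σ) (h2 : σ ≤ b) :
    gaussMean (fun s => F s + G s) p T D σ ≤
      4 * (gaussMean F p T D σ + gaussMean G p T D σ) := by
  have hi := (hF.integrable (T := T) hp hD h1 h2).add (hG.integrable (T := T) hp hD h1 h2)
  rw [gaussMean, gaussMean, gaussMean, ← integral_add (hF.integrable hp hD h1 h2)
    (hG.integrable hp hD h1 h2), ← integral_const_mul]
  refine integral_mono_of_nonneg (Eventually.of_forall fun _ => by positivity)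
    (hi.const_mul 4) (Eventually.of_forall fun t => ?_)
  simp only
  rw [← add_mul, ← mul_assoc]
  refine mul_le_mul_of_nonneg_right ?_ (by positivity)
  exact (Real.rpow_le_rpow (norm_nonneg _) (norm_add_le _ _) hp.le).trans
    (rpow_add_le (norm_nonneg _) (norm_nonneg _) hp hp2)

theorem gaussMean_neg : gaussMean (fun s => -F s) p T D σ = gaussMean F p T D σ := by
  simp only [gaussMean, norm_neg]

theorem gaussMean_sub_le (hF : StripGrowth F a b) (hG : StripGrowth G a b) (hp : 0 < p)
    (hp2 : p ≤ 2) (hD : 0 < D) (h1 : a ≤ σ) (h2 : σ ≤ b) :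
    gaussMean (fun s => F s - G s) p T D σ ≤
      4 * (gaussMean F p T D σ + gaussMean G p T D σ) := by
  have := gaussMean_add_le (T := T) hF hG.neg hp hp2 hD h1 h2
  rw [gaussMean_neg] at this
  simpa only [sub_eq_add_neg] using this
end

theorem zetaStar_tail_le {p T D x t : ℝ} (hp : 0 < p) (hp2 : p ≤ 2) (hT : 8 ≤ T)
    (hD : 0 < D) (htail : D ^ 4 * Real.exp (-(T / D) ^ 2 / 8) ≤ 1) (hx : 0 ≤ x) (hx' : x ≤ 1 / 4)
    (ht : T / 2 ≤ |t - T|) :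
    ‖zetaStar ((1 / 2 - x : ℝ) + t * I)‖ ^ p * Real.exp (-((t - T) / D) ^ 2) ≤
      204800 * Real.exp (-((t - T) / (2 * D)) ^ 2) := by
  set u := |t - T| with hu
  have hu4 : 4 ≤ u := by linarith
  have h1 : ‖zetaStar ((1 / 2 - x : ℝ) + t * I)‖ ≤ 5 * (4 * u) ^ 2 := by
    refine (norm_zetaStar_le (by rw [line_re]; linarith)).trans ?_
    have h2 : ‖((1 / 2 - x : ℝ) : ℂ) + t * I‖ ≤ 1 / 2 + |t| := by
      refine (Complex.norm_le_abs_re_add_abs_im _).trans ?_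
      rw [line_re, line_im, abs_of_nonneg (by linarith : 0 ≤ 1 / 2 - x)]
      linarith
    have h3 : |t| ≤ T + u := by
      have := abs_add_le T (t - T)
      rw [add_sub_cancel, abs_of_pos (by linarith : 0 < T)] at this
      exact this
    gcongr
    linarith
  have h4 : ‖zetaStar ((1 / 2 - x : ℝ) + t * I)‖ ^ p ≤ 6400 * u ^ 4 := by
    calc _ ≤ (5 * (4 * u) ^ 2) ^ p := by gcongr
      _ ≤ (5 * (4 * u) ^ 2) ^ (2:ℝ) :=
          Real.rpow_le_rpow_of_exponent_le (by nlinarith) hp2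
      _ = _ := by rw [Real.rpow_two]; ring
  set v := u / D with hv
  have hv0 : 0 ≤ v := by positivity
  have huv : u = D * v := by rw [hv]; field_simp
  have h5 : ((t - T) / D) ^ 2 = v ^ 2 := by
    rw [hv, hu, div_pow, div_pow, sq_abs]
  have h6 : ((t - T) / (2 * D)) ^ 2 = v ^ 2 / 4 := by
    rw [hv, hu, div_pow, div_pow, sq_abs]; ring
  rw [h5, h6]
  have h7 : v ^ 4 ≤ 32 * Real.exp (v ^ 2 / 4) := by
    have := Real.quadratic_le_exp_of_nonneg (x := v ^ 2 / 4) (by positivity)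
    nlinarith [sq_nonneg v]
  have h8 : Real.exp (-(v ^ 2 / 2)) ≤ Real.exp (-(T / D) ^ 2 / 8) := by
    gcongr
    have : T / D / 2 ≤ v := by
      rw [hv, div_div, mul_comm D 2, ← div_div]; gcongr
    have h9 : (T / D / 2) ^ 2 ≤ v ^ 2 := by gcongr
    nlinarith
  have e1 : Real.exp (-v ^ 2) = Real.exp (-(v ^ 2 / 2)) * Real.exp (-(v ^ 2 / 4)) *
      Real.exp (-(v ^ 2 / 4)) := by
    rw [← Real.exp_add, ← Real.exp_add]; ring_nf
  have e2 : Real.exp (v ^ 2 / 4) * Real.exp (-(v ^ 2 / 4)) = 1 := by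
    rw [← Real.exp_add]; simp
  calc _ ≤ 6400 * u ^ 4 * Real.exp (-v ^ 2) := by gcongr
    _ = 6400 * (D ^ 4 * Real.exp (-(v ^ 2 / 2))) * (v ^ 4 * Real.exp (-(v ^ 2 / 4))) *
        Real.exp (-(v ^ 2 / 4)) := by rw [e1, huv]; ring
    _ ≤ 6400 * 1 * (32 * Real.exp (v ^ 2 / 4) * Real.exp (-(v ^ 2 / 4))) *
        Real.exp (-(v ^ 2 / 4)) := by
        gcongr
        exact le_trans (by gcongr) htail
    _ = _ := by rw [mul_assoc 32, e2]; ring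

theorem gaussMean_zetaStar_reflect {p T D x : ℝ} (hp : 0 < p) (hp2 : p ≤ 2) (hT : 8 ≤ T)
    (hD : 0 < D) (htail : D ^ 4 * Real.exp (-(T / D) ^ 2 / 8) ≤ 1) (hx : 0 ≤ x)
    (hx' : x ≤ 1 / 4) :
    gaussMean zetaStar p T D (1 / 2 - x) ≤
      36 * (2 * T) ^ (p * x) * gaussMean zetaStar p T D (1 / 2 + x) + 1000000 * D := by
  have hT0 : 0 < T := by linarith
  have hi := (stripGrowth_zetaStar (a := 1 / 4) (b := 2) le_rfl).integrable (T := T) hp hD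
    (σ := 1 / 2 + x) (by linarith) (by linarith)
  have hg := integrable_gauss_weight (T := T) (D := 2 * D) (by positivity)
  have hpt : ∀ t : ℝ, ‖zetaStar ((1 / 2 - x : ℝ) + t * I)‖ ^ p * Real.exp (-((t - T) / D) ^ 2) ≤
      36 * (2 * T) ^ (p * x) * (‖zetaStar ((1 / 2 + x : ℝ) + t * I)‖ ^ p *
        Real.exp (-((t - T) / D) ^ 2)) + 204800 * Real.exp (-((t - T) / (2 * D)) ^ 2) := by
    intro t
    rcases le_or_gt (T / 2) |t - T| with h | h
    · exact (zetaStar_tail_le hp hp2 hT hD htail hx hx' h).trans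
        (le_add_of_nonneg_left (by positivity))
    · refine le_trans ?_ (le_add_of_nonneg_right (by positivity))
      rw [← mul_assoc]
      refine mul_le_mul_of_nonneg_right ?_ (by positivity)
      obtain ⟨h1, h2⟩ := abs_lt.1 h
      have ht : 0 < t := by linarith
      have h3 := norm_zetaStar_reflect hx (by linarith) (t := t) (by rw [abs_of_pos ht]; linarith)
      rw [abs_of_pos ht] at h3
      have h4 : (2 * Real.exp 1) ^ p ≤ 36 := by
        calc (2 * Real.exp 1) ^ p ≤ 6 ^ p := by
              gcongr
              linarith [Real.exp_one_lt_d9]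
          _ ≤ 6 ^ (2:ℝ) := Real.rpow_le_rpow_of_exponent_le (by norm_num) hp2
          _ = 36 := by norm_num
      calc _ ≤ (2 * Real.exp 1 * t ^ x * ‖zetaStar ((1 / 2 + x : ℝ) + t * I)‖) ^ p := by gcongr
        _ = (2 * Real.exp 1) ^ p * t ^ (p * x) * ‖zetaStar ((1 / 2 + x : ℝ) + t * I)‖ ^ p := by
            rw [Real.mul_rpow (by positivity) (norm_nonneg _),
              Real.mul_rpow (by positivity) (by positivity), ← Real.rpow_mul ht.le, mul_comm x p]
        _ ≤ _ := by
            gcongr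
            linarith
  calc gaussMean zetaStar p T D (1 / 2 - x) ≤ ∫ t : ℝ,
        (36 * (2 * T) ^ (p * x) * (‖zetaStar ((1 / 2 + x : ℝ) + t * I)‖ ^ p *
        Real.exp (-((t - T) / D) ^ 2)) + 204800 * Real.exp (-((t - T) / (2 * D)) ^ 2)) :=
        integral_mono_of_nonneg (Eventually.of_forall fun _ => by positivity)
          ((hi.const_mul _).add (hg.const_mul _)) (Eventually.of_forall hpt)
    _ = 36 * (2 * T) ^ (p * x) * gaussMean zetaStar p T D (1 / 2 + x) +
        204800 * ∫ t : ℝ, Real.exp (-((t - T) / (2 * D)) ^ 2) := by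
        rw [integral_add (hi.const_mul _) (hg.const_mul _), integral_const_mul, integral_const_mul,
          gaussMean]
    _ ≤ _ := by
        have := integral_gauss_weight_le (T := T) (D := 2 * D) (by positivity)
        linarith

theorem stripGrowth_dirPoly (a : ℕ → ℂ) (N : ℕ) {e : ℝ} (he : 0 ≤ e) (σ₀ σ₁ : ℝ) :
    StripGrowth (fun s => dirPoly a N (e * s)) σ₀ σ₁ := by
  refine ⟨fun s _ _ => ?_, ∑ m ∈ Finset.Icc 1 N, ‖a m‖ * (m : ℝ) ^ (-(e * σ₀)), 0,
    by positivity, fun s h1 _ => ?_⟩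
  · exact ((differentiable_dirPoly a N).comp (differentiable_id.const_mul (e : ℂ))).analyticAt s
  · rw [pow_zero, mul_one]
    refine (norm_dirPoly_le a N _).trans (Finset.sum_le_sum fun m hm => ?_)
    have : (1:ℝ) ≤ m := by exact_mod_cast (Finset.mem_Icc.1 hm).1
    gcongr
    rw [Complex.re_ofReal_mul]; gcongr

theorem stripGrowth_zetaPowPoly (z : ℝ) (N : ℕ) (a b : ℝ) : StripGrowth (zetaPowPoly z N) a b := by
  have := stripGrowth_dirPoly (fun m => (genDivisor z m : ℂ)) N (e := 1) zero_le_one a b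
  simp only [Complex.ofReal_one, one_mul] at this
  exact this

theorem gaussMean_zetaPowPoly_le {z T D σ : ℝ} (hz : |z| ≤ 1) {N : ℕ} (hN : 3 ≤ N) (hD : 2 * N ≤ D)
    (hσ : 1 / 2 ≤ σ) :
    gaussMean (zetaPowPoly z N) 2 T D σ ≤ 24 * D * (45 * Real.log N) ^ (z ^ 2) := by
  have hN' : (3:ℝ) ≤ N := by exact_mod_cast hN
  have hD0 : 0 < D := by linarith
  have h := dirPoly_mean_value (T := T) (fun m => (genDivisor z m : ℂ)) hD0 hD (le_refl (1:ℝ)) σ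
  simp only [Complex.ofReal_one, one_mul] at h
  refine h.trans ?_
  have h2 := sum_genDivisor_sq_le hz hN hσ
  have h3 : 0 ≤ (45 * Real.log N) ^ (z ^ 2) := by
    have := Real.log_nonneg (by linarith : (1:ℝ) ≤ N)
    positivity
  calc _ ≤ 8 * D * (Real.exp 1 * (45 * Real.log N) ^ (z ^ 2)) := by gcongr
    _ ≤ 8 * D * (3 * (45 * Real.log N) ^ (z ^ 2)) := by
        gcongr
        linarith [Real.exp_one_lt_d9]
    _ = _ := by ring

theorem gaussMean_poleFactor_mul_pow_le {T D σ : ℝ} {F : ℂ → ℂ} {n : ℕ} (hn : 1 ≤ n) (hD : 0 < D)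
    (hσ : 0 ≤ σ) (hF : StripGrowth F σ σ) :
    gaussMean (fun s => poleFactor s * F s ^ n) (2 / n) T D σ ≤ gaussMean F 2 T D σ := by
  have hn0 : (n:ℝ) ≠ 0 := by exact_mod_cast (by omega : n ≠ 0)
  refine gaussMean_mono hF (by norm_num) hD le_rfl le_rfl fun t => ?_
  calc ‖poleFactor (σ + t * I) * F (σ + t * I) ^ n‖ ^ (2 / n : ℝ)
      ≤ (‖F (σ + t * I)‖ ^ n) ^ (2 / n : ℝ) := by
        rw [norm_mul, norm_pow]
        gcongr
        exact mul_le_of_le_one_left (by positivity) (norm_poleFactor_le (by rwa [line_re]))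
    _ = _ := by
        rw [← Real.rpow_natCast, ← Real.rpow_mul (norm_nonneg _)]
        congr 1
        field_simp

/-- The `2/n`-th moment of zeta on the critical line, in terms of the mean square of the Dirichlet
polynomial that approximates its `n`-th root. -/
theorem gaussMean_zetaStar_half_le {T D Y : ℝ} {n N : ℕ} (hn : 1 ≤ n) (hT : 8 ≤ T) (hD : 8 ≤ D)
    (htail : D ^ 4 * Real.exp (-(T / D) ^ 2 / 8) ≤ 1) (hN : 1 ≤ N)
    (hN6 : 4 * n / (N : ℝ) ^ 6 ≤ T ^ (-(21 / 5) : ℝ)) (hnT : 480 * n ≤ Real.log T) (hDY : D ≤ Y)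
    (hY : ∀ σ, 1 / 2 ≤ σ → gaussMean (zetaPowPoly (1 / n) N) 2 T D σ ≤ Y) :
    gaussMean zetaStar (2 / n) T D (1 / 2) ≤ Real.exp 140 * Y := by
  have hn0 : (1:ℝ) ≤ n := by exact_mod_cast hn
  set p : ℝ := 2 / n with hp
  have hp0 : 0 < p := by positivity
  have hp2 : p ≤ 2 := div_le_self (by norm_num) hn0
  have hT0 : 0 < T := by linarith
  have hD0 : 0 < D := by linarith
  have hY0 : 0 < Y := by linarith
  have hlog : 0 < Real.log T := by linarith
  set x : ℝ := 120 * n / Real.log T with hx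
  have hx0 : 0 < x := by positivity
  have hx1 : x ≤ 1 / 4 := by rw [hx, div_le_iff₀ hlog]; linarith
  have hpx : Real.log T * (p * x) = 240 := by
    rw [hp, hx]; field_simp; norm_num
  have hpx1 : p * x ≤ 1 / 2 := by nlinarith
  have hTpow : ∀ c : ℝ, T ^ (c * (p * x)) = Real.exp (240 * c) := by
    intro c
    rw [Real.rpow_def_of_pos hT0]
    congr 1
    linear_combination c * hpx
  set J := gaussMean zetaStar p T D (1 / 2) with hJ
  have hJ0 : 0 ≤ J := gaussMean_nonneg ..
  set S : ℂ → ℂ := zetaPowPoly (1 / n) N with hS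
  set P : ℂ → ℂ := fun s => poleFactor s * S s ^ n with hP
  have gP : StripGrowth P (1 / 2) 8 :=
    (stripGrowth_poleFactor (by norm_num)).mul ((stripGrowth_zetaPowPoly _ _ _ _).pow n)
  have gZ : StripGrowth zetaStar (1 / 4) 8 := stripGrowth_zetaStar le_rfl
  have gZ' : StripGrowth zetaStar (1 / 2) 8 := stripGrowth_zetaStar (by norm_num)
  have gK : StripGrowth (fun s => zetaStar s - P s) (1 / 2) 8 := gZ'.sub gP
  have hPY : ∀ σ, 1 / 2 ≤ σ → gaussMean P p T D σ ≤ Y := fun σ hσ =>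
    (gaussMean_poleFactor_mul_pow_le hn hD0 (by linarith)
      (stripGrowth_zetaPowPoly _ _ _ _)).trans (hY σ hσ)
  set V := 4 * J + 5 * Y with hV
  have hV0 : 0 < V := by positivity
  have hKhalf : gaussMean (fun s => zetaStar s - P s) p T D (1 / 2) ≤ V := by
    have := gaussMean_sub_le (T := T) gZ' gP hp0 hp2 hD0 le_rfl (by norm_num)
    linarith [hPY (1 / 2) le_rfl]
  have hK8 : gaussMean (fun s => zetaStar s - P s) p T D 8 ≤ 2 * D * (T ^ (-(21 / 5) : ℝ)) ^ p := by
    refine gaussMean_le_of_norm_le hp0 hD0 fun t => ?_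
    have hre : (((8:ℝ) : ℂ) + t * I).re = 8 := line_re _ _
    have hne : ((8:ℝ) : ℂ) + t * I ≠ 1 := by
      intro h
      rw [h] at hre; norm_num at hre
    simp only [hP]
    rw [zetaStar_eq hne, ← mul_sub, norm_mul]
    refine (mul_le_of_le_one_left (norm_nonneg _) (norm_poleFactor_le (by rw [hre]; norm_num))).trans
      ((norm_riemannZeta_sub_zetaPowPoly_pow_le hn hN hre).trans hN6)
  set b : ℝ := 2 / 15 * x with hb
  have hKx : gaussMean (fun s => zetaStar s - P s) p T D (1 / 2 + x) ≤
      6 * V * T ^ (-(14 / 25) * (p * x)) := by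
    have h := gaussMean_convex (T := T) gK (by norm_num) hp0 hD0
      (by rw [abs_of_pos (by norm_num)]; linarith) (by rw [abs_of_pos (by norm_num)]; linarith)
      hV0 (by positivity) hKhalf hK8 (x := b) (by positivity) (by linarith)
    rw [show (1 - b) * (1 / 2) + b * 8 = 1 / 2 + x by rw [hb]; ring] at h
    refine h.trans ?_
    have e1 : ((2 * D * (T ^ (-(21 / 5) : ℝ)) ^ p)) ^ b =
        (2 * D) ^ b * T ^ (-(14 / 25) * (p * x)) := by
      rw [Real.mul_rpow (by positivity) (by positivity), ← Real.rpow_mul hT0.le,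
        ← Real.rpow_mul hT0.le]
      congr 2
      rw [hb]; ring
    have e2 : (2 * D) ^ b ≤ 2 * V ^ b := by
      calc (2 * D) ^ b ≤ (2 * V) ^ b := by gcongr; linarith
        _ = 2 ^ b * V ^ b := Real.mul_rpow (by norm_num) hV0.le
        _ ≤ 2 * V ^ b := by
          gcongr
          calc (2:ℝ) ^ b ≤ 2 ^ (1:ℝ) :=
                Real.rpow_le_rpow_of_exponent_le (by norm_num) (by linarith)
            _ = 2 := Real.rpow_one 2
    have e3 : V ^ (1 - b) * V ^ b = V := by
      rw [← Real.rpow_add hV0]; simp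
    rw [e1]
    calc _ ≤ 3 * (V ^ (1 - b) * (2 * V ^ b * T ^ (-(14 / 25) * (p * x)))) := by
          gcongr
          linarith [Real.exp_one_lt_d9]
      _ = 6 * (V ^ (1 - b) * V ^ b) * T ^ (-(14 / 25) * (p * x)) := by ring
      _ = _ := by rw [e3]
  rw [hTpow] at hKx
  set ε := Real.exp (240 * -(14 / 25)) with hε
  have hε0 : 0 < ε := Real.exp_pos _
  have hJx : gaussMean zetaStar p T D (1 / 2 + x) ≤ 24 * V * ε + 4 * Y := by
    have := gaussMean_add_le (T := T) (σ := 1 / 2 + x) gK gP hp0 hp2 hD0 (by linarith) (by linarith)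
    simp only [sub_add_cancel] at this
    refine this.trans ?_
    linarith [hPY (1 / 2 + x) (by linarith)]
  set B := 24 * V * ε + 5 * Y with hB
  have hB0 : 0 < B := by positivity
  have hJm : gaussMean zetaStar p T D (1 / 2 - x) ≤ 1000000 * (2 * T) ^ (p * x) * B := by
    refine (gaussMean_zetaStar_reflect hp0 hp2 hT hD0 htail hx0.le hx1).trans ?_
    have h1 : 1 ≤ (2 * T) ^ (p * x) := Real.one_le_rpow (by linarith) (by positivity)
    have h2 : gaussMean zetaStar p T D (1 / 2 + x) ≤ B - Y := by linarith
    have h3 : 0 ≤ B - Y := by rw [hB]; have : 0 ≤ 24 * V * ε := by positivity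
                              linarith
    calc _ ≤ 36 * (2 * T) ^ (p * x) * (B - Y) + 1000000 * Y := by gcongr
      _ ≤ 1000000 * (2 * T) ^ (p * x) * (B - Y) + 1000000 * ((2 * T) ^ (p * x) * Y) := by
          gcongr
          · norm_num
          · exact le_mul_of_one_le_left hY0.le h1
      _ = _ := by ring
  have hmain : J ≤ 6000 * Real.exp 120 * B := by
    have h := gaussMean_convex (T := T) (gZ.mono (a' := 1 / 2 - x) (b' := 1 / 2 + x) (by linarith)
      (by linarith)) (by linarith) hp0 hD0
      (by rw [abs_of_pos (by linarith)]; linarith) (by rw [abs_of_pos (by linarith)]; linarith)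
      (by positivity) hB0 hJm (hJx.trans (by linarith)) (x := 1 / 2) (by norm_num) (by norm_num)
    rw [show (1 - 1 / 2) * (1 / 2 - x) + 1 / 2 * (1 / 2 + x) = 1 / 2 by ring] at h
    refine h.trans ?_
    have e1 : (1000000 * (2 * T) ^ (p * x) * B) ^ (1 - 1 / 2 : ℝ) =
        1000 * (2 * T) ^ (1 / 2 * (p * x)) * B ^ (1 / 2 : ℝ) := by
      rw [Real.mul_rpow (by positivity) hB0.le, Real.mul_rpow (by norm_num) (by positivity),
        ← Real.rpow_mul (by positivity)]
      congr 2
      · rw [show (1000000:ℝ) = 1000 ^ (2:ℝ) by norm_num, ← Real.rpow_mul (by norm_num)]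
        norm_num
      · ring_nf
      · norm_num
    have e2 : (2 * T) ^ (1 / 2 * (p * x)) ≤ 2 * Real.exp 120 := by
      rw [Real.mul_rpow (by norm_num) hT0.le, hTpow]
      have : (2:ℝ) ^ (1 / 2 * (p * x)) ≤ 2 := by
        calc (2:ℝ) ^ (1 / 2 * (p * x)) ≤ 2 ^ (1:ℝ) :=
              Real.rpow_le_rpow_of_exponent_le (by norm_num) (by linarith)
          _ = 2 := Real.rpow_one 2
      have e : Real.exp (240 * (1 / 2)) = Real.exp 120 := by norm_num
      rw [e]
      gcongr
    have e3 : B ^ (1 / 2 : ℝ) * B ^ (1 / 2 : ℝ) = B := by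
      rw [← Real.rpow_add hB0]; norm_num
    rw [e1]
    calc _ ≤ 3 * (1000 * (2 * Real.exp 120) * B ^ (1 / 2 : ℝ) * B ^ (1 / 2 : ℝ)) := by
          gcongr
          linarith [Real.exp_one_lt_d9]
      _ = 6000 * Real.exp 120 * (B ^ (1 / 2 : ℝ) * B ^ (1 / 2 : ℝ)) := by ring
      _ = _ := by rw [e3]
  have hE : Real.exp 120 * ε * 1152000 ≤ 1 := by
    have h1 : (1152000:ℝ) ≤ Real.exp 14 := by
      have h2 : (2.7182818 : ℝ) ^ 14 ≤ Real.exp 1 ^ 14 := by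
        gcongr
        linarith [Real.exp_one_gt_d9]
      rw [← Real.exp_nat_mul] at h2
      norm_num at h2 ⊢
      linarith
    calc Real.exp 120 * ε * 1152000 ≤ Real.exp 120 * ε * Real.exp 14 := by gcongr
      _ = Real.exp (120 + 240 * -(14 / 25) + 14) := by rw [hε, ← Real.exp_add, ← Real.exp_add]
      _ ≤ 1 := by rw [Real.exp_le_one_iff]; norm_num
  have hF : (120000:ℝ) ≤ Real.exp 20 := by
    have h2 : (2.7 : ℝ) ^ 20 ≤ Real.exp 1 ^ 20 := by
      gcongr
      linarith [Real.exp_one_gt_d9]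
    rw [← Real.exp_nat_mul] at h2
    norm_num at h2 ⊢
    linarith
  have hone : 1 ≤ Real.exp 120 := Real.one_le_exp (by norm_num)
  have h140 : Real.exp 140 = Real.exp 120 * Real.exp 20 := by rw [← Real.exp_add]; norm_num
  have f1 : 6000 * Real.exp 120 * B = Real.exp 120 * ε * 1152000 * (V / 8) +
      30000 * Real.exp 120 * Y := by rw [hB]; ring
  have f2 : Real.exp 120 * ε * 1152000 * (V / 8) ≤ V / 8 := mul_le_of_le_one_left (by positivity) hE
  have f3 : Real.exp 120 * Y * 120000 ≤ Real.exp 120 * Y * Real.exp 20 := by gcongr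
  have f4 : Y ≤ Real.exp 120 * Y := le_mul_of_one_le_left hY0.le hone
  rw [h140]
  linarith

/-- Admissible sizes for a window of length `D` at height `T`, together with the length `N` of the
Dirichlet polynomials that approximate the `n`-th root of zeta there. -/
structure WindowParams (T D : ℝ) (n N : ℕ) : Prop where
  one_le_n : 1 ≤ n
  eight_le_T : 8 ≤ T
  eight_le_D : 8 ≤ D
  tail : D ^ 4 * Real.exp (-(T / D) ^ 2 / 8) ≤ 1
  three_le_N : 3 ≤ N
  two_mul_N_le : 2 * N ≤ D
  N_le_T : (N : ℝ) ≤ T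
  approx : 8 * n / (N : ℝ) ^ 6 ≤ T ^ (-(21 / 5) : ℝ)
  n_le_log : 480 * n ≤ Real.log T

/-- The size of the fractional moments. -/
def momentSize (T D : ℝ) (n : ℕ) : ℝ := D * Real.exp (Real.log (Real.log T) / n ^ 2)

namespace WindowParams
variable {T D : ℝ} {n N : ℕ} (h : WindowParams T D n N)
include h

theorem T_pos : 0 < T := by linarith [h.eight_le_T]
theorem D_pos : 0 < D := by linarith [h.eight_le_D]
theorem one_le_n_real : (1:ℝ) ≤ n := by exact_mod_cast h.one_le_n
theorem log_ge : 480 ≤ Real.log T := by linarith [h.n_le_log, h.one_le_n_real]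
theorem D_le : D ≤ momentSize T D n :=
  le_mul_of_one_le_right h.D_pos.le
    (Real.one_le_exp (div_nonneg (Real.log_nonneg (by linarith [h.log_ge])) (by positivity)))
theorem momentSize_pos : 0 < momentSize T D n := h.D_pos.trans_le h.D_le

theorem zetaPowPoly_le {z : ℝ} (hz : |z| = 1 / n) {σ : ℝ} (hσ : 1 / 2 ≤ σ) :
    gaussMean (zetaPowPoly z N) 2 T D σ ≤ 1080 * momentSize T D n := by
  have hn := h.one_le_n_real
  have hz1 : |z| ≤ 1 := by rw [hz]; exact div_le_one_of_le₀ hn (by positivity)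
  refine (gaussMean_zetaPowPoly_le hz1 h.three_le_N h.two_mul_N_le hσ).trans ?_
  have hz2 : z ^ 2 = 1 / n ^ 2 := by rw [← sq_abs, hz]; ring
  have hz3 : z ^ 2 ≤ 1 := (sq_le_one_iff_abs_le_one z).2 hz1
  have hlog := h.log_ge
  have hN3 : (3:ℝ) ≤ N := by exact_mod_cast h.three_le_N
  have h1 : Real.log N ≤ Real.log T := Real.log_le_log (by linarith) h.N_le_T
  have h0 : 0 ≤ Real.log N := Real.log_nonneg (by linarith)
  have hD := h.D_pos
  calc 24 * D * (45 * Real.log N) ^ (z ^ 2) ≤ 24 * D * (45 * Real.log T) ^ (z ^ 2) := by gcongr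
    _ = 24 * D * (45 ^ (z ^ 2) * Real.exp (Real.log (Real.log T) / n ^ 2)) := by
        rw [Real.mul_rpow (by norm_num) (by linarith),
          Real.rpow_def_of_pos (by linarith : 0 < Real.log T), hz2, mul_one_div]
    _ ≤ 24 * D * (45 ^ (1:ℝ) * Real.exp (Real.log (Real.log T) / n ^ 2)) := by
        gcongr
        norm_num
    _ = _ := by rw [momentSize, Real.rpow_one]; ring

theorem zetaStar_half_le :
    gaussMean zetaStar (2 / n) T D (1 / 2) ≤ Real.exp 148 * momentSize T D n := by
  have hY := h.momentSize_pos
  have := gaussMean_zetaStar_half_le (Y := 1080 * momentSize T D n) h.one_le_n h.eight_le_T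
    h.eight_le_D h.tail (by linarith [h.three_le_N]) (le_trans (by gcongr; norm_num) h.approx)
    h.n_le_log (by linarith [h.D_le])
    fun σ hσ => h.zetaPowPoly_le (abs_of_nonneg (by positivity)) hσ
  refine this.trans ?_
  have h8 : (1080:ℝ) ≤ Real.exp 8 := by
    have h2 : (2.7 : ℝ) ^ 8 ≤ Real.exp 1 ^ 8 := by
      gcongr
      linarith [Real.exp_one_gt_d9]
    rw [← Real.exp_nat_mul] at h2
    norm_num at h2 ⊢
    linarith
  rw [show (148:ℝ) = 140 + 8 by norm_num, Real.exp_add, mul_assoc]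
  gcongr

theorem convex_to_eight {F : ℂ → ℂ} {p c : ℝ} (hF : StripGrowth F (1 / 2) 8) (hp : 0 < p)
    {A B : ℝ} (hA : 0 < A) (hB : 0 < B) (hBA : B ≤ A)
    (h1 : gaussMean F p T D (1 / 2) ≤ A) (hc : 0 ≤ c)
    (h2 : gaussMean F p T D 8 ≤ B * T ^ (-c)) {x : ℝ} (hx0 : 0 ≤ x) (hx1 : x ≤ 15 / 2) :
    gaussMean F p T D (1 / 2 + x) ≤ Real.exp 1 * A * T ^ (-(2 / 15 * c * x)) := by
  have hT := h.T_pos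
  have hD := h.eight_le_D
  have key := gaussMean_convex (T := T) hF (by norm_num) hp h.D_pos
    (by rw [abs_of_pos (by norm_num)]; linarith) (by rw [abs_of_pos (by norm_num)]; linarith)
    hA (by positivity) h1 h2 (x := 2 / 15 * x) (by positivity) (by linarith)
  rw [show (1 - 2 / 15 * x) * (1 / 2) + 2 / 15 * x * 8 = 1 / 2 + x by ring] at key
  refine key.trans ?_
  rw [Real.mul_rpow hB.le (by positivity), ← Real.rpow_mul hT.le,
    show -c * (2 / 15 * x) = -(2 / 15 * c * x) by ring]
  have e : A ^ (1 - 2 / 15 * x) * A ^ (2 / 15 * x) = A := by rw [← Real.rpow_add hA]; simp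
  calc _ ≤ Real.exp 1 * (A ^ (1 - 2 / 15 * x) * (A ^ (2 / 15 * x) * T ^ (-(2 / 15 * c * x)))) := by
        gcongr
    _ = Real.exp 1 * (A ^ (1 - 2 / 15 * x) * A ^ (2 / 15 * x)) * T ^ (-(2 / 15 * c * x)) := by ring
    _ = _ := by rw [e]

theorem zetaStar_right_le {σ : ℝ} (h1 : 1 / 2 ≤ σ) (h2 : σ ≤ 8) :
    gaussMean zetaStar (2 / n) T D σ ≤ Real.exp 149 * momentSize T D n := by
  have hY := h.momentSize_pos
  have hn := h.one_le_n_real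
  have hD := h.D_pos
  have hp2 : (2 / n : ℝ) ≤ 2 := div_le_self (by norm_num) hn
  have h8 : gaussMean zetaStar (2 / n) T D 8 ≤ 8 * momentSize T D n * T ^ (-(0:ℝ)) := by
    have : gaussMean zetaStar (2 / n) T D 8 ≤ 2 * D * 2 ^ (2 / n : ℝ) := by
      refine gaussMean_le_of_norm_le (by positivity) h.D_pos fun t => ?_
      have hre : (((8:ℝ) : ℂ) + t * I).re = 8 := line_re _ _
      have hne : ((8:ℝ) : ℂ) + t * I ≠ 1 := by
        intro h
        rw [h] at hre; norm_num at hre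
      rw [zetaStar_eq hne, norm_mul]
      exact (mul_le_of_le_one_left (norm_nonneg _)
        (norm_poleFactor_le (by rw [hre]; norm_num))).trans (norm_riemannZeta_eight_le hre)
    refine this.trans ?_
    have h3 : (2:ℝ) ^ (2 / n : ℝ) ≤ 4 := by
      calc (2:ℝ) ^ (2 / n : ℝ) ≤ 2 ^ (2:ℝ) := Real.rpow_le_rpow_of_exponent_le (by norm_num) hp2
        _ = 4 := by norm_num
    rw [neg_zero, Real.rpow_zero, mul_one]
    nlinarith [h.D_le]
  have h3 := h.convex_to_eight (stripGrowth_zetaStar (by norm_num)) (by positivity)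
    (by positivity) (by positivity) (by
      gcongr
      linarith [Real.add_one_le_exp (148:ℝ)]) h.zetaStar_half_le le_rfl h8 (x := σ - 1 / 2)
    (by linarith) (by linarith)
  rw [add_sub_cancel] at h3
  refine h3.trans (le_of_eq ?_)
  rw [← mul_assoc, ← Real.exp_add]
  norm_num

theorem zetaStar_left_le {x : ℝ} (h1 : 0 ≤ x) (h2 : x ≤ 1 / 4) :
    gaussMean zetaStar (2 / n) T D (1 / 2 - x) ≤
      Real.exp 160 * momentSize T D n * Real.exp (4 * x * Real.log T / n) := by
  have hn := h.one_le_n_real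
  have hY := h.momentSize_pos
  have hT := h.T_pos
  have hT8 := h.eight_le_T
  have hp2 : (2 / n : ℝ) ≤ 2 := div_le_self (by norm_num) hn
  refine (gaussMean_zetaStar_reflect (by positivity) hp2 h.eight_le_T h.D_pos h.tail h1 h2).trans ?_
  have h3 := h.zetaStar_right_le (σ := 1 / 2 + x) (by linarith) (by linarith)
  have h4 : (2 * T) ^ (2 / n * x : ℝ) ≤ Real.exp (4 * x * Real.log T / n) := by
    rw [Real.rpow_def_of_pos (by linarith)]
    gcongr
    have : Real.log (2 * T) ≤ 2 * Real.log T := by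
      rw [Real.log_mul (by norm_num) hT.ne', two_mul]
      gcongr
      linarith
    calc Real.log (2 * T) * (2 / n * x) ≤ 2 * Real.log T * (2 / n * x) := by gcongr
      _ = _ := by ring
  have h5 : 1 ≤ Real.exp (4 * x * Real.log T / n) :=
    Real.one_le_exp (div_nonneg (mul_nonneg (by positivity) (by linarith [h.log_ge])) (by positivity))
  have h11 : (74:ℝ) ≤ Real.exp 11 := by
    have h2 : (2.7 : ℝ) ^ 11 ≤ Real.exp 1 ^ 11 := by
      gcongr
      linarith [Real.exp_one_gt_d9]
    rw [← Real.exp_nat_mul] at h2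
    norm_num at h2 ⊢
    linarith
  have h148 : (1000000:ℝ) ≤ Real.exp 149 := by
    have h2 : (2.7 : ℝ) ^ 149 ≤ Real.exp 1 ^ 149 := by
      gcongr
      linarith [Real.exp_one_gt_d9]
    rw [← Real.exp_nat_mul] at h2
    norm_num at h2 ⊢
    linarith
  calc _ ≤ 36 * Real.exp (4 * x * Real.log T / n) * (Real.exp 149 * momentSize T D n) +
        Real.exp 149 * momentSize T D n := by
        gcongr
        · exact gaussMean_nonneg ..
        · exact h.D_pos.le
        · exact h.D_le
    _ ≤ 36 * Real.exp (4 * x * Real.log T / n) * (Real.exp 149 * momentSize T D n) +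
        Real.exp 149 * momentSize T D n * Real.exp (4 * x * Real.log T / n) := by
        refine add_le_add le_rfl ?_
        exact le_mul_of_one_le_right (by positivity) h5
    _ ≤ 74 * Real.exp (4 * x * Real.log T / n) * (Real.exp 149 * momentSize T D n) := by
        have : 0 < Real.exp 149 * momentSize T D n * Real.exp (4 * x * Real.log T / n) := by
          positivity
        linarith
    _ ≤ Real.exp 11 * Real.exp (4 * x * Real.log T / n) * (Real.exp 149 * momentSize T D n) := by
        gcongr
    _ = _ := by
        rw [show (160:ℝ) = 11 + 149 by norm_num, Real.exp_add 11 149]; ring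

/-- Fractional moments of zeta in a neighbourhood of the critical line. -/
theorem zetaStar_le {σ x : ℝ} (hx0 : 0 ≤ x) (hx : x ≤ 1 / 4) (h1 : 1 / 2 - x ≤ σ) (h2 : σ ≤ 8) :
    gaussMean zetaStar (2 / n) T D σ ≤
      Real.exp 160 * momentSize T D n * Real.exp (4 * x * Real.log T / n) := by
  have hY := h.momentSize_pos
  have hlog := h.log_ge
  rcases le_or_gt (1 / 2) σ with h3 | h3
  · refine (h.zetaStar_right_le h3 h2).trans ?_
    have h5 : 1 ≤ Real.exp (4 * x * Real.log T / n) :=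
      Real.one_le_exp (div_nonneg (mul_nonneg (by positivity) (by linarith)) (by positivity))
    refine le_trans ?_ (le_mul_of_one_le_right (by positivity) h5)
    gcongr
    norm_num
  · have := h.zetaStar_left_le (x := 1 / 2 - σ) (by linarith) (by linarith)
    rw [sub_sub_cancel] at this
    refine this.trans ?_
    gcongr
    linarith

/-- The function whose smallness forces zeta to be bounded away from zero. -/
def _root_.mollified (n N : ℕ) (s : ℂ) : ℂ :=
  zetaStar s * zetaPowPoly (-(1 / n)) N s ^ n - poleFactor s

omit h in
theorem _root_.stripGrowth_mollified {a b : ℝ} (ha : 1 / 4 ≤ a) :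
    StripGrowth (mollified n N) a b :=
  ((stripGrowth_zetaStar ha).mul ((stripGrowth_zetaPowPoly _ _ _ _).pow n)).sub
    (stripGrowth_poleFactor (by linarith))

theorem mollified_half_le :
    gaussMean (mollified n N) (1 / n) T D (1 / 2) ≤ Real.exp 151 * momentSize T D n := by
  have hn := h.one_le_n_real
  have hY := h.momentSize_pos
  have hD := h.D_pos
  have hq : (1 / n : ℝ) ≤ 2 := (div_le_self (by norm_num) hn).trans (by norm_num)
  set M := zetaPowPoly (-(1 / n)) N with hM
  have gZ : StripGrowth zetaStar (1 / 2) 8 := stripGrowth_zetaStar (by norm_num)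
  have gM : StripGrowth M (1 / 2) 8 := stripGrowth_zetaPowPoly _ _ _ _
  have h1 : gaussMean (fun s => zetaStar s * M s ^ n) (1 / n) T D (1 / 2) ≤
      gaussMean zetaStar (2 / n) T D (1 / 2) + gaussMean M 2 T D (1 / 2) := by
    have i1 := gZ.integrable (T := T) (D := D) (p := 2 / n) (σ := 1 / 2) (by positivity) hD le_rfl
      (by norm_num)
    have i2 := gM.integrable (T := T) (D := D) (p := 2) (σ := 1 / 2) (by norm_num) hD le_rfl
      (by norm_num)
    rw [gaussMean, gaussMean, gaussMean, ← integral_add i1 i2]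
    refine integral_mono_of_nonneg (Eventually.of_forall fun _ => by positivity) (i1.add i2)
      (Eventually.of_forall fun t => ?_)
    simp only
    rw [← add_mul]
    refine mul_le_mul_of_nonneg_right ?_ (by positivity)
    rw [norm_mul, norm_pow, Real.mul_rpow (norm_nonneg _) (by positivity),
      ← Real.rpow_natCast (_ : ℝ) n, ← Real.rpow_mul (norm_nonneg (M _)),
      mul_one_div_cancel (by positivity), Real.rpow_one, Real.rpow_two,
      show (2 / n : ℝ) = 1 / n * (2:ℕ) by push_cast; ring, Real.rpow_mul (norm_nonneg _),
      Real.rpow_natCast]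
    generalize ‖zetaStar _‖ ^ (1 / n : ℝ) = u
    generalize ‖M _‖ = v
    nlinarith [sq_nonneg (u - v), sq_nonneg u, sq_nonneg v]
  have h2 : gaussMean poleFactor (1 / n) T D (1 / 2) ≤ 2 * D := by
    have := gaussMean_le_of_norm_le (F := poleFactor) (p := 1 / n) (T := T) (D := D) (σ := 1 / 2)
      (B := 1) (by positivity) hD fun t => norm_poleFactor_le (by rw [line_re]; norm_num)
    rwa [Real.one_rpow, mul_one] at this
  have h3 := gaussMean_sub_le (T := T) (D := D) (σ := 1 / 2) (gZ.mul (gM.pow n))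
    (stripGrowth_poleFactor (by norm_num)) (p := 1 / n) (by positivity) hq hD le_rfl (by norm_num)
  have h4 := h.zetaStar_half_le
  have h5 : gaussMean M 2 T D (1 / 2) ≤ 1080 * momentSize T D n := h.zetaPowPoly_le
    (by rw [abs_neg, abs_of_nonneg (by positivity)]) le_rfl
  have h6 : (1100:ℝ) ≤ Real.exp 148 := by
    have h2 : (2.7 : ℝ) ^ 148 ≤ Real.exp 1 ^ 148 := by
      gcongr
      linarith [Real.exp_one_gt_d9]
    rw [← Real.exp_nat_mul] at h2
    norm_num at h2 ⊢
    linarith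
  have h7 : (8:ℝ) ≤ Real.exp 3 := by
    have h2 : (2.7 : ℝ) ^ 3 ≤ Real.exp 1 ^ 3 := by
      gcongr
      linarith [Real.exp_one_gt_d9]
    rw [← Real.exp_nat_mul] at h2
    norm_num at h2 ⊢
    linarith
  calc gaussMean (mollified n N) (1 / n) T D (1 / 2) ≤ _ := h3
    _ ≤ 4 * (Real.exp 148 * momentSize T D n + 1080 * momentSize T D n + 2 * momentSize T D n) := by
        linarith [h.D_le]
    _ ≤ 8 * (Real.exp 148 * momentSize T D n) := by nlinarith
    _ ≤ Real.exp 3 * (Real.exp 148 * momentSize T D n) := by gcongr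
    _ = _ := by rw [← mul_assoc, ← Real.exp_add]; norm_num

theorem mollified_le {x : ℝ} (hx0 : 0 ≤ x) (hx1 : x ≤ 15 / 2) :
    gaussMean (mollified n N) (1 / n) T D (1 / 2 + x) ≤
      Real.exp 152 * momentSize T D n * Real.exp (-(x * Real.log T / (2 * n))) := by
  have hn := h.one_le_n_real
  have hY := h.momentSize_pos
  have hT := h.T_pos
  have h8 : gaussMean (mollified n N) (1 / n) T D 8 ≤ 2 * D * T ^ (-(21 / 5 / n) : ℝ) := by
    have := gaussMean_le_of_norm_le (F := mollified n N) (p := 1 / n) (T := T) (D := D) (σ := 8)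
      (B := T ^ (-(21 / 5) : ℝ)) (by positivity) h.D_pos fun t => ?_
    · rwa [← Real.rpow_mul hT.le, show (-(21 / 5) * (1 / n) : ℝ) = -(21 / 5 / n) by ring] at this
    · have hre : (((8:ℝ) : ℂ) + t * I).re = 8 := line_re _ _
      have hne : ((8:ℝ) : ℂ) + t * I ≠ 1 := by
        intro h
        rw [h] at hre; norm_num at hre
      rw [mollified, zetaStar_eq hne, mul_assoc, ← mul_sub_one, norm_mul]
      exact (mul_le_of_le_one_left (norm_nonneg _) (norm_poleFactor_le (by rw [hre]; norm_num))).trans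
        ((norm_riemannZeta_mul_zetaPowPoly_pow_sub_one_le h.one_le_n
          (by linarith [h.three_le_N]) hre).trans h.approx)
  have hD := h.D_pos
  have key := h.convex_to_eight (stripGrowth_mollified (by norm_num)) (by positivity) (by positivity)
    (by positivity) (by
      have := Real.add_one_le_exp (151:ℝ)
      have := h.D_le
      nlinarith) h.mollified_half_le (by positivity) h8 hx0 hx1
  refine key.trans ?_
  rw [← mul_assoc (Real.exp 1), ← Real.exp_add, show (1 + 151 : ℝ) = 152 by norm_num]
  gcongr
  rw [Real.rpow_def_of_pos hT, Real.exp_le_exp, mul_neg, neg_le_neg_iff]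
  have : 0 ≤ x * Real.log T / n :=
    div_nonneg (mul_nonneg hx0 (by linarith [h.log_ge])) (by positivity)
  calc x * Real.log T / (2 * n) = 1 / 2 * (x * Real.log T / n) := by field_simp
    _ ≤ 14 / 25 * (x * Real.log T / n) := mul_le_mul_of_nonneg_right (by norm_num) this
    _ = _ := by ring

end WindowParams

/-- The primes up to `Y`. -/
def primesUpTo (Y : ℕ) : Finset ℕ := (Finset.Icc 1 Y).filter Nat.Prime

theorem mem_primesUpTo {Y p : ℕ} : p ∈ primesUpTo Y ↔ p.Prime ∧ p ≤ Y := by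
  simp only [primesUpTo, Finset.mem_filter, Finset.mem_Icc]
  exact ⟨fun h => ⟨h.2, h.1.2⟩, fun h => ⟨⟨h.1.one_lt.le, h.2⟩, h.1⟩⟩

/-- The prime sum of length `Y`. -/
def primeSum (Y : ℕ) (s : ℂ) : ℂ := ∑ p ∈ primesUpTo Y, (p : ℂ) ^ (-s)

/-- The coefficients of the `j`-th power of a prime sum. -/
def primePowCoeff (Y j m : ℕ) : ℕ :=
  ∑ k ∈ (Finset.piAntidiag (primesUpTo Y) j).filter
    (fun k => ∏ p ∈ primesUpTo Y, p ^ k p = m), Nat.multinomial (primesUpTo Y) k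

theorem prod_pow_injOn (Y j : ℕ) : Set.InjOn (fun k : ℕ → ℕ => ∏ p ∈ primesUpTo Y, p ^ k p)
    (Finset.piAntidiag (primesUpTo Y) j) := by
  have key : ∀ k ∈ Finset.piAntidiag (primesUpTo Y) j, ∀ q ∈ primesUpTo Y,
      (∏ p ∈ primesUpTo Y, p ^ k p).factorization q = k q := by
    intro k _ q hq
    rw [Nat.factorization_prod fun p hp => pow_ne_zero _ (mem_primesUpTo.1 hp).1.ne_zero]
    rw [Finsupp.finsetSum_apply, Finset.sum_eq_single q]
    · simp [(mem_primesUpTo.1 hq).1.factorization]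
    · intro p hp hpq
      simp [(mem_primesUpTo.1 hp).1.factorization, hpq]
    · exact fun h => absurd hq h
  intro k hk l hl hkl
  funext q
  by_cases hq : q ∈ primesUpTo Y
  · rw [← key k hk q hq, ← key l hl q hq]
    exact congrArg (fun m => m.factorization q) hkl
  · have h1 := (Finset.mem_piAntidiag.1 hk).2 q
    have h2 := (Finset.mem_piAntidiag.1 hl).2 q
    rw [not_imp_comm.1 h1 hq, not_imp_comm.1 h2 hq]

theorem primePowCoeff_le (Y j m : ℕ) : primePowCoeff Y j m ≤ j.factorial := by
  unfold primePowCoeff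
  have hcard : ((Finset.piAntidiag (primesUpTo Y) j).filter
      (fun k => ∏ p ∈ primesUpTo Y, p ^ k p = m)).card ≤ 1 := by
    refine Finset.card_le_one.2 fun k hk l hl => ?_
    rw [Finset.mem_filter] at hk hl
    exact prod_pow_injOn Y j hk.1 hl.1 (hk.2.trans hl.2.symm)
  refine (Finset.sum_le_card_nsmul _ _ j.factorial fun k hk => ?_).trans ?_
  · rw [Finset.mem_filter, Finset.mem_piAntidiag] at hk
    rw [← hk.1.1, ← Nat.multinomial_spec]
    exact Nat.le_mul_of_pos_left _ (Finset.prod_pos fun i _ => Nat.factorial_pos _)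
  · rw [smul_eq_mul]
    exact Nat.mul_le_of_le_div _ _ _ (by simpa [Nat.div_self (Nat.factorial_pos j)] using hcard)

theorem natCast_prod_pow_cpow (Y : ℕ) (k : ℕ → ℕ) (s : ℂ) :
    ((∏ p ∈ primesUpTo Y, p ^ k p : ℕ) : ℂ) ^ s = ∏ p ∈ primesUpTo Y, ((p : ℂ) ^ s) ^ k p := by
  induction primesUpTo Y using Finset.induction_on with
  | empty => simp
  | insert a u ha ih =>
    rw [Finset.prod_insert ha, Finset.prod_insert ha, Nat.cast_mul, Complex.natCast_mul_natCast_cpow,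
      ih, Nat.cast_pow, ← Complex.natCast_cpow_natCast_mul, Complex.cpow_nat_mul]

theorem primeSum_pow (Y j : ℕ) (s : ℂ) :
    primeSum Y s ^ j = dirPoly (fun m => (primePowCoeff Y j m : ℂ)) (Y ^ j) s := by
  have hmaps : ∀ k ∈ Finset.piAntidiag (primesUpTo Y) j,
      ∏ p ∈ primesUpTo Y, p ^ k p ∈ Finset.Icc 1 (Y ^ j) := by
    intro k hk
    rw [Finset.mem_Icc]
    refine ⟨Finset.prod_pos fun p hp => pow_pos (mem_primesUpTo.1 hp).1.pos _, ?_⟩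
    rw [← (Finset.mem_piAntidiag.1 hk).1, ← Finset.prod_pow_eq_pow_sum]
    exact Finset.prod_le_prod' fun p hp => Nat.pow_le_pow_left (mem_primesUpTo.1 hp).2 _
  rw [primeSum, Finset.sum_pow_eq_sum_piAntidiag, dirPoly, ← Finset.sum_fiberwise_of_maps_to hmaps]
  refine Finset.sum_congr rfl fun m _ => ?_
  unfold primePowCoeff
  rw [Nat.cast_sum, Finset.sum_mul]
  refine Finset.sum_congr rfl fun k hk => ?_
  rw [← (Finset.mem_filter.1 hk).2, natCast_prod_pow_cpow]

theorem sum_primePowCoeff (Y j : ℕ) (σ : ℝ) :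
    ∑ m ∈ Finset.Icc 1 (Y ^ j), (primePowCoeff Y j m : ℝ) * (m : ℝ) ^ (-σ) =
      (∑ p ∈ primesUpTo Y, (p : ℝ) ^ (-σ)) ^ j := by
  have h := primeSum_pow Y j σ
  unfold primeSum dirPoly at h
  have e : ∀ m : ℕ, (m : ℂ) ^ (-(σ : ℂ)) = (((m : ℝ) ^ (-σ) : ℝ) : ℂ) := by
    intro m
    rw [Complex.ofReal_cpow (Nat.cast_nonneg m)]
    push_cast
    rfl
  simp_rw [e] at h
  exact_mod_cast h.symm

theorem sum_primePowCoeff_sq_le (Y j : ℕ) (σ : ℝ) :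
    ∑ m ∈ Finset.Icc 1 (Y ^ j), ‖(primePowCoeff Y j m : ℂ)‖ ^ 2 * (m : ℝ) ^ (-σ) ≤
      j.factorial * (∑ p ∈ primesUpTo Y, (p : ℝ) ^ (-σ)) ^ j := by
  rw [← sum_primePowCoeff, Finset.mul_sum]
  refine Finset.sum_le_sum fun m _ => ?_
  rw [Complex.norm_natCast, ← mul_assoc]
  gcongr
  rw [sq]
  gcongr
  exact_mod_cast primePowCoeff_le Y j m

theorem gaussMean_primeSum_le {Y j : ℕ} {T D e : ℝ} (hD0 : 0 < D) (hD : 2 * (Y : ℝ) ^ j ≤ D)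
    (he : 1 ≤ e) (σ : ℝ) :
    gaussMean (fun s => primeSum Y (e * s)) (2 * j : ℝ) T D σ ≤
      8 * D * (j.factorial * (∑ p ∈ primesUpTo Y, (p : ℝ) ^ (-(2 * e * σ))) ^ j) := by
  have h := (dirPoly_mean_value (fun m => (primePowCoeff Y j m : ℂ)) (N := Y ^ j) (T := T) hD0
    (by push_cast; exact hD) he σ).trans (mul_le_mul_of_nonneg_left
      (sum_primePowCoeff_sq_le Y j (2 * e * σ)) (by positivity : 0 ≤ 8 * D))
  refine le_trans (le_of_eq ?_) h
  unfold gaussMean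
  congr 1
  ext t
  congr 1
  simp only
  rw [← primeSum_pow, norm_pow, ← Real.rpow_natCast (‖_‖) j, ← Real.rpow_mul (norm_nonneg _)]
  congr 1
  ring

theorem sum_prime_inv_le {Y : ℕ} (hY : 3 ≤ Y) :
    ∑ p ∈ primesUpTo Y, (p : ℝ) ^ (-1 : ℝ) ≤ 8 * (Real.log (Real.log Y) + 4) := by
  have hN0 : (3:ℝ) ≤ Y := by exact_mod_cast hY
  have hlog : 1 ≤ Real.log Y := by
    rw [Real.le_log_iff_exp_le (by linarith)]
    linarith [Real.exp_one_lt_d9]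
  set R := Real.log (45 * Real.log Y) with hR
  have h45 : Real.log 45 ≤ 4 := by
    rw [Real.log_le_iff_le_exp (by norm_num)]
    have h2 : (2.7 : ℝ) ^ 4 ≤ Real.exp 1 ^ 4 := by
      gcongr
      linarith [Real.exp_one_gt_d9]
    rw [← Real.exp_nat_mul] at h2
    norm_num at h2 ⊢
    linarith
  have hR1 : 1 ≤ R := by
    rw [hR, Real.le_log_iff_exp_le (by linarith)]
    linarith [Real.exp_one_lt_d9]
  have hR4 : R ≤ Real.log (Real.log Y) + 4 := by
    rw [hR, Real.log_mul (by norm_num) (by linarith)]; linarith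
  have h := sum_genDivisor_le (z := 1 / R) (by positivity) (div_le_one_of_le₀ hR1 (by linarith)) hY
  have h3 : (45 * Real.log Y) ^ (1 / R) = Real.exp 1 := by
    rw [Real.rpow_def_of_pos (by linarith), ← hR, mul_one_div_cancel (by linarith)]
  rw [h3] at h
  have h4 : ∑ p ∈ primesUpTo Y, 1 / R * (p : ℝ) ^ (-1 : ℝ) ≤
      ∑ m ∈ Finset.Icc 1 Y, genDivisor (1 / R) m * (m : ℝ) ^ (-1 : ℝ) := by
    calc _ = ∑ p ∈ primesUpTo Y, genDivisor (1 / R) p * (p : ℝ) ^ (-1 : ℝ) := by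
          refine Finset.sum_congr rfl fun p hp => ?_
          have := genDivisor_prime_pow (1 / R) (mem_primesUpTo.1 hp).1 1
          rw [pow_one] at this
          rw [this]
          simp [binomCoeff]
      _ ≤ _ := Finset.sum_le_sum_of_subset_of_nonneg (Finset.filter_subset _ _) fun m _ _ =>
          mul_nonneg (genDivisor_nonneg (by positivity) m) (by positivity)
  rw [← Finset.mul_sum] at h4
  have h5 := h4.trans h
  rw [one_div_mul_eq_div, div_le_iff₀ (by linarith)] at h5
  have h6 : Real.exp 1 * Real.exp 1 ≤ 8 := by
    nlinarith [Real.exp_one_lt_d9, Real.exp_one_gt_d9]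
  calc _ ≤ _ := h5
    _ ≤ 8 * R := by gcongr
    _ ≤ _ := by gcongr

theorem sum_prime_rpow_le_two {Y : ℕ} {σ : ℝ} (hσ : 2 ≤ σ) :
    ∑ p ∈ primesUpTo Y, (p : ℝ) ^ (-σ) ≤ 2 := by
  refine le_trans ?_ tsum_inv_sq_le_two
  refine le_trans ?_ (hasSum_zeta_two.summable.sum_le_tsum (primesUpTo Y) fun m _ => by positivity)
  refine Finset.sum_le_sum fun p hp => ?_
  have hp1 : (1:ℝ) ≤ p := by exact_mod_cast (mem_primesUpTo.1 hp).1.one_lt.le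
  rw [one_div, ← Real.rpow_two, ← Real.rpow_neg (by linarith)]
  exact Real.rpow_le_rpow_of_exponent_le hp1 (by linarith)

/-- The logarithm of the Euler product over the primes up to `Y`. -/
def eulerLog (Y : ℕ) (s : ℂ) : ℂ := ∑ p ∈ primesUpTo Y, -Complex.log (1 - (p : ℂ) ^ (-s))

theorem differentiableAt_primeSum (Y : ℕ) (s : ℂ) : DifferentiableAt ℂ (primeSum Y) s := by
  unfold primeSum
  refine DifferentiableAt.fun_sum fun p hp => ?_
  have : (p : ℂ) ≠ 0 := by exact_mod_cast (mem_primesUpTo.1 hp).1.ne_zero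
  exact DifferentiableAt.const_cpow (by fun_prop) (Or.inl this)

theorem differentiableAt_eulerLog (Y : ℕ) {s : ℂ} (hs : 0 < s.re) :
    DifferentiableAt ℂ (eulerLog Y) s := by
  unfold eulerLog
  refine DifferentiableAt.fun_sum fun p hp => ?_
  have hp' := (mem_primesUpTo.1 hp).1
  have : (p : ℂ) ≠ 0 := by exact_mod_cast hp'.ne_zero
  refine (DifferentiableAt.clog ?_ ?_).neg
  · exact (DifferentiableAt.const_cpow (by fun_prop) (Or.inl this)).const_sub 1
  · rw [sub_eq_add_neg]
    exact Complex.mem_slitPlane_of_norm_lt_one (by rw [norm_neg]; exact norm_prime_cpow_lt_one hp' hs)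

theorem norm_primeSum_le (Y : ℕ) (s : ℂ) :
    ‖primeSum Y s‖ ≤ ∑ p ∈ primesUpTo Y, (p : ℝ) ^ (-s.re) := by
  refine (norm_sum_le _ _).trans (Finset.sum_le_sum fun p hp => ?_)
  rw [norm_natCast_cpow_neg (mem_primesUpTo.1 hp).1.one_lt.le]

theorem exists_norm_eulerLog_sub_le : ∃ C : ℝ, 0 ≤ C ∧ ∀ (Y : ℕ) (s : ℂ), 1 / 2 ≤ s.re →
    ‖eulerLog Y s - (primeSum Y s + primeSum Y (2 * s) / 2)‖ ≤ C := by
  set c : ℝ := 1 - (2:ℝ) ^ (-(1 / 2) : ℝ) with hc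
  have hc0 : 0 < c := by
    have := Real.rpow_lt_one_of_one_lt_of_neg (x := 2) (z := -(1 / 2)) (by norm_num) (by norm_num)
    linarith
  have hsum : Summable fun m : ℕ => (m : ℝ) ^ (-(3 / 2) : ℝ) :=
    Real.summable_nat_rpow.2 (by norm_num)
  refine ⟨∑' m : ℕ, (m : ℝ) ^ (-(3 / 2) : ℝ) * c⁻¹, tsum_nonneg fun m => by positivity,
    fun Y s hs => ?_⟩
  have e : eulerLog Y s - (primeSum Y s + primeSum Y (2 * s) / 2) =
      ∑ p ∈ primesUpTo Y, -(Complex.log (1 + -(p : ℂ) ^ (-s)) -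
        Complex.logTaylor (2 + 1) (-(p : ℂ) ^ (-s))) := by
    unfold eulerLog primeSum
    rw [Finset.sum_div, ← Finset.sum_add_distrib, ← Finset.sum_sub_distrib]
    refine Finset.sum_congr rfl fun p hp => ?_
    have : (p : ℂ) ^ (-(2 * s)) = ((p : ℂ) ^ (-s)) ^ 2 := by
      rw [← Complex.cpow_nat_mul]
      push_cast
      ring_nf
    rw [this]
    simp [Complex.logTaylor, Finset.sum_range_succ]
    ring
  rw [e]
  refine (norm_sum_le _ _).trans (le_trans (Finset.sum_le_sum fun p hp => ?_)
    ((hsum.mul_right c⁻¹).sum_le_tsum (primesUpTo Y) fun m _ => by positivity))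
  have hp' := (mem_primesUpTo.1 hp).1
  have hp1 : (1:ℝ) ≤ p := by exact_mod_cast hp'.one_lt.le
  have hlt := norm_prime_cpow_lt_one hp' (s := s) (by linarith)
  rw [norm_neg]
  refine (Complex.norm_log_sub_logTaylor_le 2 (by rwa [norm_neg])).trans ?_
  rw [norm_neg]
  have hn : ‖(p : ℂ) ^ (-s)‖ ≤ (p : ℝ) ^ (-(1 / 2) : ℝ) := by
    rw [norm_natCast_cpow_neg hp'.one_lt.le]
    exact Real.rpow_le_rpow_of_exponent_le hp1 (by linarith)
  have hn2 : (p : ℝ) ^ (-(1 / 2) : ℝ) ≤ (2:ℝ) ^ (-(1 / 2) : ℝ) :=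
    Real.rpow_le_rpow_of_nonpos (by norm_num) (by exact_mod_cast hp'.two_le) (by norm_num)
  have h3 : ‖(p : ℂ) ^ (-s)‖ ^ (2 + 1) ≤ (p : ℝ) ^ (-(3 / 2) : ℝ) := by
    calc ‖(p : ℂ) ^ (-s)‖ ^ (2 + 1) ≤ ((p : ℝ) ^ (-(1 / 2) : ℝ)) ^ (2 + 1) := by gcongr
      _ = _ := by
        rw [← Real.rpow_natCast, ← Real.rpow_mul (by linarith)]
        norm_num
  have h4 : (1 - ‖(p : ℂ) ^ (-s)‖)⁻¹ ≤ c⁻¹ := by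
    refine inv_anti₀ hc0 ?_
    linarith
  refine (div_le_self (mul_nonneg (by positivity) (inv_nonneg.2 (by linarith))) (by norm_num)).trans ?_
  gcongr

theorem norm_riemannZeta_mul_exp_eulerLog_sub_one_le {Y : ℕ} (hY : 2 ≤ Y) {s : ℂ} (hs : s.re = 8) :
    ‖riemannZeta s * cexp (-eulerLog Y s) - 1‖ ≤ 8 / (Y : ℝ) ^ 6 := by
  have hs1 : 1 < s.re := by rw [hs]; norm_num
  have hY0 : (2:ℝ) ≤ Y := by exact_mod_cast hY
  set g : Nat.Primes → ℂ := fun p => -Complex.log (1 - (p : ℂ) ^ (-s)) with hg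
  set F : Finset Nat.Primes := (primesUpTo Y).subtype Nat.Prime with hF
  have hFsum : ∑ p ∈ F, g p = eulerLog Y s := by
    rw [hF]
    exact Finset.sum_subtype_of_mem (p := Nat.Prime)
      (fun p : ℕ => -Complex.log (1 - (p : ℂ) ^ (-s)))
      (fun p hp => (mem_primesUpTo.1 hp).1)
  have htail := (summable_logZeta hs1).sum_add_tsum_compl (s := F)
  change ∑ p ∈ F, g p + _ = logZeta s at htail
  rw [hFsum] at htail
  set w := ∑' x : ↑((F : Set Nat.Primes)ᶜ), g x with hw
  have hzeta : riemannZeta s * cexp (-eulerLog Y s) = cexp w := by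
    rw [← exp_logZeta hs1, ← htail, ← Complex.exp_add]
    congr 1
    change _ + w + _ = w
    ring
  have hsum2 : Summable fun m : ℕ => 2 / (Y : ℝ) ^ 6 * (1 / (m : ℝ) ^ 2) :=
    hasSum_zeta_two.summable.mul_left _
  have hb : ‖w‖ ≤ 4 / (Y : ℝ) ^ 6 := by
    have hs3 : Summable fun p : Nat.Primes => 2 / (Y : ℝ) ^ 6 * (1 / ((p : ℕ) : ℝ) ^ 2) :=
      hsum2.subtype {p : ℕ | p.Prime}
    have h1 : ‖w‖ ≤ ∑' x : ↑((F : Set Nat.Primes)ᶜ), 2 / (Y : ℝ) ^ 6 * (1 / ((x.1 : ℕ) : ℝ) ^ 2) := by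
      refine tsum_of_norm_bounded (hs3.subtype _).hasSum ?_
      rintro ⟨p, hp⟩
      have hpY : Y < (p : ℕ) := by
        by_contra hcon
        push Not at hcon
        apply hp
        exact Finset.mem_coe.2 (Finset.mem_subtype.2 (mem_primesUpTo.2 ⟨p.2, hcon⟩))
      have hp0 : (Y : ℝ) < (p : ℕ) := by exact_mod_cast hpY
      have hn := norm_natCast_cpow_le hs (p : ℕ)
      have hpp : (0:ℝ) < (p : ℕ) := by linarith
      have h8 : 1 / ((p : ℕ) : ℝ) ^ 8 ≤ 1 / (Y : ℝ) ^ 6 * (1 / ((p : ℕ) : ℝ) ^ 2) := by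
        rw [div_mul_div_comm, one_mul]
        refine one_div_le_one_div_of_le (by positivity) ?_
        calc (Y : ℝ) ^ 6 * ((p : ℕ) : ℝ) ^ 2 ≤ ((p : ℕ) : ℝ) ^ 6 * ((p : ℕ) : ℝ) ^ 2 := by gcongr
          _ = _ := by ring
      have hhalf : ‖-((p : ℕ) : ℂ) ^ (-s)‖ ≤ 1 / 2 := by
        rw [norm_neg]
        refine hn.trans ?_
        refine one_div_le_one_div_of_le (by norm_num) ?_
        calc (2:ℝ) ≤ 2 ^ 8 := by norm_num
          _ ≤ _ := by gcongr; linarith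
      change ‖-Complex.log (1 - ((p : ℕ) : ℂ) ^ (-s))‖ ≤ _
      rw [norm_neg, sub_eq_add_neg]
      refine (Complex.norm_log_one_add_half_le_self hhalf).trans ?_
      rw [norm_neg]
      have e : 2 / (Y : ℝ) ^ 6 * (1 / ((p : ℕ) : ℝ) ^ 2) =
        2 * (1 / (Y : ℝ) ^ 6 * (1 / ((p : ℕ) : ℝ) ^ 2)) := by ring
      change _ ≤ 2 / (Y : ℝ) ^ 6 * (1 / ((p : ℕ) : ℝ) ^ 2)
      rw [e]
      nlinarith [norm_nonneg (((p : ℕ) : ℂ) ^ (-s))]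
    refine h1.trans ?_
    refine (hs3.tsum_subtype_le _ _ fun p => by positivity).trans ?_
    refine (hsum2.tsum_subtype_le _ {p : ℕ | p.Prime} fun p => by positivity).trans ?_
    rw [tsum_mul_left]
    calc 2 / (Y : ℝ) ^ 6 * ∑' m : ℕ, 1 / (m : ℝ) ^ 2 ≤ 2 / (Y : ℝ) ^ 6 * 2 := by
          gcongr; exact tsum_inv_sq_le_two
      _ = _ := by ring
  rw [hzeta]
  have h64 : (2:ℝ) ^ 6 ≤ (Y : ℝ) ^ 6 := by gcongr
  have h1 : ‖w‖ ≤ 1 := hb.trans (by rw [div_le_one (by positivity)]; linarith)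
  refine (Complex.norm_exp_sub_one_le h1).trans ?_
  calc 2 * ‖w‖ ≤ 2 * (4 / (Y : ℝ) ^ 6) := by gcongr
    _ = _ := by ring

/-- Approximation of zeta by a short Euler product to the right of the critical line. -/
theorem norm_riemannZeta_mul_exp_eulerLog_le_half {Y : ℕ} {t x G h σ : ℝ} (hx : 0 < x)
    (hY : Real.exp 14 ≤ Y) (hh : 0 < h) (hht : h < t) (hG : 0 ≤ G)
    (hzeta : ∀ s : ℂ, 1 / 2 + x / 2 ≤ s.re → s.re ≤ 8 → |s.im - t| ≤ h →
      ‖riemannZeta s‖ ≤ Real.exp G)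
    (heuler : ∀ s : ℂ, 1 / 2 + x / 2 ≤ s.re → s.re ≤ 8 → |s.im - t| ≤ h → ‖eulerLog Y s‖ ≤ G)
    (hGx : 2 * G + 6 ≤ x * Real.log Y / 16) (hGh : 2 * G + Real.log Y + 60 ≤ h ^ 2)
    (hσ : 1 / 2 + x ≤ σ) (hσ2 : σ ≤ 2) :
    ‖riemannZeta (σ + t * I) * cexp (-eulerLog Y (σ + t * I)) - 1‖ ≤ 1 / 2 := by
  have hYpos : 0 < (Y : ℝ) := (Real.exp_pos _).trans_le hY
  have hlogY : 14 ≤ Real.log Y := (Real.le_log_iff_exp_le hYpos).2 hY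
  set β := Real.log Y / 8 with hβ
  set s₀ : ℂ := σ + t * I with hs₀
  have hs₀re : s₀.re = σ := line_re _ _
  have hs₀im : s₀.im = t := line_im _ _
  set f : ℂ → ℂ := fun s => riemannZeta s * cexp (-eulerLog Y s) - 1 with hf
  set E : ℂ → ℂ := fun s => cexp (β * (s - s₀) + (s - s₀) ^ 2) with hE
  have hEn : ∀ s, ‖E s‖ = Real.exp (β * (s.re - σ) + (s.re - σ) ^ 2 - (s.im - t) ^ 2) := by
    intro s
    rw [hE]
    simp only
    rw [Complex.norm_exp]
    congr 1
    simp only [Complex.add_re, Complex.re_ofReal_mul, Complex.sub_re, sq, Complex.mul_re,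
      Complex.sub_im, hs₀re, hs₀im, Complex.ofReal_re, Complex.ofReal_im]
    ring
  set U : Set ℂ := Ioo (1 / 2 + x / 2) 8 ×ℂ Ioo (t - h) (t + h) with hU
  have hx2 : 1 / 2 + x / 2 < σ := by linarith
  have hclos : closure U = Icc (1 / 2 + x / 2) 8 ×ℂ Icc (t - h) (t + h) := by
    rw [hU, Complex.closure_reProdIm, closure_Ioo (by linarith), closure_Ioo (by linarith)]
  have hmem : ∀ s ∈ closure U, 1 / 2 + x / 2 ≤ s.re ∧ s.re ≤ 8 ∧ |s.im - t| ≤ h := by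
    intro s hs
    rw [hclos, Complex.mem_reProdIm] at hs
    refine ⟨hs.1.1, hs.1.2, ?_⟩
    rw [abs_le]
    constructor <;> linarith [hs.2.1, hs.2.2]
  have hfb : ∀ s ∈ closure U, ‖f s‖ ≤ 2 * Real.exp (2 * G) := by
    intro s hs
    obtain ⟨h1, h2, h3⟩ := hmem s hs
    have h4 : ‖cexp (-eulerLog Y s)‖ ≤ Real.exp G := by
      refine (Complex.norm_exp_le_exp_norm _).trans ?_
      rw [norm_neg]
      exact Real.exp_le_exp.2 (heuler s h1 h2 h3)
    have h5 : 1 ≤ Real.exp (2 * G) := Real.one_le_exp (by linarith)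
    calc ‖f s‖ ≤ ‖riemannZeta s * cexp (-eulerLog Y s)‖ + ‖(1:ℂ)‖ := norm_sub_le _ _
      _ ≤ Real.exp G * Real.exp G + 1 := by
          rw [norm_mul, norm_one]
          gcongr
          exact hzeta s h1 h2 h3
      _ = Real.exp (2 * G) + 1 := by rw [← Real.exp_add]; ring_nf
      _ ≤ _ := by linarith
  have hdiff : DifferentiableOn ℂ (fun s => f s * E s) (closure U) := by
    intro s hs
    obtain ⟨h1, h2, h3⟩ := hmem s hs
    have hne : s ≠ 1 := by
      rintro rfl
      rw [Complex.one_im, abs_le] at h3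
      linarith [h3.1]
    refine DifferentiableAt.differentiableWithinAt ?_
    have h4 := differentiableAt_riemannZeta hne
    have h5 := differentiableAt_eulerLog Y (s := s) (by linarith)
    exact ((h4.mul h5.neg.cexp).sub_const 1).mul (by rw [hE]; fun_prop)
  have hbd : ∀ s ∈ frontier U, ‖f s * E s‖ ≤ 1 / 2 := by
    intro s hs
    have hsc : s ∈ closure U := hs.1
    have hopen : IsOpen U := isOpen_Ioo.reProdIm isOpen_Ioo
    have hsn : s ∉ U := by
      have := hs.2
      rwa [hopen.interior_eq] at this
    obtain ⟨h1, h2, h3⟩ := hmem s hsc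
    rw [norm_mul, hEn]
    have hsq : (s.re - σ) ^ 2 ≤ 57 := by nlinarith
    have hbase : 2 * Real.exp (2 * G) ≤ Real.exp (2 * G + 1) := by
      rw [Real.exp_add]
      nlinarith [Real.exp_one_gt_d9, Real.exp_pos (2 * G)]
    have hhalf : Real.exp (-1) ≤ 1 / 2 := by
      rw [Real.exp_neg, inv_le_comm₀ (Real.exp_pos _) (by norm_num)]
      linarith [Real.exp_one_gt_d9]
    have hcase : ∀ X : ℝ, 2 * G + 1 + X ≤ -1 → 2 * Real.exp (2 * G) * Real.exp X ≤ 1 / 2 := by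
      intro X hX
      refine le_trans ?_ hhalf
      calc _ ≤ Real.exp (2 * G + 1) * Real.exp X := by gcongr
        _ = Real.exp (2 * G + 1 + X) := (Real.exp_add _ _).symm
        _ ≤ _ := Real.exp_le_exp.2 hX
    by_cases hr : s.re = 8
    · have hY2 : 2 ≤ Y := by
        have : (2:ℝ) ≤ Y := by linarith [Real.add_one_le_exp (14:ℝ)]
        exact_mod_cast this
      have h8 := norm_riemannZeta_mul_exp_eulerLog_sub_one_le hY2 hr
      have e : (Y : ℝ) ^ 6 = Real.exp (6 * Real.log Y) := by
        rw [show (6:ℝ) * Real.log Y = (6:ℕ) * Real.log Y by norm_num, Real.exp_nat_mul,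
          Real.exp_log hYpos]
      have h9 : (8:ℝ) ≤ Real.exp 7 := by linarith [Real.add_one_le_exp (7:ℝ)]
      refine le_trans ?_ hhalf
      calc ‖f s‖ * Real.exp (β * (s.re - σ) + (s.re - σ) ^ 2 - (s.im - t) ^ 2)
          ≤ 8 / (Y : ℝ) ^ 6 * Real.exp (β * (s.re - σ) + (s.re - σ) ^ 2 - (s.im - t) ^ 2) := by
            gcongr
        _ ≤ Real.exp 7 / (Y : ℝ) ^ 6 *
            Real.exp (β * (s.re - σ) + (s.re - σ) ^ 2 - (s.im - t) ^ 2) := by gcongr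
        _ = Real.exp (7 - 6 * Real.log Y +
            (β * (s.re - σ) + (s.re - σ) ^ 2 - (s.im - t) ^ 2)) := by
            rw [e, ← Real.exp_sub, ← Real.exp_add]
        _ ≤ _ := by
            refine Real.exp_le_exp.2 ?_
            have : β * (s.re - σ) ≤ β * 8 := by
              refine mul_le_mul_of_nonneg_left (by linarith) ?_
              rw [hβ]; linarith
            nlinarith [sq_nonneg (s.im - t)]
    · refine (mul_le_mul_of_nonneg_right (hfb s hsc) (Real.exp_pos _).le).trans ?_
      apply hcase
      by_cases hl : s.re = 1 / 2 + x / 2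
      · have h4 : β * (s.re - σ) ≤ β * (-(x / 2)) := by
          refine mul_le_mul_of_nonneg_left (by linarith) ?_
          rw [hβ]; linarith
        have h5 : (s.re - σ) ^ 2 ≤ 9 / 4 := by nlinarith
        have h6 : β * (-(x / 2)) = -(x * Real.log Y / 16) := by rw [hβ]; ring
        nlinarith [sq_nonneg (s.im - t)]
      · have h4 : h ^ 2 ≤ (s.im - t) ^ 2 := by
          rw [← sq_abs (s.im - t)]
          have : h ≤ |s.im - t| := by
            by_contra hcon
            push Not at hcon
            rw [abs_lt] at hcon
            apply hsn
            rw [hU, Complex.mem_reProdIm]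
            refine ⟨⟨lt_of_le_of_ne h1 (Ne.symm hl), lt_of_le_of_ne h2 hr⟩, ?_, ?_⟩ <;> linarith
          gcongr
        have h5 : β * (s.re - σ) ≤ β * 8 := by
          refine mul_le_mul_of_nonneg_left (by linarith) ?_
          rw [hβ]; linarith
        have h6 : β * 8 = Real.log Y := by rw [hβ]; ring
        linarith
  have hbdd : Bornology.IsBounded U := by
    rw [hU]; exact Bornology.IsBounded.reProdIm (Metric.isBounded_Ioo _ _) (Metric.isBounded_Ioo _ _)
  have key := Complex.norm_le_of_forall_mem_frontier_norm_le hbdd hdiff.diffContOnCl hbd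
    (z := s₀) (subset_closure (by
      rw [hU, Complex.mem_reProdIm, hs₀re, hs₀im]
      refine ⟨⟨hx2, by linarith⟩, ?_, ?_⟩ <;> linarith))
  simpa [hE] using key

theorem card_zeros_le_log {f : ℂ → ℂ} {c : ℂ} {r M : ℝ} (hr : 0 < r)
    (hf : AnalyticOnNhd ℂ f (Metric.closedBall c (3 * r))) (hM : 1 ≤ M)
    (hfM : ∀ z ∈ Metric.closedBall c (3 * r), ‖f z‖ ≤ M) (hc : f c ≠ 0) (Z : Finset ℂ)
    (hZ : ∀ z ∈ Z, z ∈ Metric.closedBall c r ∧ f z = 0) :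
    (Z.card : ℝ) ≤ Real.log (M / ‖f c‖) := by
  have h3r : |3 * r| = 3 * r := abs_of_pos (by positivity)
  have hrr : |r| = r := abs_of_pos hr
  have key := AnalyticOnNhd.sum_divisor_le (c := c) (r := r) (R := 3 * r) (M := M) (f := f)
    (by rw [hrr]; exact hr) (by rw [hrr, h3r]; linarith) hM (by rwa [h3r]) hc
    (by rw [h3r]; exact fun z hz => hfM z (Metric.sphere_subset_closedBall hz))
  rw [hrr, mul_div_assoc, div_self hr.ne', mul_one] at key
  have hsub : Metric.closedBall c r ⊆ Metric.closedBall c (3 * r) :=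
    Metric.closedBall_subset_closedBall (by linarith)
  have hf' := hf.mono hsub
  set d := MeromorphicOn.divisor f (Metric.closedBall c r) with hd
  have hfin : (Function.support d).Finite := d.finiteSupport (isCompact_closedBall c r)
  have hnn : ∀ u, 0 ≤ d u := fun u => MeromorphicOn.AnalyticOnNhd.divisor_nonneg hf' u
  have hc0 : analyticOrderAt f c ≠ ⊤ := by
    rw [((hf c (Metric.mem_closedBall_self (by positivity))).analyticOrderAt_eq_zero).2 hc]
    simp
  have hone : ∀ z ∈ Z, 1 ≤ d z := by
    intro z hz
    obtain ⟨hzb, hz0⟩ := hZ z hz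
    rw [hd, MeromorphicOn.AnalyticOnNhd.divisor_apply hf' hzb]
    have h1 : analyticOrderAt f z ≠ ⊤ := hf'.analyticOrderAt_ne_top_of_isPreconnected
      (convex_closedBall c r).isPreconnected (Metric.mem_closedBall_self hr.le) hzb hc0
    have h2 : analyticOrderAt f z ≠ 0 := fun h => ((hf' z hzb).analyticOrderAt_eq_zero).1 h hz0
    have h4 : analyticOrderNatAt f z ≠ 0 := by
      intro h
      apply h2
      rw [← Nat.cast_analyticOrderNatAt h1, h]; rfl
    rw [← Nat.cast_analyticOrderNatAt h1]
    have h5 : (1:ℤ) ≤ (analyticOrderNatAt f z : ℤ) := by exact_mod_cast Nat.one_le_iff_ne_zero.2 h4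
    exact h5
  have hcard : (Z.card : ℤ) ≤ ∑ᶠ u, d u := by
    rw [finsum_eq_sum_of_support_subset (s := hfin.toFinset ∪ Z) d
      (by intro u hu; simp [hu])]
    calc (Z.card : ℤ) = ∑ z ∈ Z, 1 := by simp
      _ ≤ ∑ z ∈ Z, d z := Finset.sum_le_sum hone
      _ ≤ _ := Finset.sum_le_sum_of_subset_of_nonneg Finset.subset_union_right fun u _ _ => hnn u
  have hlog3 : 1 ≤ Real.log 3 := by
    rw [Real.le_log_iff_exp_le (by norm_num)]
    linarith [Real.exp_one_lt_d9]
  have hnorm : 0 < ‖f c‖ := norm_pos_iff.2 hc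
  have hlog : 0 ≤ Real.log (M / ‖f c‖) := Real.log_nonneg
    ((one_le_div hnorm).2 (hfM c (Metric.mem_closedBall_self (by positivity))))
  calc (Z.card : ℝ) ≤ ((∑ᶠ u, d u : ℤ) : ℝ) := by exact_mod_cast hcard
    _ ≤ _ := key
    _ ≤ _ := div_le_self hlog hlog3

theorem exists_finset_cos_eq_zero_of_le {φ : ℝ → ℝ} {l m : ℝ} (α : ℝ)
    (hφ : ContinuousOn φ (uIcc l m)) (k : ℕ) (hk : k * π ≤ φ m - φ l) :
    ∃ Z : Finset ℝ, Z.card = k ∧ ∀ z ∈ Z, z ∈ uIcc l m ∧ Real.cos (φ z - α) = 0 := by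
  set j : ℤ := ⌈(φ l - α - π / 2) / π⌉ with hj
  set v : ℕ → ℝ := fun i => α + π / 2 + (j + i) * π with hv
  have hpi := Real.pi_pos
  have h1 : (φ l - α - π / 2) ≤ j * π := by
    rw [← div_le_iff₀ hpi]; exact Int.le_ceil _
  have h2 : j * π < φ l - α - π / 2 + π := by
    have := Int.ceil_lt_add_one ((φ l - α - π / 2) / π)
    rw [← hj, ← sub_lt_iff_lt_add, lt_div_iff₀ hpi] at this
    linarith
  have hex : ∀ i : ℕ, ∃ z, i < k → z ∈ uIcc l m ∧ φ z = v i := by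
    intro i
    by_cases hi : i < k
    · have hik : (i : ℝ) + 1 ≤ k := by exact_mod_cast hi
      have hi0 : (0:ℝ) ≤ i := Nat.cast_nonneg i
      have hmem : v i ∈ uIcc (φ l) (φ m) := by
        have hle : φ l ≤ φ m := by nlinarith
        rw [uIcc_of_le hle]
        constructor <;> simp only [hv] <;> nlinarith
      obtain ⟨z, hz, hz'⟩ := intermediate_value_uIcc hφ hmem
      exact ⟨z, fun _ => ⟨hz, hz'⟩⟩
    · exact ⟨0, fun h => absurd h hi⟩
  choose z hz using hex
  refine ⟨(Finset.range k).image z, ?_, fun w hw => ?_⟩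
  · rw [Finset.card_image_of_injOn, Finset.card_range]
    intro a ha b hb hab
    have e1 := (hz a (by simpa using ha)).2
    have e2 := (hz b (by simpa using hb)).2
    rw [hab, e2] at e1
    have h3 : ((b:ℝ) - a) * π = 0 := by
      simp only [hv] at e1; linear_combination e1
    have h4 := (mul_eq_zero.1 h3).resolve_right hpi.ne'
    exact_mod_cast (sub_eq_zero.1 h4).symm
  · obtain ⟨i, hi, rfl⟩ := Finset.mem_image.1 hw
    obtain ⟨h3, h4⟩ := hz i (by simpa using hi)
    refine ⟨h3, ?_⟩
    rw [h4, Real.cos_eq_zero_iff]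
    exact ⟨j + i, by simp only [hv]; push_cast; ring⟩

theorem exists_finset_cos_eq_zero {φ : ℝ → ℝ} {l m : ℝ} (α : ℝ)
    (hφ : ContinuousOn φ (uIcc l m)) (k : ℕ) (hk : k * π ≤ |φ m - φ l|) :
    ∃ Z : Finset ℝ, Z.card = k ∧ ∀ z ∈ Z, z ∈ uIcc l m ∧ Real.cos (φ z - α) = 0 := by
  rcases le_total 0 (φ m - φ l) with h | h
  · exact exists_finset_cos_eq_zero_of_le α hφ k (by rwa [abs_of_nonneg h] at hk)
  · rw [abs_of_nonpos h, neg_sub] at hk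
    have := exists_finset_cos_eq_zero_of_le (l := m) (m := l) α (by rwa [uIcc_comm]) k hk
    rwa [uIcc_comm] at this

theorem re_exp_mul_exp_neg (w : ℂ) (α : ℝ) :
    (Complex.exp w * Complex.exp (-(α * I))).re = Real.exp w.re * Real.cos (w.im - α) := by
  rw [← Complex.exp_add, Complex.exp_re]
  simp [sub_eq_add_neg]

/-- If `exp ∘ θ` stays in the right half-plane then the imaginary part of `θ` varies by less
than `π`. -/
theorem abs_im_sub_le_pi {θ : ℝ → ℂ} {l m : ℝ} (hθ : ContinuousOn θ (uIcc l m))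
    (h : ∀ u ∈ uIcc l m, 0 < (Complex.exp (θ u)).re) : |(θ m).im - (θ l).im| ≤ π := by
  by_contra! hlt
  obtain ⟨Z, hZ, hZ'⟩ := exists_finset_cos_eq_zero (φ := fun u => (θ u).im) 0
    (Complex.continuous_im.comp_continuousOn hθ) 1 (by simpa using hlt.le)
  obtain ⟨z, hz⟩ := Finset.card_pos.1 (by omega : 0 < Z.card)
  obtain ⟨h1, h2⟩ := hZ' z hz
  have h3 := h z h1
  rw [Complex.exp_re, ← sub_zero (θ z).im, h2, mul_zero] at h3
  exact lt_irrefl _ h3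

/-- Backlund's bound for the variation of the argument along a real segment inside a disc. -/
theorem abs_im_sub_le_of_disc {f : ℂ → ℂ} {θ : ℝ → ℂ} {c r M l m : ℝ} (hr : 0 < r)
    (hf : AnalyticOnNhd ℂ f (Metric.closedBall (c : ℂ) (3 * r))) (hM : 1 ≤ M)
    (hfM : ∀ z ∈ Metric.closedBall (c : ℂ) (3 * r), ‖f z‖ ≤ M) (hc : f c ≠ 0)
    (hl : |l - c| ≤ r) (hm : |m - c| ≤ r) (hθ : ContinuousOn θ (uIcc l m))
    (hexp : ∀ u ∈ uIcc l m, Complex.exp (θ u) = f u) :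
    |(θ m).im - (θ l).im| ≤ π * (Real.log (M / ‖f c‖) + 1) := by
  set α : ℝ := (f c).arg with hα
  set e : ℂ := Complex.exp (-(α * I)) with he
  set G : ℂ → ℂ := fun z => (f z * e + conj (f (conj z)) * conj e) / 2 with hG
  have hne : ‖e‖ = 1 := by
    rw [he, show -((α : ℂ) * I) = ((-α : ℝ) : ℂ) * I by push_cast; ring, Complex.norm_exp_ofReal_mul_I]
  have hconjmem : ∀ z ∈ Metric.closedBall (c : ℂ) (3 * r), conj z ∈ Metric.closedBall (c : ℂ) (3 * r) := by
    intro z hz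
    rw [mem_closedBall_iff_norm] at hz ⊢
    rwa [← Complex.conj_ofReal c, ← map_sub, Complex.norm_conj]
  have hGan : AnalyticOnNhd ℂ G (Metric.closedBall (c : ℂ) (3 * r)) := by
    intro z hz
    have h1 : AnalyticAt ℂ (fun z => conj (f (conj z))) z := by
      rw [analyticAt_iff_eventually_differentiableAt]
      have h2 := analyticAt_iff_eventually_differentiableAt.1 (hf _ (hconjmem z hz))
      have h3 : Tendsto (fun w : ℂ => conj w) (nhds z) (nhds (conj z)) :=
        Complex.continuous_conj.tendsto z
      filter_upwards [h3.eventually h2] with w hw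
      have := hw.conj_conj
      rwa [Complex.conj_conj] at this
    exact (((hf z hz).mul analyticAt_const).add (h1.mul analyticAt_const)).div analyticAt_const
      two_ne_zero
  have hGM : ∀ z ∈ Metric.closedBall (c : ℂ) (3 * r), ‖G z‖ ≤ M := by
    intro z hz
    have h1 := hfM z hz
    have h2 := hfM _ (hconjmem z hz)
    simp only [hG]
    rw [norm_div, Complex.norm_two, div_le_iff₀ two_pos]
    refine (norm_add_le _ _).trans ?_
    rw [norm_mul, norm_mul, Complex.norm_conj, Complex.norm_conj, hne, mul_one, mul_one]
    linarith
  have hGreal : ∀ u : ℝ, G u = (((f u * e).re : ℝ) : ℂ) := by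
    intro u
    simp only [hG]
    rw [Complex.conj_ofReal, ← map_mul, Complex.add_conj]
    push_cast; ring
  have hGc : G c = (‖f c‖ : ℂ) := by
    rw [hGreal]
    congr 1
    have h1 : f c * e = ‖f c‖ := by
      conv_lhs => rw [← Complex.norm_mul_exp_arg_mul_I (f c)]
      rw [mul_assoc, he, ← Complex.exp_add, ← hα]
      simp
    rw [h1, Complex.ofReal_re]
  have hGc0 : G c ≠ 0 := by
    rw [hGc]; exact_mod_cast (norm_ne_zero_iff.2 hc)
  by_contra! hlt
  set k : ℕ := ⌊|(θ m).im - (θ l).im| / π⌋₊ with hk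
  have hpi := Real.pi_pos
  have hk1 : k * π ≤ |(θ m).im - (θ l).im| := by
    rw [← le_div_iff₀ hpi]; exact Nat.floor_le (by positivity)
  have hk2 : |(θ m).im - (θ l).im| / π < k + 1 := Nat.lt_floor_add_one _
  obtain ⟨Z, hZ, hZ'⟩ := exists_finset_cos_eq_zero (φ := fun u => (θ u).im) α
    (Complex.continuous_im.comp_continuousOn hθ) k hk1
  have key := card_zeros_le_log hr hGan hM hGM hGc0 (Z.image fun u : ℝ => (u : ℂ)) ?_
  · rw [Finset.card_image_of_injective _ Complex.ofReal_injective, hZ, hGc] at key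
    simp only [Complex.norm_real, norm_norm] at key
    rw [div_lt_iff₀ hpi] at hk2
    nlinarith
  · intro w hw
    obtain ⟨u, hu, rfl⟩ := Finset.mem_image.1 hw
    obtain ⟨h1, h2⟩ := hZ' u hu
    constructor
    · rw [mem_closedBall_iff_norm, ← Complex.ofReal_sub, Complex.norm_real, Real.norm_eq_abs]
      have hmem : u ∈ Icc (c - r) (c + r) := by
        have hl' := abs_le.1 hl
        have hm' := abs_le.1 hm
        exact (uIcc_subset_Icc ⟨by linarith, by linarith⟩ ⟨by linarith, by linarith⟩) h1
      rw [abs_le]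
      constructor <;> linarith [hmem.1, hmem.2]
    · rw [hGreal, ← hexp u h1, he, re_exp_mul_exp_neg, h2, mul_zero, Complex.ofReal_zero]

theorem re_riemannZeta_pos {s : ℂ} (hs : s.re = 2) : 0 < (riemannZeta s).re := by
  have hs1 : 1 < s.re := by rw [hs]; norm_num
  have hnorm : ∀ m : ℕ, ‖1 / (m : ℂ) ^ s‖ = 1 / (m : ℝ) ^ 2 := by
    intro m
    rcases Nat.eq_zero_or_pos m with rfl | hm
    · have : s ≠ 0 := by rintro rfl; norm_num at hs
      simp [Complex.zero_cpow this]
    · rw [norm_div, norm_one, Complex.norm_natCast_cpow_of_pos hm, hs, Real.rpow_two]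
  have hsum : Summable fun m : ℕ => 1 / (m : ℂ) ^ s := by
    refine Summable.of_norm ?_
    simp_rw [hnorm]
    exact hasSum_zeta_two.summable
  have h1 : riemannZeta s = 1 + ∑' m : ℕ, 1 / ((m + 2 : ℕ) : ℂ) ^ s := by
    rw [zeta_eq_tsum_one_div_nat_cpow hs1, ← hsum.sum_add_tsum_nat_add 2]
    have : s ≠ 0 := by rintro rfl; norm_num at hs
    simp [Finset.sum_range_succ, Complex.zero_cpow this]
  have h2 : ∑' m : ℕ, 1 / ((m + 2 : ℕ) : ℝ) ^ 2 = π ^ 2 / 6 - 1 := by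
    have := hasSum_zeta_two.summable.sum_add_tsum_nat_add 2
    rw [hasSum_zeta_two.tsum_eq] at this
    simp [Finset.sum_range_succ] at this
    simp only [one_div]
    push_cast
    linarith
  have h3 : ‖∑' m : ℕ, 1 / ((m + 2 : ℕ) : ℂ) ^ s‖ ≤ π ^ 2 / 6 - 1 := by
    rw [← h2]
    refine tsum_of_norm_bounded
      ((summable_nat_add_iff 2).2 hasSum_zeta_two.summable).hasSum fun m => ?_
    rw [hnorm]
  have h4 : π ^ 2 / 6 - 1 < 1 := by nlinarith [Real.pi_lt_d2, Real.pi_pos]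
  rw [h1, Complex.add_re, Complex.one_re]
  have := (abs_le.1 (Complex.abs_re_le_norm (∑' m : ℕ, 1 / ((m + 2 : ℕ) : ℂ) ^ s))).1
  linarith

/-- The abscissae at which the argument of zeta is controlled by Jensen's inequality. -/
def nodeDist (x₀ : ℝ) (j : ℕ) : ℝ := x₀ * (3 / 2) ^ j

theorem nodeDist_pos {x₀ : ℝ} (h : 0 < x₀) (j : ℕ) : 0 < nodeDist x₀ j := by
  unfold nodeDist; positivity

theorem nodeDist_mono {x₀ : ℝ} (h : 0 < x₀) : Monotone (nodeDist x₀) := by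
  intro i j hij
  unfold nodeDist
  gcongr
  norm_num

/-- Variation of the argument of zeta along a horizontal segment from the critical line. -/
theorem abs_im_sub_le_nodes {φ : ℝ → ℂ} {t x₀ W : ℝ} {J : ℕ} (ht : 8 ≤ t) (hx : 0 < x₀)
    (hW : 0 ≤ W) (hJ : 1 / 2 + nodeDist x₀ J ≤ 2) (hx1 : 2 * nodeDist x₀ J + 3 * x₀ ≤ 4)
    (hφ : ContinuousOn φ (Icc (1 / 2) 2))
    (hexp : ∀ σ ∈ Icc (1 / 2 : ℝ) 2, cexp (φ σ) = riemannZeta (σ + t * I))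
    (hbox : ∀ s : ℂ, 1 / 2 - 2 * x₀ ≤ s.re → s.re ≤ 1 / 2 + 2 * nodeDist x₀ J + 4 * x₀ →
      |s.im - t| ≤ nodeDist x₀ J + 3 * x₀ → ‖riemannZeta s‖ ≤ Real.exp (11 * W))
    (hnode : ∀ j ≤ J, Real.exp (-(2 * W)) ≤ ‖riemannZeta ((1 / 2 + nodeDist x₀ j : ℝ) + t * I)‖) :
    |(φ (1 / 2)).im - (φ (1 / 2 + nodeDist x₀ J)).im| ≤ (J + 1) * (π * (13 * W + 1)) := by
  have hpos := nodeDist_pos hx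
  have hmono := nodeDist_mono hx
  have step : ∀ (c r l m : ℝ), 0 < r → 1 / 2 - 2 * x₀ ≤ c - 3 * r →
      c + 3 * r ≤ 1 / 2 + 2 * nodeDist x₀ J + 4 * x₀ → 3 * r ≤ nodeDist x₀ J + 3 * x₀ →
      Real.exp (-(2 * W)) ≤ ‖riemannZeta ((c : ℝ) + t * I)‖ → |l - c| ≤ r → |m - c| ≤ r →
      l ∈ Icc (1 / 2 : ℝ) 2 → m ∈ Icc (1 / 2 : ℝ) 2 →
      |(φ m).im - (φ l).im| ≤ π * (13 * W + 1) := by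
    intro c r l m hr h1 h2 h3 hc hl hm hl' hm'
    have hmem : ∀ z ∈ Metric.closedBall (c : ℂ) (3 * r), |z.re - c| ≤ 3 * r ∧ |z.im| ≤ 3 * r := by
      intro z hz
      rw [mem_closedBall_iff_norm] at hz
      have h4 := (Complex.abs_re_le_norm (z - c)).trans hz
      have h5 := (Complex.abs_im_le_norm (z - c)).trans hz
      simp only [Complex.sub_re, Complex.ofReal_re, Complex.sub_im, Complex.ofReal_im,
        sub_zero] at h4 h5
      exact ⟨h4, h5⟩
    have hsub : uIcc l m ⊆ Icc (1 / 2 : ℝ) 2 := uIcc_subset_Icc hl' hm'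
    have hcpos : 0 < ‖riemannZeta ((c : ℝ) + t * I)‖ := (Real.exp_pos _).trans_le hc
    have key := abs_im_sub_le_of_disc (f := fun z => riemannZeta (z + t * I)) (θ := φ)
      (c := c) (r := r) (M := Real.exp (11 * W)) (l := l) (m := m) hr ?_
      (Real.one_le_exp (by positivity)) ?_ (norm_pos_iff.1 hcpos) hl hm (hφ.mono hsub)
      (fun u hu => hexp u (hsub hu))
    · refine key.trans ?_
      have : Real.log (Real.exp (11 * W) / ‖riemannZeta ((c : ℝ) + t * I)‖) ≤ 13 * W := by
        rw [Real.log_div (Real.exp_pos _).ne' hcpos.ne', Real.log_exp]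
        have := Real.log_le_log (Real.exp_pos _) hc
        rw [Real.log_exp] at this
        linarith
      have hpi := Real.pi_pos
      gcongr
    · intro z hz
      have him := (abs_le.1 (hmem z hz).2).1
      have hne : z + t * I ≠ 1 := by
        intro h
        have := congrArg Complex.im h
        simp at this
        have := hmono (Nat.zero_le J)
        linarith [hpos J]
      refine AnalyticAt.comp' (g := riemannZeta) ?_ (by fun_prop)
      rw [Complex.analyticAt_iff_eventually_differentiableAt]
      filter_upwards [isOpen_ne.mem_nhds hne] with w hw
      exact differentiableAt_riemannZeta hw
    · intro z hz
      obtain ⟨h4, h5⟩ := hmem z hz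
      rw [abs_le] at h4
      refine hbox _ ?_ ?_ ?_
      · simp; linarith
      · simp; linarith
      · simp; linarith
  have h0 : nodeDist x₀ 0 = x₀ := by simp [nodeDist]
  have main : ∀ j ≤ J, |(φ (1 / 2)).im - (φ (1 / 2 + nodeDist x₀ j)).im| ≤
      (j + 1) * (π * (13 * W + 1)) := by
    intro j
    induction j with
    | zero =>
      intro _
      have hj := hmono (Nat.zero_le J)
      rw [h0] at hj ⊢
      have hn := hnode 0 (Nat.zero_le _)
      rw [h0] at hn
      simpa using step (1 / 2 + x₀) x₀ (1 / 2 + x₀) (1 / 2) hx (by linarith) (by linarith)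
        (by linarith) hn (by simp [hx.le]) (by simp [abs_of_pos hx])
        ⟨by linarith, by linarith⟩ ⟨by linarith, by linarith⟩
    | succ j ih =>
      intro hj1
      have ih := ih (by omega)
      have hs : nodeDist x₀ (j + 1) = 3 / 2 * nodeDist x₀ j := by
        unfold nodeDist; ring
      have hj := hmono hj1
      have hpj := hpos j
      have hsj := step (1 / 2 + nodeDist x₀ (j + 1)) (nodeDist x₀ (j + 1) / 3)
        (1 / 2 + nodeDist x₀ (j + 1)) (1 / 2 + nodeDist x₀ j) (by linarith [hpos (j + 1)])
        (by linarith) (by linarith) (by linarith) (hnode _ hj1)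
        (by rw [sub_self, abs_zero]; linarith [hpos (j + 1)])
        (by rw [hs, abs_le]; constructor <;> linarith)
        ⟨by linarith, by linarith⟩ ⟨by linarith, by linarith⟩
      push_cast
      calc |(φ (1 / 2)).im - (φ (1 / 2 + nodeDist x₀ (j + 1))).im|
          ≤ |(φ (1 / 2)).im - (φ (1 / 2 + nodeDist x₀ j)).im| +
            |(φ (1 / 2 + nodeDist x₀ j)).im - (φ (1 / 2 + nodeDist x₀ (j + 1))).im| :=
            abs_sub_le _ _ _
        _ ≤ _ := by linarith
  exact main J le_rfl

/-- The argument of zeta on the critical line, by continuous variation, away from zeros. -/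
theorem abs_argument_le {θ q : ℝ → ℂ} {t x₀ W B : ℝ} {J : ℕ} (ht : 8 ≤ t) (hx : 0 < x₀)
    (hW : 0 ≤ W) (hJ : 1 / 2 + nodeDist x₀ J ≤ 2) (hx1 : 2 * nodeDist x₀ J + 3 * x₀ ≤ 4)
    (hθ : ContinuousOn θ (Icc 0 2)) (hθ0 : θ 0 = Complex.log (riemannZeta 2))
    (h01 : ∀ u ∈ Icc (0:ℝ) 1, cexp (θ u) = riemannZeta (2 + u * t * I))
    (h12 : ∀ u ∈ Icc (1:ℝ) 2, cexp (θ u) = riemannZeta (2 - 3 / 2 * (u - 1) + t * I))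
    (hbox : ∀ s : ℂ, 1 / 2 - 2 * x₀ ≤ s.re → s.re ≤ 1 / 2 + 2 * nodeDist x₀ J + 4 * x₀ →
      |s.im - t| ≤ nodeDist x₀ J + 3 * x₀ → ‖riemannZeta s‖ ≤ Real.exp (11 * W))
    (hnode : ∀ j ≤ J, Real.exp (-(2 * W)) ≤ ‖riemannZeta ((1 / 2 + nodeDist x₀ j : ℝ) + t * I)‖)
    (hq : ContinuousOn q (Icc (1 / 2 + nodeDist x₀ J) 2))
    (hre : ∀ σ ∈ Icc (1 / 2 + nodeDist x₀ J) 2,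
      0 < (riemannZeta ((σ : ℝ) + t * I) * cexp (-q σ)).re)
    (hB : |(q (1 / 2 + nodeDist x₀ J)).im| + |(q 2).im| ≤ B) :
    |(θ 2).im| ≤ 3 * π + B + (J + 1) * (π * (13 * W + 1)) := by
  have hpos := nodeDist_pos hx J
  set σ₁ := 1 / 2 + nodeDist x₀ J with hσ₁
  set φ : ℝ → ℂ := fun σ => θ (1 + (2 - σ) * (2 / 3)) with hφdef
  have hmaps : ∀ σ ∈ Icc (1 / 2 : ℝ) 2, 1 + (2 - σ) * (2 / 3) ∈ Icc (1:ℝ) 2 := by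
    rintro σ ⟨h1, h2⟩
    constructor <;> linarith
  have hφ : ContinuousOn φ (Icc (1 / 2) 2) :=
    hθ.comp (Continuous.continuousOn (by fun_prop))
      fun σ hσ => ⟨by linarith [(hmaps σ hσ).1], (hmaps σ hσ).2⟩
  have hexp : ∀ σ ∈ Icc (1 / 2 : ℝ) 2, cexp (φ σ) = riemannZeta (σ + t * I) := by
    intro σ hσ
    rw [hφdef]
    simp only
    rw [h12 _ (hmaps σ hσ)]
    congr 1
    push_cast
    ring
  have hφ1 : φ (1 / 2) = θ 2 := by rw [hφdef]; norm_num
  have hφ2 : φ 2 = θ 1 := by rw [hφdef]; norm_num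
  have k0 : |(θ 0).im| ≤ π := by rw [hθ0]; rw [Complex.log_im]; exact Complex.abs_arg_le_pi _
  have k1 : |(θ 1).im - (θ 0).im| ≤ π := by
    have hu : uIcc (0:ℝ) 1 = Icc 0 1 := uIcc_of_le zero_le_one
    refine abs_im_sub_le_pi (hθ.mono ?_) fun u hu' => ?_
    · rw [hu]; exact Icc_subset_Icc le_rfl (by norm_num)
    · rw [hu] at hu'
      rw [h01 u hu']
      exact re_riemannZeta_pos (by simp)
  have k2 : |(φ σ₁).im - (φ 2).im| ≤ π + B := by
    have hu : uIcc 2 σ₁ = Icc σ₁ 2 := uIcc_of_ge hJ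
    have hsub : Icc σ₁ 2 ⊆ Icc (1 / 2 : ℝ) 2 := Icc_subset_Icc (by linarith) le_rfl
    have key := abs_im_sub_le_pi (θ := fun σ => φ σ - q σ) (l := 2) (m := σ₁)
      (by rw [hu]; exact (hφ.mono hsub).sub hq) (fun σ hσ => by
        rw [hu] at hσ
        rw [sub_eq_add_neg, Complex.exp_add, hexp σ (hsub hσ)]
        exact hre σ hσ)
    simp only [Complex.sub_im] at key
    have e : (φ σ₁).im - (φ 2).im = ((φ σ₁).im - (q σ₁).im - ((φ 2).im - (q 2).im)) +
      ((q σ₁).im - (q 2).im) := by ring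
    rw [e]
    refine (abs_add_le _ _).trans ?_
    have := abs_sub (q σ₁).im (q 2).im
    linarith
  have k3 := abs_im_sub_le_nodes ht hx hW hJ hx1 hφ hexp hbox hnode
  rw [← hσ₁, hφ1] at k3
  rw [hφ2] at k2
  have e : (θ 2).im = (((θ 2).im - (φ σ₁).im) + ((φ σ₁).im - (θ 1).im)) +
      (((θ 1).im - (θ 0).im) + (θ 0).im) := by ring
  rw [e]
  refine (abs_add_le _ _).trans ?_
  have a1 := abs_add_le ((θ 2).im - (φ σ₁).im) ((φ σ₁).im - (θ 1).im)
  have a2 := abs_add_le ((θ 1).im - (θ 0).im) (θ 0).im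
  linarith

theorem countable_riemannZetaZeros : riemannZetaZeros.Countable := by
  have := isDiscrete_riemannZetaZeros.to_subtype
  exact Set.countable_coe_iff.1 countable_of_Lindelof_of_discrete

theorem norm_riemannZeta_le_two {s : ℂ} (hs : 2 ≤ s.re) : ‖riemannZeta s‖ ≤ 2 := by
  rw [zeta_eq_tsum_one_div_nat_cpow (by linarith)]
  refine (tsum_of_norm_bounded hasSum_zeta_two.summable.hasSum
    fun m => ?_).trans tsum_inv_sq_le_two
  rcases Nat.eq_zero_or_pos m with rfl | h
  · have : s ≠ 0 := by rintro rfl; norm_num at hs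
    simp [Complex.zero_cpow this]
  · have h1 : (1:ℝ) ≤ m := by exact_mod_cast h
    rw [norm_div, norm_one, Complex.norm_natCast_cpow_of_pos h]
    gcongr
    rw [← Real.rpow_two]
    exact Real.rpow_le_rpow_of_exponent_le h1 hs

theorem momentSize_mul_exp (T D : ℝ) (n : ℕ) (a b : ℝ) :
    Real.exp a * momentSize T D n * Real.exp b =
      D * Real.exp (a + (Real.log (Real.log T) / n ^ 2 + b)) := by
  rw [momentSize, Real.exp_add, Real.exp_add]; ring

namespace WindowParams
variable {T D : ℝ} {n N : ℕ} (h : WindowParams T D n N)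
include h

/-- Large values of zeta in a small box around a point of the critical line are rare. -/
theorem volume_zetaStar_box_le {x₀ W : ℝ} {J : ℕ} (hx : 0 < x₀) (hxW : x₀ * Real.log T = W)
    (hxJ : nodeDist x₀ J + 5 * x₀ ≤ 1 / 2) :
    volume {t : ℝ | t ∈ Icc T (T + D) ∧ ∃ s : ℂ, 1 / 2 - 2 * x₀ ≤ s.re ∧
        s.re ≤ 1 / 2 + 2 * nodeDist x₀ J + 4 * x₀ ∧ |s.im - t| ≤ nodeDist x₀ J + 3 * x₀ ∧
        Real.exp (20 * W / n) ≤ ‖zetaStar s‖ ^ (2 / n : ℝ)} ≤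
      ENNReal.ofReal (D * Real.exp (200 + J + Real.log (Real.log T) / n ^ 2 - 8 * W / n)) := by
  have hn := h.one_le_n_real
  have hD := h.D_pos
  have hD8 := h.eight_le_D
  have hpos := nodeDist_pos hx J
  have hge : x₀ ≤ nodeDist x₀ J := by
    have := nodeDist_mono hx (Nat.zero_le J)
    simpa [nodeDist] using this
  set X := nodeDist x₀ J with hX
  have key := volume_box_large_le (F := zetaStar) (p := 2 / n) (T := T) (D := D) (r := x₀)
    (h := X + 3 * x₀) (v := Real.exp (20 * W / n)) (a := 1 / 2 - 2 * x₀) (b := 1 / 2 + 2 * X + 4 * x₀)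
    (M := Real.exp 160 * momentSize T D n * Real.exp (4 * (3 * x₀) * Real.log T / n))
    hx (by linarith) (by linarith) (by linarith) measurable_zetaStar
    (stripGrowth_zetaStar (by linarith)) (by positivity) hD (Real.exp_pos _)
    (fun σ hσ => h.zetaStar_le (x := 3 * x₀) (by linarith) (by linarith) (by linarith [hσ.1])
      (by linarith [hσ.2]))
  refine key.trans (ENNReal.ofReal_le_ofReal ?_)
  have hr : X = x₀ * (3 / 2) ^ J := rfl
  have hpow : ((3 / 2 : ℝ) ^ J) ^ 2 ≤ Real.exp J := by
    rw [← pow_mul, mul_comm J 2, pow_mul, ← Real.exp_one_rpow, Real.rpow_natCast]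
    have : (3 / 2 : ℝ) ^ 2 ≤ Real.exp 1 := by linarith [Real.exp_one_gt_d9]
    gcongr
  have e4 : 4 * (3 * x₀) * Real.log T / n = 12 * W / n := by rw [← hxW]; ring
  rw [momentSize_mul_exp, e4]
  have hgeo : 2 * (X + 3 * x₀ + x₀) * (1 / 2 + 2 * X + 4 * x₀ - (1 / 2 - 2 * x₀) + 2 * x₀) ≤
      100 * x₀ ^ 2 * Real.exp J := by
    calc _ ≤ 2 * (5 * X) * (10 * X) := by
          gcongr <;> linarith
      _ = 100 * x₀ ^ 2 * ((3 / 2) ^ J) ^ 2 := by rw [hr]; ring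
      _ ≤ _ := by gcongr
  have h100 : (100:ℝ) ≤ Real.exp 36 * π := by
    have h1 : (37:ℝ) ≤ Real.exp 36 := by linarith [Real.add_one_le_exp (36:ℝ)]
    nlinarith [Real.pi_gt_three]
  rw [div_le_iff₀ (by positivity)]
  calc Real.exp 4 * (2 * (X + 3 * x₀ + x₀) *
        (1 / 2 + 2 * X + 4 * x₀ - (1 / 2 - 2 * x₀) + 2 * x₀) *
        (D * Real.exp (160 + (Real.log (Real.log T) / n ^ 2 + 12 * W / n))))
      ≤ Real.exp 4 * (100 * x₀ ^ 2 * Real.exp J *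
        (D * Real.exp (160 + (Real.log (Real.log T) / n ^ 2 + 12 * W / n)))) := by gcongr
    _ ≤ Real.exp 4 * (Real.exp 36 * π * x₀ ^ 2 * Real.exp J *
        (D * Real.exp (160 + (Real.log (Real.log T) / n ^ 2 + 12 * W / n)))) := by gcongr
    _ = (D * (Real.exp 4 * Real.exp 36 * Real.exp J *
        Real.exp (160 + (Real.log (Real.log T) / n ^ 2 + 12 * W / n)))) * (π * x₀ ^ 2) := by ring
    _ = (D * Real.exp (4 + 36 + J + (160 + (Real.log (Real.log T) / n ^ 2 + 12 * W / n)))) *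
        (π * x₀ ^ 2) := by simp only [Real.exp_add]
    _ = (D * (Real.exp (200 + J + Real.log (Real.log T) / n ^ 2 - 8 * W / n) *
        Real.exp (20 * W / n))) * (π * x₀ ^ 2) := by
        rw [← Real.exp_add]; ring_nf
    _ = _ := by ring

/-- The mollified zeta function is rarely far from one at a node. -/
theorem volume_mollified_le {x W : ℝ} (hx1 : x ≤ 15 / 2) (hxW : W ≤ x * Real.log T) (hx0 : 0 ≤ x) :
    volume {t : ℝ | t ∈ Icc T (T + D) ∧
        (1 / 4) ≤ ‖mollified n N ((1 / 2 + x : ℝ) + t * I)‖ ^ (1 / n : ℝ)} ≤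
      ENNReal.ofReal (D * Real.exp (200 + Real.log (Real.log T) / n ^ 2 - W / (2 * n))) := by
  have hn := h.one_le_n_real
  have hD := h.D_pos
  have key := volume_point_large_le (F := mollified n N) (p := 1 / n) (T := T) (D := D)
    (a := 1 / 2) (b := 8) (σ := 1 / 2 + x) (v := 1 / 4) (stripGrowth_mollified (by norm_num))
    (by positivity) hD (by linarith) (by linarith) (by norm_num) (h.mollified_le hx0 hx1)
  refine key.trans (ENNReal.ofReal_le_ofReal ?_)
  rw [momentSize_mul_exp]
  have h4 : (4:ℝ) ≤ Real.exp 4 := by linarith [Real.add_one_le_exp (4:ℝ)]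
  have hdiv : W / (2 * n) ≤ x * Real.log T / (2 * n) := by gcongr
  calc _ = 4 * Real.exp 4 * (D * Real.exp (152 + (Real.log (Real.log T) / n ^ 2 +
        -(x * Real.log T / (2 * n))))) := by ring
    _ ≤ Real.exp 4 * Real.exp 4 * (D * Real.exp (152 + (Real.log (Real.log T) / n ^ 2 +
        -(x * Real.log T / (2 * n))))) := by gcongr
    _ = D * Real.exp (4 + 4 + (152 + (Real.log (Real.log T) / n ^ 2 +
        -(x * Real.log T / (2 * n))))) := by simp only [Real.exp_add]; ring
    _ ≤ _ := by
        gcongr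
        linarith

/-- The mollifier is rarely large. -/
theorem volume_mollifier_le {x W : ℝ} (hx0 : 0 ≤ x) :
    volume {t : ℝ | t ∈ Icc T (T + D) ∧
        Real.exp (2 * W / n) ≤
          ‖zetaPowPoly (-(1 / n)) N ((1 / 2 + x : ℝ) + t * I)‖ ^ (2 : ℝ)} ≤
      ENNReal.ofReal (D * Real.exp (200 + Real.log (Real.log T) / n ^ 2 - 2 * W / n)) := by
  have hn := h.one_le_n_real
  have hD := h.D_pos
  have key := volume_point_large_le (F := zetaPowPoly (-(1 / n)) N) (p := 2) (T := T) (D := D)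
    (a := 1 / 2) (b := 1 / 2 + x) (σ := 1 / 2 + x) (v := Real.exp (2 * W / n))
    (stripGrowth_zetaPowPoly _ _ _ _)
    (by positivity) hD (by linarith) (by linarith) (Real.exp_pos _)
    (h.zetaPowPoly_le (by rw [abs_neg, abs_of_nonneg (by positivity)]) (by linarith))
  refine key.trans (ENNReal.ofReal_le_ofReal ?_)
  have hY := h.momentSize_pos
  have h4 : (1080:ℝ) ≤ Real.exp 8 := by
    have h2 : (2.7 : ℝ) ^ 8 ≤ Real.exp 1 ^ 8 := by
      gcongr
      linarith [Real.exp_one_gt_d9]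
    rw [← Real.exp_nat_mul] at h2
    norm_num at h2 ⊢
    linarith
  calc _ ≤ Real.exp 4 * (Real.exp 8 * momentSize T D n) / Real.exp (2 * W / n) := by gcongr
    _ = Real.exp 4 * (Real.exp 8 * momentSize T D n * Real.exp (-(2 * W / n))) := by
        rw [Real.exp_neg]; ring
    _ = D * Real.exp (4 + (8 + (Real.log (Real.log T) / n ^ 2 + -(2 * W / n)))) := by
        rw [momentSize_mul_exp, Real.exp_add 4]; ring
    _ ≤ _ := by
        gcongr
        linarith

/-- The geometric loss in passing from mean values to suprema over a tall box. -/
theorem box_factor_le {x : ℝ} (hx1 : x ≤ 1) (hx : 1 ≤ x * Real.log T) :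
    Real.exp 4 * (2 * (Real.log T + x / 2) * (2 - (1 / 2 + x / 2) + 2 * (x / 2))) /
      (π * (x / 2) ^ 2) ≤ Real.exp (12 + 3 * Real.log (Real.log T)) := by
  have hlog := h.log_ge
  have hx0 : 0 < x := by
    by_contra hcon
    push Not at hcon
    nlinarith
  rw [div_le_iff₀ (by positivity)]
  set l := Real.log T with hl
  have e : Real.exp (12 + 3 * Real.log l) = Real.exp 4 * Real.exp 8 * l ^ 3 := by
    rw [← Real.exp_add, Real.exp_add, show (3:ℝ) * Real.log l = (3:ℕ) * Real.log l by norm_num,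
      Real.exp_nat_mul, Real.exp_log (by linarith)]
    norm_num
  rw [e]
  have h8 : (9:ℝ) ≤ Real.exp 8 := by linarith [Real.add_one_le_exp (8:ℝ)]
  have h1 : 2 * (l + x / 2) * (2 - (1 / 2 + x / 2) + 2 * (x / 2)) ≤ 6 * l := by
    nlinarith
  have h2 : 1 ≤ (x * l) ^ 2 := one_le_pow₀ hx
  have h3 : 6 * l ≤ 9 * l ^ 3 * (3 * (x / 2) ^ 2) := by nlinarith
  calc _ ≤ Real.exp 4 * (6 * l) := by gcongr
    _ ≤ Real.exp 4 * (9 * l ^ 3 * (3 * (x / 2) ^ 2)) := by gcongr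
    _ ≤ Real.exp 4 * (Real.exp 8 * l ^ 3 * (π * (x / 2) ^ 2)) := by
        gcongr
        exact Real.pi_gt_three.le
    _ = _ := by ring

/-- Very large values of zeta in a tall box to the right of the critical line are rare. -/
theorem volume_zetaStar_tall_box_le {x U : ℝ} (hx1 : x ≤ 1) (hx : 1 ≤ x * Real.log T)
    (hTD : Real.log T + 1 ≤ D) :
    volume {t : ℝ | t ∈ Icc T (T + D) ∧ ∃ s : ℂ, 1 / 2 + x / 2 ≤ s.re ∧ s.re ≤ 2 ∧
        |s.im - t| ≤ Real.log T ∧ Real.exp (2 * U / n) ≤ ‖zetaStar s‖ ^ (2 / n : ℝ)} ≤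
      ENNReal.ofReal (D * Real.exp (200 + 3 * Real.log (Real.log T) +
        Real.log (Real.log T) / n ^ 2 - 2 * U / n)) := by
  have hn := h.one_le_n_real
  have hD := h.D_pos
  have hlog := h.log_ge
  have hx0 : 0 < x := by
    by_contra hcon
    push Not at hcon
    nlinarith
  have key := volume_box_large_le (F := zetaStar) (p := 2 / n) (T := T) (D := D) (r := x / 2)
    (h := Real.log T) (v := Real.exp (2 * U / n)) (a := 1 / 2 + x / 2) (b := 2)
    (M := Real.exp 149 * momentSize T D n)
    (by linarith) (by linarith) (by linarith) (by linarith) measurable_zetaStar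
    (stripGrowth_zetaStar (by linarith)) (by positivity) hD (Real.exp_pos _)
    (fun σ hσ => h.zetaStar_right_le (by linarith [hσ.1]) (by linarith [hσ.2]))
  refine key.trans (ENNReal.ofReal_le_ofReal ?_)
  have hY := h.momentSize_pos
  have e : ∀ a b c v m : ℝ, a * (b * m) / (c * v) = a * b / c * (m * v⁻¹) := by
    intro a b c v m; rw [div_eq_mul_inv, mul_inv, div_eq_mul_inv]; ring
  rw [e]
  calc _ ≤ Real.exp (12 + 3 * Real.log (Real.log T)) *
        (Real.exp 149 * momentSize T D n * (Real.exp (2 * U / n))⁻¹) := by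
        gcongr
        exact h.box_factor_le hx1 hx
    _ = D * Real.exp (12 + 3 * Real.log (Real.log T) +
        (149 + (Real.log (Real.log T) / n ^ 2 + -(2 * U / n)))) := by
        rw [← Real.exp_neg, momentSize_mul_exp, Real.exp_add (12 + _)]; ring
    _ ≤ _ := by
        gcongr
        linarith

end WindowParams

theorem stripGrowth_primeSum (Y : ℕ) {e : ℝ} (he : 0 ≤ e) (a b : ℝ) :
    StripGrowth (fun s => primeSum Y (e * s)) a b := by
  have h := stripGrowth_dirPoly (fun m => (primePowCoeff Y 1 m : ℂ)) (Y ^ 1) he a b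
  simp only [← primeSum_pow] at h
  simpa only [pow_one] using h

theorem sum_prime_rpow_le_of_one_le {Y : ℕ} {τ : ℝ} (hτ : 1 ≤ τ) :
    ∑ p ∈ primesUpTo Y, (p : ℝ) ^ (-τ) ≤ ∑ p ∈ primesUpTo Y, (p : ℝ) ^ (-1 : ℝ) := by
  refine Finset.sum_le_sum fun p hp => ?_
  have h1 : (1:ℝ) ≤ p := by exact_mod_cast (mem_primesUpTo.1 hp).1.one_lt.le
  gcongr

theorem gaussMean_primeSum_le_exp {Y j : ℕ} {T D e σ Q v : ℝ} (hD0 : 0 < D)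
    (hD : 2 * (Y : ℝ) ^ j ≤ D) (he : 1 ≤ e) (hσ : 1 / 2 ≤ σ)
    (hQ : ∑ p ∈ primesUpTo Y, (p : ℝ) ^ (-1 : ℝ) ≤ Q) (hv : Real.exp 1 * j * Q ≤ v ^ 2) :
    gaussMean (fun s => primeSum Y (e * s)) (2 * j) T D σ ≤
      8 * D * (Real.exp (-j) * (v ^ 2) ^ j) := by
  refine (gaussMean_primeSum_le hD0 hD he σ).trans ?_
  have hs : ∑ p ∈ primesUpTo Y, (p : ℝ) ^ (-(2 * e * σ)) ≤ Q :=
    (sum_prime_rpow_le_of_one_le (by nlinarith)).trans hQ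
  have hs0 : 0 ≤ ∑ p ∈ primesUpTo Y, (p : ℝ) ^ (-(2 * e * σ)) :=
    Finset.sum_nonneg fun p _ => by positivity
  have hfac : (j.factorial : ℝ) ≤ (j : ℝ) ^ j := by exact_mod_cast Nat.factorial_le_pow j
  have hexp : Real.exp (-(j:ℝ)) = Real.exp (-1) ^ j := by
    rw [← Real.exp_nat_mul]; congr 1; ring
  have hle : (j : ℝ) * Q ≤ Real.exp (-1) * v ^ 2 := by
    calc (j : ℝ) * Q = Real.exp (-1) * (Real.exp 1 * j * Q) := by
          rw [Real.exp_neg]; field_simp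
      _ ≤ _ := by gcongr
  have hQ0 : 0 ≤ Q := hs0.trans hs
  refine mul_le_mul_of_nonneg_left ?_ (by positivity)
  calc _ ≤ (j : ℝ) ^ j * Q ^ j := by gcongr
    _ = (j * Q) ^ j := (mul_pow _ _ _).symm
    _ ≤ (Real.exp (-1) * v ^ 2) ^ j := by gcongr
    _ = _ := by rw [mul_pow, hexp]

theorem rpow_two_mul_natCast (v : ℝ) (hv : 0 ≤ v) (j : ℕ) : v ^ (2 * j : ℝ) = (v ^ 2) ^ j := by
  rw [Real.rpow_mul hv, Real.rpow_natCast]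
  norm_num

theorem volume_primeSum_le {Y j : ℕ} {T D e σ Q v : ℝ} (hD0 : 0 < D) (hj : 1 ≤ j)
    (hD : 2 * (Y : ℝ) ^ j ≤ D) (he : 1 ≤ e) (hσ : 1 / 2 ≤ σ)
    (hQ : ∑ p ∈ primesUpTo Y, (p : ℝ) ^ (-1 : ℝ) ≤ Q) (hv0 : 0 < v)
    (hv : Real.exp 1 * j * Q ≤ v ^ 2) :
    volume {t : ℝ | t ∈ Icc T (T + D) ∧ v ≤ ‖primeSum Y (e * (σ + t * I))‖} ≤
      ENNReal.ofReal (D * Real.exp (200 - j)) := by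
  have hj0 : (0:ℝ) < j := by exact_mod_cast hj
  have key := volume_point_large_le (F := fun s => primeSum Y (e * s)) (p := 2 * j) (T := T)
    (stripGrowth_primeSum Y (by linarith) σ σ) (by positivity) hD0 le_rfl le_rfl
    (v := v ^ (2 * j : ℝ)) (by positivity) (gaussMean_primeSum_le_exp hD0 hD he hσ hQ hv)
  refine (measure_mono ?_).trans (key.trans (ENNReal.ofReal_le_ofReal ?_))
  · rintro t ⟨h1, h2⟩
    exact ⟨h1, by gcongr⟩
  · rw [rpow_two_mul_natCast v hv0.le, div_le_iff₀ (by positivity)]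
    have h8 : (8:ℝ) ≤ Real.exp 196 := by linarith [Real.add_one_le_exp (196:ℝ)]
    calc _ = Real.exp 4 * 8 * (D * Real.exp (-j) * (v ^ 2) ^ j) := by ring
      _ ≤ Real.exp 4 * Real.exp 196 * (D * Real.exp (-j) * (v ^ 2) ^ j) := by gcongr
      _ = _ := by
        rw [← Real.exp_add, sub_eq_add_neg, Real.exp_add 200]; norm_num; ring

namespace WindowParams
variable {T D : ℝ} {n N : ℕ} (h : WindowParams T D n N)
include h

/-- Large values of a prime sum in a tall box to the right of the critical line are rare. -/
theorem volume_primeSum_tall_box_le {x Q v : ℝ} {Y j : ℕ} (hx1 : x ≤ 1)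
    (hx : 1 ≤ x * Real.log T) (hTD : Real.log T + 1 ≤ D) (hj : 1 ≤ j)
    (hD : 2 * (Y : ℝ) ^ j ≤ D)
    (hQ : ∑ p ∈ primesUpTo Y, (p : ℝ) ^ (-1 : ℝ) ≤ Q) (hv0 : 0 < v)
    (hv : Real.exp 1 * j * Q ≤ v ^ 2) :
    volume {t : ℝ | t ∈ Icc T (T + D) ∧ ∃ s : ℂ, 1 / 2 + x / 2 ≤ s.re ∧ s.re ≤ 2 ∧
        |s.im - t| ≤ Real.log T ∧ v ≤ ‖primeSum Y s‖} ≤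
      ENNReal.ofReal (D * Real.exp (200 + 3 * Real.log (Real.log T) - j)) := by
  have hD0 := h.D_pos
  have hlog := h.log_ge
  have hx0 : 0 < x := by
    by_contra hcon
    push Not at hcon
    nlinarith
  have hj0 : (0:ℝ) < j := by exact_mod_cast hj
  have key := volume_box_large_le (F := fun s => primeSum Y ((1:ℝ) * s)) (p := 2 * j) (T := T)
    (D := D) (r := x / 2) (h := Real.log T) (v := v ^ (2 * j : ℝ)) (a := 1 / 2 + x / 2) (b := 2)
    (by linarith) (by linarith) (by linarith) (by linarith)
    (Continuous.measurable (continuous_iff_continuousAt.2 fun s =>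
      (((differentiableAt_primeSum Y _).comp s
        (differentiableAt_id.const_mul ((1:ℝ):ℂ))).continuousAt)))
    (stripGrowth_primeSum Y zero_le_one _ _) (by positivity) hD0 (by positivity)
    (fun σ hσ => gaussMean_primeSum_le_exp hD0 hD le_rfl (by linarith [hσ.1]) hQ hv)
  refine (measure_mono ?_).trans (key.trans (ENNReal.ofReal_le_ofReal ?_))
  · rintro t ⟨h1, s, h2, h3, h4, h5⟩
    refine ⟨h1, s, h2, h3, h4, ?_⟩
    simp only [Complex.ofReal_one, one_mul]
    gcongr
  · have e : ∀ a b c v m : ℝ, a * (b * m) / (c * v) = a * b / c * (m / v) := by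
      intro a b c v m; field_simp
    rw [e]
    have h8 : (8:ℝ) ≤ Real.exp 188 := by linarith [Real.add_one_le_exp (188:ℝ)]
    have h9 : 8 * D * (Real.exp (-j) * (v ^ 2) ^ j) / v ^ (2 * j : ℝ) ≤
        Real.exp 188 * (D * Real.exp (-j)) := by
      rw [rpow_two_mul_natCast v hv0.le, div_le_iff₀ (by positivity)]
      calc _ = 8 * (D * Real.exp (-j) * (v ^ 2) ^ j) := by ring
        _ ≤ Real.exp 188 * (D * Real.exp (-j) * (v ^ 2) ^ j) := by gcongr
        _ = _ := by ring
    calc _ ≤ Real.exp (12 + 3 * Real.log (Real.log T)) *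
          (Real.exp 188 * (D * Real.exp (-j))) := by
          gcongr
          exact h.box_factor_le hx1 hx
      _ = _ := by
        rw [show 200 + 3 * Real.log (Real.log T) - (j:ℝ) =
          (12 + 3 * Real.log (Real.log T)) + (188 + -j) by ring, Real.exp_add (12 + _),
          Real.exp_add 188]
        ring

end WindowParams

/-- Compatibility conditions between all the parameters used to bound the argument of zeta on a
window `[T, T + D]`: box size `x₀`, number `J + 1` of nodes, length `Y` of the Euler product,
moments `j₁ ≤ j₂` of prime sums, thresholds `W, U, R` for large values, a bound `Q` for the sum of
reciprocals of primes up to `Y`, and the saving `E`. -/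
structure ArgParams (T D : ℝ) (n N J j₁ j₂ Y : ℕ) (x₀ W U Q R C E : ℝ) : Prop
    extends WindowParams T D n N where
  two_le_W : 2 ≤ W
  x₀_mul_log : x₀ * Real.log T = W
  node_le : nodeDist x₀ J + 5 * x₀ ≤ 1 / 2
  one_le_j₁ : 1 ≤ j₁
  j₁_le_j₂ : j₁ ≤ j₂
  pow_le : 2 * (Y : ℝ) ^ j₂ ≤ D
  exp_le_Y : Real.exp 14 ≤ Y
  sum_le : ∑ p ∈ primesUpTo Y, (p : ℝ) ^ (-1 : ℝ) ≤ Q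
  R_pos : 0 < R
  R_sq : Real.exp 1 * j₁ * Q ≤ R ^ 2
  U_sq : Real.exp 1 * j₂ * Q ≤ U ^ 2
  U_ge : Q / 2 + C + 2 ≤ U
  gap : 4 * U + 6 ≤ nodeDist x₀ J * Real.log Y / 16
  tall : 4 * U + Real.log Y + 60 ≤ Real.log T ^ 2
  log_le_D : Real.log T + 1 ≤ D
  C_nonneg : 0 ≤ C
  eulerLog_le : ∀ s : ℂ, 1 / 2 ≤ s.re →
    ‖eulerLog Y s - (primeSum Y s + primeSum Y (2 * s) / 2)‖ ≤ C
  saving_W : J + Real.log (Real.log T) / n ^ 2 - W / (2 * n) ≤ -E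
  saving_U : 3 * Real.log (Real.log T) + Real.log (Real.log T) / n ^ 2 - 2 * U / n ≤ -E
  saving_j₂ : 3 * Real.log (Real.log T) - j₂ ≤ -E
  saving_j₁ : E ≤ j₁

theorem lt_exp_of_rpow_lt {y a : ℝ} {n : ℕ} (hn : 1 ≤ n) (hy : 0 ≤ y)
    (h : y ^ (2 / n : ℝ) < Real.exp (2 * a / n)) : y < Real.exp a := by
  have hn' : (0:ℝ) < n := by exact_mod_cast hn
  by_contra! hc
  refine absurd h (not_lt.2 ?_)
  calc Real.exp (2 * a / n) = Real.exp a ^ (2 / n : ℝ) := by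
        rw [← Real.exp_mul]; congr 1; ring
    _ ≤ _ := by gcongr

/-- A lower bound for zeta at a point where the mollified zeta function is close to `1` and the
mollifier is not too large. -/
theorem exp_le_norm_riemannZeta_of_mollified {n N : ℕ} {s : ℂ} {W : ℝ} (hn : 1 ≤ n) (hW : 2 ≤ W)
    (hs : 0 ≤ s.re) (ht : 4 ≤ |s.im|) (h1 : ‖mollified n N s‖ ^ (1 / n : ℝ) < 1 / 4)
    (h2 : ‖zetaPowPoly (-(1 / n)) N s‖ ^ (2 : ℝ) < Real.exp (2 * W / n)) :
    Real.exp (-(2 * W)) ≤ ‖riemannZeta s‖ := by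
  have hn' : (1:ℝ) ≤ n := by exact_mod_cast hn
  have h3 : ‖mollified n N s‖ < 1 / 4 := by
    by_contra! hc
    refine absurd h1 (not_lt.2 ?_)
    calc (1 / 4 : ℝ) = (1 / 4 : ℝ) ^ (1 : ℝ) := (Real.rpow_one _).symm
      _ ≤ (1 / 4 : ℝ) ^ (1 / n : ℝ) := by
        apply Real.rpow_le_rpow_of_exponent_ge (by norm_num) (by norm_num)
        rw [div_le_iff₀ (by linarith)]; linarith
      _ ≤ _ := by gcongr
  set M := zetaPowPoly (-(1 / n)) N s with hM
  have h4 : ‖M‖ < Real.exp (W / n) := by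
    have := lt_exp_of_rpow_lt (n := 1) (a := W / n) le_rfl (norm_nonneg M)
      (by norm_num; norm_num at h2; rwa [← mul_div_assoc])
    exact this
  have h5 : ‖M‖ ^ n ≤ Real.exp W := by
    calc ‖M‖ ^ n ≤ Real.exp (W / n) ^ n := by gcongr
      _ = Real.exp W := by rw [← Real.exp_nat_mul]; congr 1; field_simp
  have h6 : 1 / 4 ≤ ‖zetaStar s‖ * Real.exp W := by
    have e : poleFactor s = zetaStar s * M ^ n - mollified n N s := by
      rw [mollified, ← hM]; ring
    have h7 := half_le_norm_poleFactor hs ht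
    rw [e] at h7
    have h8 := norm_sub_le (zetaStar s * M ^ n) (mollified n N s)
    rw [norm_mul, norm_pow] at h8
    have h9 : ‖zetaStar s‖ * ‖M‖ ^ n ≤ ‖zetaStar s‖ * Real.exp W := by gcongr
    linarith
  have h0 : s.im ≠ 0 := by intro h; rw [h] at ht; norm_num at ht
  refine le_trans ?_ (norm_zetaStar_le_norm_riemannZeta hs h0)
  have h10 : 4 ≤ Real.exp W := by
    have : Real.exp (1 + 1) ≤ Real.exp W := by gcongr; linarith
    rw [Real.exp_add] at this
    nlinarith [Real.exp_one_gt_d9]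
  have h11 : Real.exp (-(2 * W)) * (Real.exp W * Real.exp W) = 1 := by
    rw [← Real.exp_add, ← Real.exp_add]; ring_nf; exact Real.exp_zero
  have h12 := Real.exp_pos (-(2 * W))
  by_contra! hc
  have : ‖zetaStar s‖ * Real.exp W < Real.exp (-(2 * W)) * Real.exp W := by gcongr
  nlinarith

namespace ArgParams
variable {T D : ℝ} {n N J j₁ j₂ Y : ℕ} {x₀ W U Q R C E : ℝ}
  (h : ArgParams T D n N J j₁ j₂ Y x₀ W U Q R C E)
include h

theorem x₀_pos : 0 < x₀ := by
  have h1 := h.two_le_W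
  have h2 := h.log_ge
  by_contra! hc
  nlinarith [h.x₀_mul_log]

theorem le_nodeDist (j : ℕ) : x₀ ≤ nodeDist x₀ j := by
  simpa [nodeDist] using nodeDist_mono h.x₀_pos (Nat.zero_le j)

theorem nodeDist_le_half {j : ℕ} (hj : j ≤ J) : nodeDist x₀ j ≤ 1 / 2 := by
  linarith [nodeDist_mono h.x₀_pos hj, h.node_le, h.x₀_pos]

theorem Q_nonneg : 0 ≤ Q :=
  (Finset.sum_nonneg fun p _ => by positivity).trans h.sum_le

theorem two_le_U : 2 ≤ U := by linarith [h.U_ge, h.Q_nonneg, h.C_nonneg]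

theorem log_add_four_lt : Real.log T + 4 < T := by
  have h1 := h.log_ge
  have h2 := Real.quadratic_le_exp_of_nonneg (x := Real.log T) (by linarith)
  rw [Real.exp_log h.T_pos] at h2
  nlinarith

theorem norm_eulerLog_le {s : ℂ} (hs : 1 / 2 ≤ s.re) :
    ‖eulerLog Y s‖ ≤ ‖primeSum Y s‖ + ‖primeSum Y (2 * s)‖ / 2 + C := by
  have h1 := h.eulerLog_le s hs
  have h2 : ‖primeSum Y s + primeSum Y (2 * s) / 2‖ ≤
      ‖primeSum Y s‖ + ‖primeSum Y (2 * s)‖ / 2 := by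
    refine (norm_add_le _ _).trans ?_
    rw [norm_div]; norm_num
  have h3 := norm_sub_norm_le (eulerLog Y s) (primeSum Y s + primeSum Y (2 * s) / 2)
  linarith

theorem norm_eulerLog_le_of_two_le {s : ℂ} (hs : 2 ≤ s.re) : ‖eulerLog Y s‖ ≤ 3 + C := by
  have h1 := h.norm_eulerLog_le (s := s) (by linarith)
  have h2 := (norm_primeSum_le Y s).trans (sum_prime_rpow_le_two hs)
  have h3 := (norm_primeSum_le Y (2 * s)).trans
    (sum_prime_rpow_le_two (by simp; linarith))
  linarith

theorem norm_primeSum_two_mul_le {s : ℂ} (hs : 1 / 2 ≤ s.re) : ‖primeSum Y (2 * s)‖ ≤ Q :=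
  ((norm_primeSum_le Y _).trans
    (sum_prime_rpow_le_of_one_le (by simp; linarith))).trans h.sum_le

/-- The pointwise bound for `S` away from the exceptional events. -/
theorem abs_le_of_regular {S : ℝ → ℝ} (hS : IsS S) {t : ℝ} (ht : T ≤ t)
    (hzero : ∀ σ : ℝ, 1 / 2 ≤ σ → σ ≤ 2 → riemannZeta (σ + t * I) ≠ 0)
    (hbox : ∀ s : ℂ, 1 / 2 - 2 * x₀ ≤ s.re → s.re ≤ 1 / 2 + 2 * nodeDist x₀ J + 4 * x₀ →
      |s.im - t| ≤ nodeDist x₀ J + 3 * x₀ →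
      ‖zetaStar s‖ ^ (2 / n : ℝ) < Real.exp (20 * W / n))
    (hmoll : ∀ j ≤ J,
      ‖mollified n N ((1 / 2 + nodeDist x₀ j : ℝ) + t * I)‖ ^ (1 / n : ℝ) < 1 / 4)
    (hpoly : ∀ j ≤ J, ‖zetaPowPoly (-(1 / n)) N ((1 / 2 + nodeDist x₀ j : ℝ) + t * I)‖ ^ (2 : ℝ) <
      Real.exp (2 * W / n))
    (htall : ∀ s : ℂ, 1 / 2 + nodeDist x₀ J / 2 ≤ s.re → s.re ≤ 2 → |s.im - t| ≤ Real.log T →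
      ‖zetaStar s‖ ^ (2 / n : ℝ) < Real.exp (2 * U / n))
    (hprime : ∀ s : ℂ, 1 / 2 + nodeDist x₀ J / 2 ≤ s.re → s.re ≤ 2 → |s.im - t| ≤ Real.log T →
      ‖primeSum Y s‖ < U)
    (hone : ‖primeSum Y ((1 : ℝ) * ((1 / 2 + nodeDist x₀ J : ℝ) + t * I))‖ < R)
    (htwo : ‖primeSum Y ((2 : ℝ) * ((1 / 2 + nodeDist x₀ J : ℝ) + t * I))‖ < R) :
    |S t| ≤ 4 + R + C + (J + 1) * (13 * W + 1) := by
  have hT := h.eight_le_T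
  have hW := h.two_le_W
  have hx₀ := h.x₀_pos
  have hn := h.one_le_n
  have hxJ := h.nodeDist_le_half le_rfl
  have hxJ0 := nodeDist_pos hx₀ J
  have hnode := h.node_le
  have hU := h.two_le_U
  have hC := h.C_nonneg
  obtain ⟨θ, hθ, hθ0, h01, h12, hSt⟩ := hS.1 t (by linarith) hzero
  have two_le_exp : ∀ {a : ℝ}, 1 ≤ a → 2 ≤ Real.exp a := fun {a} ha => by
    linarith [Real.add_one_le_exp a, ha]
  have hzeta : ∀ s : ℂ, 1 / 2 + nodeDist x₀ J / 2 ≤ s.re → s.re ≤ 8 → |s.im - t| ≤ Real.log T →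
      ‖riemannZeta s‖ ≤ Real.exp (2 * U) := by
    intro s h1 _ h3
    rcases le_total 2 s.re with h4 | h4
    · exact (norm_riemannZeta_le_two h4).trans (two_le_exp (by linarith))
    · have him : 4 ≤ |s.im| := by
        refine le_trans ?_ (le_abs_self _)
        linarith [(abs_le.1 h3).1, h.log_add_four_lt]
      have h5 := norm_riemannZeta_le_zetaStar (s := s) (by linarith) him
      have h6 := lt_exp_of_rpow_lt hn (norm_nonneg _) (htall s h1 h4 h3)
      rw [two_mul U, Real.exp_add]
      nlinarith [two_le_exp (a := U) (by linarith)]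
  have heuler : ∀ s : ℂ, 1 / 2 + nodeDist x₀ J / 2 ≤ s.re → s.re ≤ 8 →
      |s.im - t| ≤ Real.log T → ‖eulerLog Y s‖ ≤ 2 * U := by
    intro s h1 _ h3
    rcases le_total 2 s.re with h4 | h4
    · linarith [h.norm_eulerLog_le_of_two_le h4, h.U_ge, h.Q_nonneg]
    · linarith [h.norm_eulerLog_le (s := s) (by linarith), hprime s h1 h4 h3,
        h.norm_primeSum_two_mul_le (s := s) (by linarith), h.U_ge]
  have hlog := h.log_ge
  have hlt := h.log_add_four_lt
  have key := abs_argument_le (q := fun σ : ℝ => eulerLog Y (σ + t * I)) (J := J)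
    (W := W) (B := (R + R / 2 + C) + (3 + C)) (by linarith) hx₀ (by linarith) (by linarith) (by linarith)
    hθ hθ0 h01 h12 ?_ ?_ ?_ ?_ ?_
  · rw [hSt, abs_div, abs_of_pos Real.pi_pos, div_le_iff₀ Real.pi_pos]
    refine key.trans ?_
    have hpi := Real.pi_gt_three
    nlinarith [h.R_pos]
  · intro s h1 h2 h3
    have him : 4 ≤ |s.im| := by
      refine le_trans ?_ (le_abs_self _)
      linarith [(abs_le.1 h3).1]
    have h5 := norm_riemannZeta_le_zetaStar (s := s) (by linarith) him
    have h6 := lt_exp_of_rpow_lt (a := 10 * W) hn (norm_nonneg _)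
      (by convert hbox s h1 h2 h3 using 2; ring)
    rw [show 11 * W = W + 10 * W by ring, Real.exp_add]
    nlinarith [two_le_exp (a := W) (by linarith), Real.exp_pos (10 * W)]
  · intro j hj
    have := nodeDist_pos hx₀ j
    refine exp_le_norm_riemannZeta_of_mollified hn hW ?_ ?_ (hmoll j hj) (hpoly j hj)
    · rw [line_re]; linarith
    · rw [line_im]; exact le_trans (by linarith) (le_abs_self _)
  · intro σ hσ
    refine ContinuousAt.continuousWithinAt ?_
    refine ContinuousAt.comp (f := fun σ : ℝ => (σ : ℂ) + t * I)
      (differentiableAt_eulerLog Y ?_).continuousAt (by fun_prop)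
    rw [line_re]; linarith [hσ.1]
  · intro σ hσ
    have h1 := norm_riemannZeta_mul_exp_eulerLog_le_half (t := t) (G := 2 * U) hxJ0 h.exp_le_Y
      (h := Real.log T) (by linarith) (by linarith) (by linarith) hzeta heuler
      (by linarith [h.gap]) (by linarith [h.tall]) hσ.1 hσ.2
    have h2 := (abs_le.1 ((Complex.abs_re_le_norm _).trans h1)).1
    rw [Complex.sub_re, Complex.one_re] at h2
    linarith
  · have h1 := h.norm_eulerLog_le (s := ((1 / 2 + nodeDist x₀ J : ℝ) : ℂ) + t * I)
      (by rw [line_re]; linarith)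
    have h2 := h.norm_eulerLog_le_of_two_le (s := ((2 : ℝ) : ℂ) + t * I) (by rw [line_re])
    rw [Complex.ofReal_one, one_mul] at hone
    rw [Complex.ofReal_ofNat] at htwo
    have h3 := Complex.abs_im_le_norm (eulerLog Y (((1 / 2 + nodeDist x₀ J : ℝ) : ℂ) + t * I))
    have h4 := Complex.abs_im_le_norm (eulerLog Y (((2 : ℝ) : ℂ) + t * I))
    linarith

end ArgParams

namespace ArgParams
variable {T D : ℝ} {n N J j₁ j₂ Y : ℕ} {x₀ W U Q R C E : ℝ}
  (h : ArgParams T D n N J j₁ j₂ Y x₀ W U Q R C E)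
include h

/-- The points of a window near which zeta takes a large value, or at which the mollification fails,
form a set of small measure. -/
theorem volume_zeta_exceptional_le :
    volume ({t : ℝ | t ∈ Icc T (T + D) ∧ ∃ s : ℂ, 1 / 2 - 2 * x₀ ≤ s.re ∧
        s.re ≤ 1 / 2 + 2 * nodeDist x₀ J + 4 * x₀ ∧ |s.im - t| ≤ nodeDist x₀ J + 3 * x₀ ∧
        Real.exp (20 * W / n) ≤ ‖zetaStar s‖ ^ (2 / n : ℝ)} ∪
      (⋃ j ∈ Finset.range (J + 1), ({t : ℝ | t ∈ Icc T (T + D) ∧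
          1 / 4 ≤ ‖mollified n N ((1 / 2 + nodeDist x₀ j : ℝ) + t * I)‖ ^ (1 / n : ℝ)} ∪
        {t : ℝ | t ∈ Icc T (T + D) ∧ Real.exp (2 * W / n) ≤
          ‖zetaPowPoly (-(1 / n)) N ((1 / 2 + nodeDist x₀ j : ℝ) + t * I)‖ ^ (2 : ℝ)}))) ≤
      ENNReal.ofReal (3 * (D * Real.exp (200 - E))) := by
  have hx₀ := h.x₀_pos
  have hW := h.two_le_W
  have hn := h.one_le_n_real
  have hD := h.D_pos
  have hsave := h.saving_W
  have hpoint : ∀ j ∈ Finset.range (J + 1), volume ({t : ℝ | t ∈ Icc T (T + D) ∧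
          1 / 4 ≤ ‖mollified n N ((1 / 2 + nodeDist x₀ j : ℝ) + t * I)‖ ^ (1 / n : ℝ)} ∪
        {t : ℝ | t ∈ Icc T (T + D) ∧ Real.exp (2 * W / n) ≤
          ‖zetaPowPoly (-(1 / n)) N ((1 / 2 + nodeDist x₀ j : ℝ) + t * I)‖ ^ (2 : ℝ)}) ≤
      ENNReal.ofReal (2 * (D * Real.exp (200 - E - J))) := by
    intro j hj
    have hjJ : j ≤ J := by rw [Finset.mem_range] at hj; omega
    have hpos := (nodeDist_pos hx₀ j).le
    refine (measure_union_le _ _).trans ?_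
    rw [two_mul (D * _), ENNReal.ofReal_add (by positivity) (by positivity)]
    refine add_le_add ((h.volume_mollified_le (W := W) (by linarith [h.nodeDist_le_half hjJ]) ?_
      hpos).trans (ENNReal.ofReal_le_ofReal ?_)) ((h.volume_mollifier_le hpos).trans
        (ENNReal.ofReal_le_ofReal ?_))
    · rw [← h.x₀_mul_log]
      have := h.log_ge
      gcongr
      exact h.le_nodeDist j
    · refine mul_le_mul_of_nonneg_left (Real.exp_le_exp.2 ?_) hD.le
      linarith
    · refine mul_le_mul_of_nonneg_left (Real.exp_le_exp.2 ?_) hD.le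
      have : W / (2 * n) ≤ 2 * W / n := by
        rw [div_le_div_iff₀ (by positivity) (by positivity)]; nlinarith
      linarith
  refine (measure_union_le _ _).trans ?_
  rw [show 3 * (D * Real.exp (200 - E)) = D * Real.exp (200 - E) + 2 * (D * Real.exp (200 - E)) by
    ring, ENNReal.ofReal_add (by positivity) (by positivity)]
  refine add_le_add ((h.volume_zetaStar_box_le hx₀ h.x₀_mul_log h.node_le).trans
    (ENNReal.ofReal_le_ofReal ?_)) ((measure_biUnion_finset_le _ _).trans
      ((Finset.sum_le_sum hpoint).trans ?_))
  · refine mul_le_mul_of_nonneg_left (Real.exp_le_exp.2 ?_) hD.le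
    have : W / (2 * n) ≤ 8 * W / n := by
      rw [div_le_div_iff₀ (by positivity) (by positivity)]; nlinarith
    linarith
  · rw [Finset.sum_const, Finset.card_range, nsmul_eq_mul, ← ENNReal.ofReal_natCast,
      ← ENNReal.ofReal_mul (by positivity)]
    apply ENNReal.ofReal_le_ofReal
    have h1 := Real.add_one_le_exp (J : ℝ)
    calc _ ≤ Real.exp J * (2 * (D * Real.exp (200 - E - J))) := by
          gcongr; push_cast; exact h1
      _ = 2 * (D * (Real.exp J * Real.exp (200 - E - J))) := by ring
      _ = _ := by rw [← Real.exp_add]; ring_nf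

/-- The points of a window near which zeta or a prime sum takes a very large value form a set of
small measure. -/
theorem volume_prime_exceptional_le :
    volume ({t : ℝ | t ∈ Icc T (T + D) ∧ ∃ s : ℂ, 1 / 2 + nodeDist x₀ J / 2 ≤ s.re ∧ s.re ≤ 2 ∧
        |s.im - t| ≤ Real.log T ∧ Real.exp (2 * U / n) ≤ ‖zetaStar s‖ ^ (2 / n : ℝ)} ∪
      {t : ℝ | t ∈ Icc T (T + D) ∧ ∃ s : ℂ, 1 / 2 + nodeDist x₀ J / 2 ≤ s.re ∧ s.re ≤ 2 ∧
        |s.im - t| ≤ Real.log T ∧ U ≤ ‖primeSum Y s‖} ∪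
      {t : ℝ | t ∈ Icc T (T + D) ∧
        R ≤ ‖primeSum Y ((1 : ℝ) * ((1 / 2 + nodeDist x₀ J : ℝ) + t * I))‖} ∪
      {t : ℝ | t ∈ Icc T (T + D) ∧
        R ≤ ‖primeSum Y ((2 : ℝ) * ((1 / 2 + nodeDist x₀ J : ℝ) + t * I))‖}) ≤
      ENNReal.ofReal (4 * (D * Real.exp (200 - E))) := by
  have hD := h.D_pos
  have hx := h.nodeDist_le_half le_rfl
  have hpos := nodeDist_pos h.x₀_pos J
  have hlog := h.log_ge
  have hx1 : 1 ≤ nodeDist x₀ J * Real.log T := by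
    have : x₀ * Real.log T ≤ nodeDist x₀ J * Real.log T := by
      gcongr
      exact h.le_nodeDist J
    rw [h.x₀_mul_log] at this
    linarith [h.two_le_W]
  have hj₂ : 1 ≤ j₂ := h.one_le_j₁.trans h.j₁_le_j₂
  have hY : (1 : ℝ) ≤ Y := (Real.one_le_exp (by norm_num)).trans h.exp_le_Y
  have hYj : 2 * (Y : ℝ) ^ j₁ ≤ D := by
    refine le_trans ?_ h.pow_le
    gcongr
    exact h.j₁_le_j₂
  have hj₁ := h.saving_j₁
  have hU := h.two_le_U
  have hsplit : ENNReal.ofReal (4 * (D * Real.exp (200 - E))) =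
      ENNReal.ofReal (D * Real.exp (200 - E)) + ENNReal.ofReal (D * Real.exp (200 - E)) +
      ENNReal.ofReal (D * Real.exp (200 - E)) + ENNReal.ofReal (D * Real.exp (200 - E)) := by
    rw [← ENNReal.ofReal_add (by positivity) (by positivity),
      ← ENNReal.ofReal_add (by positivity) (by positivity),
      ← ENNReal.ofReal_add (by positivity) (by positivity)]
    congr 1; ring
  rw [hsplit]
  refine (measure_union_le _ _).trans (add_le_add ((measure_union_le _ _).trans
    (add_le_add ((measure_union_le _ _).trans (add_le_add ?_ ?_)) ?_)) ?_)
  · refine (h.volume_zetaStar_tall_box_le (by linarith) hx1 h.log_le_D).trans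
      (ENNReal.ofReal_le_ofReal ?_)
    refine mul_le_mul_of_nonneg_left (Real.exp_le_exp.2 ?_) hD.le
    linarith [h.saving_U]
  · refine (h.volume_primeSum_tall_box_le (by linarith) hx1 h.log_le_D hj₂ h.pow_le h.sum_le
      (by linarith) h.U_sq).trans (ENNReal.ofReal_le_ofReal ?_)
    refine mul_le_mul_of_nonneg_left (Real.exp_le_exp.2 ?_) hD.le
    linarith [h.saving_j₂]
  · refine (volume_primeSum_le hD h.one_le_j₁ hYj le_rfl (by linarith) h.sum_le h.R_pos
      h.R_sq).trans (ENNReal.ofReal_le_ofReal ?_)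
    gcongr
  · refine (volume_primeSum_le hD h.one_le_j₁ hYj one_le_two (by linarith) h.sum_le h.R_pos
      h.R_sq).trans (ENNReal.ofReal_le_ofReal ?_)
    gcongr

/-- The main estimate on a single window. -/
theorem volume_large_le {S : ℝ → ℝ} (hS : IsS S) :
    volume {t : ℝ | t ∈ Icc T (T + D) ∧ 4 + R + C + (J + 1) * (13 * W + 1) < |S t|} ≤
      ENNReal.ofReal (D * Real.exp (202 - E)) := by
  have hD := h.D_pos
  have hnull : volume (Complex.im '' riemannZetaZeros) = 0 :=
    (countable_riemannZetaZeros.image _).measure_zero _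
  have h7 : 3 * (D * Real.exp (200 - E)) + 4 * (D * Real.exp (200 - E)) ≤
      D * Real.exp (202 - E) := by
    rw [show 202 - E = 1 + 1 + (200 - E) by ring, Real.exp_add, Real.exp_add]
    have h1 : (7:ℝ) ≤ Real.exp 1 * Real.exp 1 := by nlinarith [Real.exp_one_gt_d9]
    nlinarith [mul_pos hD (Real.exp_pos (200 - E))]
  refine le_trans ?_ (ENNReal.ofReal_le_ofReal h7)
  rw [ENNReal.ofReal_add (by positivity) (by positivity)]
  refine le_trans ?_ (add_le_add h.volume_zeta_exceptional_le h.volume_prime_exceptional_le)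
  refine le_trans ?_ (measure_union_le _ _)
  rw [← zero_add (volume (_ ∪ _)), ← hnull]
  refine le_trans (measure_mono ?_) (measure_union_le _ _)
  rintro t ⟨ht, hlarge⟩
  by_contra hcon
  simp only [mem_union, mem_iUnion, not_or, mem_setOf_eq, not_and, not_exists, not_le, ht,
    true_imp_iff, Finset.mem_range] at hcon
  obtain ⟨hzero, ⟨hbox, hnode⟩, ⟨⟨htall, hprime⟩, hone⟩, htwo⟩ := hcon
  refine absurd hlarge (not_lt.2 (h.abs_le_of_regular hS ht.1 ?_ hbox
    (fun j hj => (hnode j (by omega)).1) (fun j hj => (hnode j (by omega)).2) htall hprime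
    hone htwo))
  intro σ _ _ hζ
  exact hzero ⟨_, hζ, line_im σ t⟩

end ArgParams

theorem eventually_mul_rpow_le {a b : ℝ} (hab : a < b) (c : ℝ) :
    ∀ᶠ x : ℝ in atTop, c * x ^ a ≤ x ^ b := by
  filter_upwards [(tendsto_rpow_atTop (sub_pos.2 hab)).eventually_ge_atTop c,
    eventually_gt_atTop 0] with x h1 h2
  calc c * x ^ a ≤ x ^ (b - a) * x ^ a := by gcongr
    _ = x ^ b := by rw [← Real.rpow_add h2]; ring_nf

theorem eventually_mul_rpow_le_exp (a c : ℝ) {b : ℝ} (hb : 0 < b) :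
    ∀ᶠ x : ℝ in atTop, c * x ^ a ≤ Real.exp (b * x) := by
  filter_upwards [(isLittleO_rpow_exp_pos_mul_atTop a hb).bound (inv_pos.2 (by positivity :
    (0:ℝ) < |c| + 1)), eventually_gt_atTop 0] with x h1 h2
  rw [Real.norm_of_nonneg (by positivity), Real.norm_of_nonneg (Real.exp_pos _).le,
    ← div_eq_inv_mul, le_div_iff₀ (by positivity)] at h1
  have h3 : 0 ≤ x ^ a := by positivity
  nlinarith [le_abs_self c]

theorem eventually_mul_rpow_le_pow_floor (a c : ℝ) {κ : ℝ} (hκ : 0 < κ) :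
    ∀ᶠ x : ℝ in atTop, c * x ^ a ≤ (3 / 2 : ℝ) ^ ⌊x ^ κ⌋₊ := by
  have hlog : 0 < Real.log (3 / 2) := Real.log_pos (by norm_num)
  filter_upwards [(tendsto_rpow_atTop hκ).eventually
    (eventually_mul_rpow_le_exp (a / κ) (3 / 2 * c) hlog), eventually_gt_atTop 0] with x h1 h2
  rw [← Real.rpow_mul h2.le, mul_div_cancel₀ _ hκ.ne'] at h1
  have h3 : Real.exp (Real.log (3 / 2) * x ^ κ) ≤ (3 / 2 : ℝ) ^ (⌊x ^ κ⌋₊ + 1) := by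
    rw [← Real.rpow_natCast, Real.rpow_def_of_pos (by norm_num : (0:ℝ) < 3 / 2)]
    gcongr
    push_cast
    exact (Nat.lt_floor_add_one _).le
  rw [pow_succ] at h3
  linarith

theorem eventually_windowParams : ∀ᶠ T : ℝ in atTop, ∀ n : ℕ, 1 ≤ n → 480 * (n:ℝ) ≤ Real.log T →
    WindowParams T (T ^ (7 / 8 : ℝ)) n ⌊T ^ (3 / 4 : ℝ)⌋₊ := by
  have htail : ∀ᶠ T : ℝ in atTop, (T ^ (1 / 4 : ℝ)) ^ (14 : ℝ) ≤
      Real.exp (1 / 8 * T ^ (1 / 4 : ℝ)) := by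
    have := (tendsto_rpow_atTop (by norm_num : (0:ℝ) < 1 / 4)).eventually
      (eventually_mul_rpow_le_exp 14 1 (by norm_num : (0:ℝ) < 1 / 8))
    simpa only [one_mul] using this
  have hlogT : ∀ᶠ T : ℝ in atTop, Real.log T ≤ 1 / 2 * T ^ (3 / 10 : ℝ) := by
    filter_upwards [(isLittleO_log_rpow_atTop (by norm_num : (0:ℝ) < 3 / 10)).bound
      (by norm_num : (0:ℝ) < 1 / 2), eventually_ge_atTop 1] with T h1 h2
    rwa [Real.norm_of_nonneg (Real.log_nonneg h2), Real.norm_of_nonneg (by positivity)] at h1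
  filter_upwards [htail, hlogT, eventually_ge_atTop 8,
    eventually_mul_rpow_le (by norm_num : (3 / 4 : ℝ) < 7 / 8) 2,
    eventually_mul_rpow_le (by norm_num : (0 : ℝ) < 7 / 8) 8,
    eventually_mul_rpow_le (by norm_num : (0 : ℝ) < 3 / 4) 3]
    with T h1 h2 h3 h4 h5 h6 n hn hlog
  have hT : 0 < T := by linarith
  have hN1 : (⌊T ^ (3 / 4 : ℝ)⌋₊ : ℝ) ≤ T ^ (3 / 4 : ℝ) := Nat.floor_le (by positivity)
  have hN2 : T ^ (3 / 4 : ℝ) / 2 ≤ (⌊T ^ (3 / 4 : ℝ)⌋₊ : ℝ) := by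
    have := (Nat.lt_floor_add_one (T ^ (3 / 4 : ℝ))).le
    rw [Real.rpow_zero] at h6
    linarith
  rw [Real.rpow_zero] at h5 h6
  have hn' : (1:ℝ) ≤ n := by exact_mod_cast hn
  refine ⟨hn, h3, by linarith, ?_, ?_, by linarith, ?_, ?_, by exact_mod_cast hlog⟩
  · have e1 : (T / T ^ (7 / 8 : ℝ)) ^ 2 = T ^ (1 / 4 : ℝ) := by
      rw [← Real.rpow_natCast, ← Real.rpow_one_sub' hT.le (by norm_num), ← Real.rpow_mul hT.le]
      norm_num
    have e2 : (T ^ (7 / 8 : ℝ)) ^ 4 = (T ^ (1 / 4 : ℝ)) ^ (14 : ℝ) := by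
      rw [← Real.rpow_natCast, ← Real.rpow_mul hT.le, ← Real.rpow_mul hT.le]
      norm_num
    rw [e1, e2, neg_div, Real.exp_neg, ← div_eq_mul_inv, div_le_one (Real.exp_pos _)]
    generalize T ^ (1 / 4 : ℝ) = y at h1 ⊢
    rwa [show y / 8 = 1 / 8 * y by ring]
  · apply Nat.le_floor
    push_cast
    linarith
  · refine hN1.trans ?_
    calc T ^ (3 / 4 : ℝ) ≤ T ^ (1 : ℝ) :=
          Real.rpow_le_rpow_of_exponent_le (by linarith) (by norm_num)
      _ = T := Real.rpow_one T
  · have hNpos : 0 < (⌊T ^ (3 / 4 : ℝ)⌋₊ : ℝ) := by linarith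
    rw [div_le_iff₀ (by positivity)]
    have e1 : T ^ (-(21 / 5) : ℝ) * (T ^ (3 / 4 : ℝ)) ^ 6 = T ^ (3 / 10 : ℝ) := by
      rw [← Real.rpow_natCast, ← Real.rpow_mul hT.le, ← Real.rpow_add hT]
      norm_num
    calc 8 * (n:ℝ) ≤ T ^ (3 / 10 : ℝ) / 64 := by linarith
      _ = T ^ (-(21 / 5) : ℝ) * (T ^ (3 / 4 : ℝ) / 2) ^ 6 := by rw [← e1]; ring
      _ ≤ _ := by gcongr

/-- The length `⌊T ^ (1 / (2 j))⌋` of the Euler product, written in terms of `l = log T`. -/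
def eulerLength (l : ℝ) (j : ℕ) : ℕ := ⌊Real.exp (l / (2 * j))⌋₊

theorem eulerLength_le (l : ℝ) (j : ℕ) : (eulerLength l j : ℝ) ≤ Real.exp (l / (2 * j)) :=
  Nat.floor_le (Real.exp_pos _).le

theorem exp_le_eulerLength {l : ℝ} {j : ℕ} (h : 20 ≤ l / (2 * j)) :
    Real.exp (l / (2 * j) - 1) ≤ eulerLength l j := by
  have h1 := (Nat.lt_floor_add_one (Real.exp (l / (2 * j)))).le
  have h2 : Real.exp (l / (2 * j)) = Real.exp 1 * Real.exp (l / (2 * j) - 1) := by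
    rw [← Real.exp_add]; ring_nf
  have h3 := Real.add_one_le_exp (l / (2 * j) - 1)
  have h4 := Real.exp_one_gt_d9
  unfold eulerLength
  nlinarith

theorem eulerLength_pow_le {l : ℝ} {j : ℕ} (hj : 1 ≤ j) :
    (eulerLength l j : ℝ) ^ j ≤ Real.exp (l / 2) := by
  have hj' : (0:ℝ) < j := by exact_mod_cast hj
  calc (eulerLength l j : ℝ) ^ j ≤ Real.exp (l / (2 * j)) ^ j := by
        gcongr; exact eulerLength_le l j
    _ = Real.exp (l / 2) := by rw [← Real.exp_nat_mul]; congr 1; field_simp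

theorem ceil_rpow_le_two_mul {x a : ℝ} (hx : 1 ≤ x) (ha : 0 ≤ a) :
    (⌈x ^ a⌉₊ : ℝ) ≤ 2 * x ^ a := by
  have h1 := Real.one_le_rpow hx ha
  linarith [(Nat.ceil_lt_add_one (a := x ^ a) (by linarith)).le]

theorem one_le_ceil_rpow {x a : ℝ} (hx : 0 < x) : 1 ≤ ⌈x ^ a⌉₊ :=
  Nat.one_le_iff_ne_zero.2 (Nat.ceil_pos.2 (by positivity)).ne'

theorem tendsto_log_log_atTop : Tendsto (fun T : ℝ => Real.log (Real.log T)) atTop atTop :=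
  Real.tendsto_log_atTop.comp Real.tendsto_log_atTop

theorem eventually_sum_lt_half_rpow {δ ε C : ℝ} (hδ : 0 < δ) (hε : 0 < ε) (hε1 : ε ≤ 1 / 2) :
    ∀ᶠ L : ℝ in atTop, 4 + L ^ (1 / 2 + 3 * δ / 4) + C +
      (⌊L ^ (ε / 4)⌋₊ + 1) * (13 * L ^ (1 / 2 + δ - ε / 2) + 1) < (L / 2) ^ (1 / 2 + δ) := by
  set c : ℝ := 2 ^ (1 / 2 + δ) with hc
  have hc0 : 0 < c := by positivity
  filter_upwards [eventually_ge_atTop 1,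
    eventually_mul_rpow_le (by linarith : (0:ℝ) < 1 / 2 + δ) (4 * c * (4 + C)),
    eventually_mul_rpow_le (by linarith : 1 / 2 + 3 * δ / 4 < 1 / 2 + δ) (4 * c),
    eventually_mul_rpow_le (by linarith : 1 / 2 + δ - ε / 4 < 1 / 2 + δ) (4 * c * 28)]
    with L h1 h2 h3 h4
  have h0 : 0 < L := by linarith
  rw [Real.div_rpow h0.le zero_le_two, ← hc, lt_div_iff₀ hc0]
  rw [Real.rpow_zero] at h2
  have hJ : (⌊L ^ (ε / 4)⌋₊ : ℝ) ≤ L ^ (ε / 4) := Nat.floor_le (by positivity)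
  have hJ1 : 1 ≤ L ^ (ε / 4) := Real.one_le_rpow h1 (by linarith)
  have hW1 : 1 ≤ L ^ (1 / 2 + δ - ε / 2) := Real.one_le_rpow h1 (by linarith)
  have h5 : ((⌊L ^ (ε / 4)⌋₊ : ℝ) + 1) * (13 * L ^ (1 / 2 + δ - ε / 2) + 1) ≤
      28 * L ^ (1 / 2 + δ - ε / 4) := by
    calc _ ≤ (2 * L ^ (ε / 4)) * (14 * L ^ (1 / 2 + δ - ε / 2)) := by
          gcongr <;> linarith
      _ = 28 * (L ^ (ε / 4) * L ^ (1 / 2 + δ - ε / 2)) := by ring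
      _ = _ := by rw [← Real.rpow_add h0]; ring_nf
  have h6 : 0 < L ^ (1 / 2 + δ) := by positivity
  nlinarith

/-- Growth conditions on `L = log log T` under which the parameters are compatible. -/
structure Large (δ ε C L : ℝ) : Prop where
  four_le : 4 ≤ L
  n_bound : 960 * L ^ (1 / 2 - ε) ≤ Real.exp (1 * L)
  W_bound : 2 * L ^ (0 : ℝ) ≤ L ^ (1 / 2 + δ - ε / 2)
  J_bound : 2 * L ^ (ε / 4) ≤ L ^ (1 : ℝ)
  node_bound : 12 * L ^ (1 / 2 + δ - ε / 2) ≤ Real.exp (1 / 2 * L)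
  Y_bound : 80 * L ^ (δ + 2) ≤ Real.exp (1 * L)
  gap_bound : 1280 * L ^ (2 * δ + 5) ≤ (3 / 2 : ℝ) ^ ⌊L ^ (ε / 4)⌋₊
  tall_bound : 1 * L ^ (δ + 3) ≤ Real.exp (1 * L)
  R_bound : 96 * L ^ (δ + 1) ≤ L ^ (1 + 3 * δ / 2)
  U_sq_bound : 96 * L ^ (0 : ℝ) ≤ L ^ (δ + 3)
  U_bound : (C + 10) * L ^ (1 : ℝ) ≤ L ^ (δ + 3)
  saving_bound : 12 * L ^ δ ≤ L ^ (δ + ε / 2)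
  saving_bound' : 5 * L ^ (δ + 1) ≤ L ^ (δ + 2)

theorem eventually_large {δ ε : ℝ} (C : ℝ) (hδ : 0 < δ) (hε : 0 < ε) (hε1 : ε ≤ 1 / 2) :
    ∀ᶠ L : ℝ in atTop, Large δ ε C L := by
  filter_upwards [eventually_ge_atTop 4, eventually_mul_rpow_le_exp (1 / 2 - ε) 960 one_pos,
    eventually_mul_rpow_le (by linarith : (0:ℝ) < 1 / 2 + δ - ε / 2) 2,
    eventually_mul_rpow_le (by linarith : ε / 4 < 1) 2,
    eventually_mul_rpow_le_exp (1 / 2 + δ - ε / 2) 12 one_half_pos,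
    eventually_mul_rpow_le_exp (δ + 2) 80 one_pos,
    eventually_mul_rpow_le_pow_floor (2 * δ + 5) 1280 (by linarith : 0 < ε / 4),
    eventually_mul_rpow_le_exp (δ + 3) 1 one_pos,
    eventually_mul_rpow_le (by linarith : δ + 1 < 1 + 3 * δ / 2) 96,
    eventually_mul_rpow_le (by linarith : (0:ℝ) < δ + 3) 96,
    eventually_mul_rpow_le (by linarith : (1:ℝ) < δ + 3) (C + 10),
    eventually_mul_rpow_le (by linarith : δ < δ + ε / 2) 12,
    eventually_mul_rpow_le (by linarith : δ + 1 < δ + 2) 5] with L h1 h2 h3 h4 h5 h6 h7 h8 h9 h10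
      h11 h12 h13
  exact ⟨h1, h2, h3, h4, h5, h6, h7, h8, h9, h10, h11, h12, h13⟩

set_option maxHeartbeats 1000000 in
/-- The parameters used for `T` with `log log T = L`. -/
theorem Large.argParams {δ ε C T L : ℝ} (hδ : 0 < δ) (hε : 0 < ε) (hε1 : ε ≤ 1 / 2)
    (hεδ : 2 * ε ≤ δ) (hC0 : 0 ≤ C)
    (hC : ∀ (Y : ℕ) (s : ℂ), 1 / 2 ≤ s.re →
      ‖eulerLog Y s - (primeSum Y s + primeSum Y (2 * s) / 2)‖ ≤ C)
    (hL : Real.log (Real.log T) = L) (h : Large δ ε C L)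
    (hwin : ∀ n : ℕ, 1 ≤ n → 480 * (n:ℝ) ≤ Real.log T →
      WindowParams T (T ^ (7 / 8 : ℝ)) n ⌊T ^ (3 / 4 : ℝ)⌋₊)
    (hT1 : Real.log T + 1 ≤ T ^ (7 / 8 : ℝ)) (hT2 : 2 * T ^ (1 / 2 : ℝ) ≤ T ^ (7 / 8 : ℝ))
    (hT3 : 480 ≤ Real.log T) (hT4 : 0 < T) :
    ArgParams T (T ^ (7 / 8 : ℝ)) ⌈L ^ (1 / 2 - ε)⌉₊ ⌊T ^ (3 / 4 : ℝ)⌋₊ ⌊L ^ (ε / 4)⌋₊ ⌈L ^ δ⌉₊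
      ⌈L ^ (δ + 2)⌉₊ (eulerLength (Real.log T) ⌈L ^ (δ + 2)⌉₊)
      (L ^ (1 / 2 + δ - ε / 2) / Real.log T) (L ^ (1 / 2 + δ - ε / 2)) (L ^ (δ + 3))
      (8 * (L + 4)) (L ^ (1 / 2 + 3 * δ / 4)) C (L ^ δ) := by
  obtain ⟨h1, hn, hW, hJ, hnode, hY, hgap, htall, hR, hUsq, hU, hs, hs'⟩ := h
  have hL0 : 0 < L := by linarith
  have hL1 : 1 ≤ L := by linarith
  have hexp : Real.exp L = Real.log T := by rw [← hL, Real.exp_log (by linarith)]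
  set l := Real.log T with hl
  have hl0 : 0 < l := by linarith
  simp only [one_mul, Real.rpow_zero, mul_one, Real.rpow_one] at hn hW hJ hY htall hUsq hU
  rw [hexp] at hn hY htall
  set n := ⌈L ^ (1 / 2 - ε)⌉₊ with hndef
  set J := ⌊L ^ (ε / 4)⌋₊ with hJdef
  set j₁ := ⌈L ^ δ⌉₊ with hj₁def
  set j₂ := ⌈L ^ (δ + 2)⌉₊ with hj₂def
  set W := L ^ (1 / 2 + δ - ε / 2) with hWdef
  set U := L ^ (δ + 3) with hUdef
  have hn1 : L ^ (1 / 2 - ε) ≤ n := Nat.le_ceil _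
  have hn2 : (n:ℝ) ≤ 2 * L ^ (1 / 2 - ε) := ceil_rpow_le_two_mul hL1 (by linarith)
  have hn3 : 1 ≤ n := one_le_ceil_rpow hL0
  have hn4 : (1:ℝ) ≤ n := by exact_mod_cast hn3
  have hj₁a : L ^ δ ≤ j₁ := Nat.le_ceil _
  have hj₁b : (j₁:ℝ) ≤ 2 * L ^ δ := ceil_rpow_le_two_mul hL1 hδ.le
  have hj₂a : L ^ (δ + 2) ≤ j₂ := Nat.le_ceil _
  have hj₂b : (j₂:ℝ) ≤ 2 * L ^ (δ + 2) := ceil_rpow_le_two_mul hL1 (by linarith)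
  have hj₂c : 1 ≤ j₂ := one_le_ceil_rpow hL0
  have hj₂d : (0:ℝ) < j₂ := by exact_mod_cast hj₂c
  have hJ1 : (J:ℝ) ≤ L ^ (ε / 4) := Nat.floor_le (by positivity)
  have hJ2 : L ^ (ε / 4) ≤ L ^ δ := Real.rpow_le_rpow_of_exponent_le hL1 (by linarith)
  have hδ1 : L ≤ L ^ (δ + 1) := by
    calc L = L ^ (1:ℝ) := (Real.rpow_one L).symm
      _ ≤ _ := Real.rpow_le_rpow_of_exponent_le hL1 (by linarith)
  have hδ2 : L ^ δ ≤ L ^ (δ + 1) := Real.rpow_le_rpow_of_exponent_le hL1 (by linarith)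
  have hpow2 : 0 < L ^ (δ + 2) := by positivity
  have hratio : l / (8 * L ^ (δ + 2)) ≤ l / (2 * j₂) - 1 := by
    have e1 : l / (8 * L ^ (δ + 2)) ≤ l / (4 * j₂) :=
      div_le_div_of_nonneg_left hl0.le (by positivity) (by linarith)
    have e2 : 1 ≤ l / (4 * j₂) := by rw [le_div_iff₀ (by positivity)]; linarith
    have e3 : l / (2 * j₂) = l / (4 * j₂) + l / (4 * j₂) := by field_simp; norm_num
    linarith
  have h20 : 20 ≤ l / (2 * j₂) := by rw [le_div_iff₀ (by positivity)]; linarith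
  set Y := eulerLength l j₂ with hYdef
  have hY1 : Real.exp (l / (2 * j₂) - 1) ≤ Y := exp_le_eulerLength h20
  have hY14 : Real.exp 14 ≤ Y := le_trans (by gcongr; linarith) hY1
  have hYpos : (0:ℝ) < Y := (Real.exp_pos _).trans_le hY14
  have hlogY : l / (8 * L ^ (δ + 2)) ≤ Real.log Y :=
    hratio.trans ((Real.le_log_iff_exp_le hYpos).2 hY1)
  have hlogY2 : Real.log Y ≤ l := by
    rw [Real.log_le_iff_le_exp hYpos]
    refine (eulerLength_le l j₂).trans ?_
    gcongr
    refine div_le_self hl0.le ?_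
    have : (1:ℝ) ≤ j₂ := by exact_mod_cast hj₂c
    linarith
  have hlogY3 : 14 ≤ Real.log Y := (Real.le_log_iff_exp_le hYpos).2 hY14
  have hLn : L / n ^ 2 ≤ L ^ δ := by
    rw [div_le_iff₀ (by positivity)]
    calc L = L ^ (2 * ε) * (L ^ (1 / 2 - ε)) ^ 2 := by
          rw [← Real.rpow_natCast, ← Real.rpow_mul hL0.le, ← Real.rpow_add hL0]
          norm_num
          rw [show 2 * ε + (1 / 2 - ε) * 2 = 1 by ring, Real.rpow_one]
      _ ≤ L ^ δ * (n:ℝ) ^ 2 := by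
          gcongr
  have he3 : Real.exp 1 ≤ 3 := by linarith [Real.exp_one_lt_d9]
  have hQ16 : 8 * (L + 4) ≤ 16 * L := by linarith
  have hmul : ∀ a b : ℝ, L ^ a * L ^ b = L ^ (a + b) := fun a b => (Real.rpow_add hL0 a b).symm
  have hUmul : U = L ^ (δ + 2) * L := by
    rw [hUdef, show δ + 3 = (δ + 2) + 1 by ring, Real.rpow_add_one hL0.ne']
  refine
    { hwin n hn3 (by linarith) with
      two_le_W := hW
      x₀_mul_log := div_mul_cancel₀ _ hl0.ne'
      node_le := ?_
      one_le_j₁ := one_le_ceil_rpow hL0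
      j₁_le_j₂ := Nat.ceil_le_ceil (Real.rpow_le_rpow_of_exponent_le hL1 (by linarith))
      pow_le := ?_
      exp_le_Y := hY14
      sum_le := ?_
      R_pos := by positivity
      R_sq := ?_
      U_sq := ?_
      U_ge := by linarith [le_mul_of_one_le_right hC0 hL1]
      gap := ?_
      tall := by
        have : 480 * l ≤ l ^ 2 := by rw [sq]; gcongr
        linarith
      log_le_D := hT1
      C_nonneg := hC0
      eulerLog_le := fun s hs => hC Y s hs
      saving_W := ?_
      saving_U := ?_
      saving_j₂ := by rw [hL]; linarith
      saving_j₁ := hj₁a }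
  · have e1 : (3 / 2 : ℝ) ^ J ≤ Real.exp (1 / 2 * L) := by
      calc (3 / 2 : ℝ) ^ J ≤ Real.exp 1 ^ J := by
            gcongr; linarith [Real.exp_one_gt_d9]
        _ = Real.exp J := by rw [← Real.exp_nat_mul, mul_one]
        _ ≤ _ := by gcongr; linarith
    have e2 : Real.exp (1 / 2 * L) * Real.exp (1 / 2 * L) = l := by
      rw [← Real.exp_add, ← hexp]; ring_nf
    have e3 := Real.add_one_le_exp (1 / 2 * L)
    unfold nodeDist
    rw [← mul_comm ((3 / 2 : ℝ) ^ J), ← add_mul, ← mul_div_assoc, div_le_iff₀ hl0]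
    have e4 : (3 / 2 : ℝ) ^ J + 5 ≤ 6 * Real.exp (1 / 2 * L) := by linarith
    calc ((3 / 2 : ℝ) ^ J + 5) * W ≤ 6 * Real.exp (1 / 2 * L) * W := by gcongr
      _ = 1 / 2 * (Real.exp (1 / 2 * L) * (12 * W)) := by ring
      _ ≤ 1 / 2 * (Real.exp (1 / 2 * L) * Real.exp (1 / 2 * L)) := by gcongr
      _ = _ := by rw [e2]
  · refine le_trans ?_ hT2
    have := eulerLength_pow_le (l := l) hj₂c
    rw [Real.rpow_def_of_pos hT4, ← hl]
    rw [show l * (1 / 2) = l / 2 by ring]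
    linarith
  · have hY3 : 3 ≤ Y := by
      have : (3:ℝ) ≤ Y := by linarith [Real.add_one_le_exp (14:ℝ)]
      exact_mod_cast this
    refine (sum_prime_inv_le hY3).trans ?_
    rw [← hL]
    gcongr
  · have e1 : (L ^ (1 / 2 + 3 * δ / 4)) ^ 2 = L ^ (1 + 3 * δ / 2) := by
      rw [← Real.rpow_natCast, ← Real.rpow_mul hL0.le]; congr 1; push_cast; ring
    rw [e1]
    refine le_trans ?_ hR
    calc Real.exp 1 * j₁ * (8 * (L + 4)) ≤ 3 * (2 * L ^ δ) * (16 * L) := by gcongr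
      _ = 96 * L ^ (δ + 1) := by rw [Real.rpow_add_one hL0.ne']; ring
  · calc Real.exp 1 * j₂ * (8 * (L + 4)) ≤ 3 * (2 * L ^ (δ + 2)) * (16 * L) := by gcongr
      _ = 96 * U := by rw [hUmul]; ring
      _ ≤ U ^ 2 := by rw [sq]; gcongr
  · have e0 : 10 * U ≤ nodeDist (W / l) J * Real.log Y / 16 := by
      calc 10 * U = 1280 * L ^ (2 * δ + 5) / (128 * L ^ (δ + 2)) := by
            have e1 : L ^ (2 * δ + 5) = U * L ^ (δ + 2) := by rw [hUdef, hmul]; ring_nf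
            rw [e1, eq_div_iff (by positivity)]
            ring
        _ ≤ (W * (3 / 2 : ℝ) ^ J) / (128 * L ^ (δ + 2)) := by
            refine div_le_div_of_nonneg_right ?_ (by positivity)
            exact hgap.trans (le_mul_of_one_le_left (by positivity) (one_le_two.trans hW))
        _ = (W / l * (3 / 2 : ℝ) ^ J) * (l / (8 * L ^ (δ + 2))) / 16 := by
            field_simp; norm_num
        _ ≤ _ := by unfold nodeDist; gcongr
    linarith
  · rw [hL]
    have e1 : L ^ (δ + ε / 2) / 4 ≤ W / (2 * n) := by
      rw [div_le_div_iff₀ (by norm_num) (by positivity)]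
      calc L ^ (δ + ε / 2) * (2 * n) ≤ L ^ (δ + ε / 2) * (2 * (2 * L ^ (1 / 2 - ε))) := by gcongr
        _ = (L ^ (δ + ε / 2) * L ^ (1 / 2 - ε)) * 4 := by ring
        _ = W * 4 := by rw [hmul, hWdef]; ring_nf
    linarith
  · rw [hL]
    have e1 : L ^ (δ + 2) ≤ 2 * U / n := by
      rw [le_div_iff₀ (by positivity)]
      have e2 : L ^ (1 / 2 - ε) ≤ L := by
        calc _ ≤ L ^ (1:ℝ) := Real.rpow_le_rpow_of_exponent_le hL1 (by linarith)
          _ = L := Real.rpow_one L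
      calc L ^ (δ + 2) * n ≤ L ^ (δ + 2) * (2 * L) := by gcongr; linarith
        _ = _ := by rw [hUmul]; ring
    linarith

theorem eventually_volume_window_le {S : ℝ → ℝ} (hS : IsS S) {δ : ℝ} (hδ : 0 < δ) :
    ∀ᶠ T : ℝ in atTop, volume {t : ℝ | t ∈ Icc T (T + T ^ (7 / 8 : ℝ)) ∧
        (Real.log (Real.log T) / 2) ^ (1 / 2 + δ) ≤ |S t|} ≤
      ENNReal.ofReal (T ^ (7 / 8 : ℝ) * Real.exp (202 - Real.log (Real.log T) ^ δ)) := by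
  obtain ⟨C, hC0, hC⟩ := exists_norm_eulerLog_sub_le
  set ε := min δ 1 / 2 with hε
  have hε0 : 0 < ε := by positivity
  have hε1 : ε ≤ 1 / 2 := by rw [hε]; linarith [min_le_right δ 1]
  have hεδ : 2 * ε ≤ δ := by rw [hε]; linarith [min_le_left δ 1]
  have hlogT : ∀ᶠ T : ℝ in atTop, Real.log T ≤ 1 / 2 * T ^ (7 / 8 : ℝ) := by
    filter_upwards [(isLittleO_log_rpow_atTop (by norm_num : (0:ℝ) < 7 / 8)).bound
      (by norm_num : (0:ℝ) < 1 / 2), eventually_ge_atTop 1] with T h1 h2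
    rwa [Real.norm_of_nonneg (Real.log_nonneg h2), Real.norm_of_nonneg (by positivity)] at h1
  filter_upwards [eventually_windowParams, hlogT,
    tendsto_log_log_atTop.eventually (eventually_large C hδ hε0 hε1),
    tendsto_log_log_atTop.eventually (eventually_sum_lt_half_rpow (C := C) hδ hε0 hε1),
    eventually_mul_rpow_le (by norm_num : (1 / 2 : ℝ) < 7 / 8) 2,
    Real.tendsto_log_atTop.eventually_ge_atTop 480, eventually_gt_atTop 0] with T h1 h2 h3 h4 h5
      h6 h7
  have hp := h3.argParams hδ hε0 hε1 hεδ hC0 hC rfl h1 (by linarith) h5 h6 h7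
  refine le_trans (measure_mono ?_) (hp.volume_large_le hS)
  rintro t ⟨ht, hle⟩
  exact ⟨ht, h4.trans_le hle⟩

theorem log_log_two_mul_le {T T₀ : ℝ} (hT : 2 ≤ T) (hL : 1 ≤ Real.log (Real.log T)) (h1 : T ≤ T₀)
    (h2 : T₀ ≤ 2 * T) : Real.log (Real.log T₀) ≤ 2 * Real.log (Real.log T) := by
  have hlog : 0 < Real.log T := Real.log_pos (by linarith)
  have h3 : Real.log T₀ ≤ 2 * Real.log T := by
    calc Real.log T₀ ≤ Real.log (2 * T) := Real.log_le_log (by linarith) h2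
      _ = Real.log 2 + Real.log T := Real.log_mul (by norm_num) (by linarith)
      _ ≤ _ := by linarith [Real.log_le_log two_pos hT]
  have h0 : 0 < Real.log T₀ := Real.log_pos (by linarith)
  calc Real.log (Real.log T₀) ≤ Real.log (2 * Real.log T) := Real.log_le_log h0 h3
    _ = Real.log 2 + Real.log (Real.log T) := Real.log_mul (by norm_num) hlog.ne'
    _ ≤ _ := by linarith [Real.log_two_lt_d9]

theorem Icc_subset_iUnion_windows {T D : ℝ} (hD : 0 < D) :
    Icc T (2 * T) ⊆ ⋃ k ∈ Finset.range (⌊T / D⌋₊ + 1), Icc (T + k * D) (T + k * D + D) := by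
  rintro t ⟨h1, h2⟩
  simp only [mem_iUnion, Finset.mem_range]
  have h0 : 0 ≤ (t - T) / D := div_nonneg (by linarith) hD.le
  refine ⟨⌊(t - T) / D⌋₊, Nat.lt_succ_of_le (Nat.floor_le_floor ?_), ?_, ?_⟩
  · gcongr; linarith
  · have := Nat.floor_le h0
    rw [le_div_iff₀ hD] at this
    linarith
  · have := (Nat.lt_floor_add_one ((t - T) / D)).le
    rw [div_le_iff₀ hD] at this
    linarith

theorem eventually_volume_dyadic_le {S : ℝ → ℝ} (hS : IsS S) {δ : ℝ} (hδ : 0 < δ) :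
    ∀ᶠ T : ℝ in atTop, volume {t : ℝ | t ∈ Icc T (2 * T) ∧
        Real.log (Real.log T) ^ (1 / 2 + δ) ≤ |S t|} ≤
      ENNReal.ofReal (4 * Real.exp 202 * T * Real.exp (-Real.log (Real.log T) ^ δ)) := by
  filter_upwards [eventually_forall_ge_atTop.2 (eventually_volume_window_le hS hδ),
    eventually_ge_atTop 2, tendsto_log_log_atTop.eventually_ge_atTop 1] with T hwin hT hL
  have hT0 : 0 < T := by linarith
  set D := T ^ (7 / 8 : ℝ) with hDdef
  have hD : 0 < D := by positivity
  have hDT : D ≤ T := by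
    calc D ≤ T ^ (1:ℝ) := Real.rpow_le_rpow_of_exponent_le (by linarith) (by norm_num)
      _ = T := Real.rpow_one T
  set L := Real.log (Real.log T) with hLdef
  have hlog : 0 < Real.log T := Real.log_pos (by linarith)
  have hcover : {t : ℝ | t ∈ Icc T (2 * T) ∧ L ^ (1 / 2 + δ) ≤ |S t|} ⊆
      ⋃ k ∈ Finset.range (⌊T / D⌋₊ + 1),
        {t : ℝ | t ∈ Icc (T + k * D) (T + k * D + D) ∧ L ^ (1 / 2 + δ) ≤ |S t|} := by
    rintro t ⟨ht, hle⟩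
    have := Icc_subset_iUnion_windows hD ht
    simp only [mem_iUnion] at this ⊢
    obtain ⟨k, hk, hkt⟩ := this
    exact ⟨k, hk, hkt, hle⟩
  have hpiece : ∀ k ∈ Finset.range (⌊T / D⌋₊ + 1),
      volume {t : ℝ | t ∈ Icc (T + k * D) (T + k * D + D) ∧ L ^ (1 / 2 + δ) ≤ |S t|} ≤
        ENNReal.ofReal (2 * D * Real.exp (202 - L ^ δ)) := by
    intro k hk
    have hk1 : k ≤ ⌊T / D⌋₊ := by rw [Finset.mem_range] at hk; omega
    have hk2 : (k : ℝ) * D ≤ T := by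
      rw [← le_div_iff₀ hD]
      exact (Nat.le_floor_iff (by positivity)).1 hk1
    set T₀ := T + k * D with hT₀
    have h1 : T ≤ T₀ := by rw [hT₀]; linarith [show 0 ≤ (k : ℝ) * D by positivity]
    have h2 : T₀ ≤ 2 * T := by linarith
    have hLL : Real.log (Real.log T₀) ≤ 2 * L := log_log_two_mul_le hT hL h1 h2
    have hLL' : L ≤ Real.log (Real.log T₀) := by
      rw [hLdef]; gcongr
    refine le_trans (measure_mono ?_) ((hwin T₀ h1).trans (ENNReal.ofReal_le_ofReal ?_))
    · rintro t ⟨⟨h3, h4⟩, h5⟩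
      refine ⟨⟨h3, h4.trans ?_⟩, le_trans ?_ h5⟩
      · rw [hDdef]; gcongr
      · gcongr
        · linarith
        · linarith
    · have h8 : T₀ ^ (7 / 8 : ℝ) ≤ 2 * D := by
        calc T₀ ^ (7 / 8 : ℝ) ≤ (2 * T) ^ (7 / 8 : ℝ) := by gcongr
          _ = 2 ^ (7 / 8 : ℝ) * D := Real.mul_rpow (by norm_num) hT0.le
          _ ≤ 2 ^ (1 : ℝ) * D := by gcongr <;> norm_num
          _ = 2 * D := by rw [Real.rpow_one]
      gcongr
  refine (measure_mono hcover).trans ((measure_biUnion_finset_le _ _).trans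
    ((Finset.sum_le_sum hpiece).trans ?_))
  rw [Finset.sum_const, Finset.card_range, nsmul_eq_mul, ← ENNReal.ofReal_natCast,
    ← ENNReal.ofReal_mul (by positivity)]
  apply ENNReal.ofReal_le_ofReal
  have hcount : ((⌊T / D⌋₊ + 1 : ℕ) : ℝ) ≤ 2 * T / D := by
    push_cast
    have h1 := Nat.floor_le (show 0 ≤ T / D by positivity)
    have h2 : 1 ≤ T / D := by rwa [one_le_div hD]
    rw [mul_div_assoc]
    linarith
  calc _ ≤ 2 * T / D * (2 * D * Real.exp (202 - L ^ δ)) := by gcongr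
    _ = 4 * T * Real.exp (202 - L ^ δ) := by field_simp; ring
    _ = _ := by rw [sub_eq_add_neg, Real.exp_add]; ring

theorem one_lt_log_of_three_le {T : ℝ} (hT : 3 ≤ T) : 1 < Real.log T := by
  rw [Real.lt_log_iff_exp_lt (by linarith)]
  linarith [Real.exp_one_lt_d9]

theorem exists_volume_dyadic_le {S : ℝ → ℝ} (hS : IsS S) {δ : ℝ} (hδ : 0 < δ) :
    ∃ K : ℝ, 0 ≤ K ∧ ∀ T : ℝ, 3 ≤ T → (volume {t : ℝ | t ∈ Icc T (2 * T) ∧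
        Real.log (Real.log T) ^ (1 / 2 + δ) ≤ |S t|}).toReal ≤
      K * T * Real.exp (-Real.log (Real.log T) ^ δ) := by
  obtain ⟨T₁, hT₁⟩ := eventually_atTop.1 (eventually_volume_dyadic_le hS hδ)
  set K := max (4 * Real.exp 202) (Real.exp (Real.log (Real.log T₁) ^ δ)) with hK
  have hK0 : 0 ≤ K := le_max_of_le_left (by positivity)
  refine ⟨K, hK0, fun T hT => ENNReal.toReal_le_of_le_ofReal (by positivity) ?_⟩
  rcases le_total T₁ T with h | h
  · refine (hT₁ T h).trans (ENNReal.ofReal_le_ofReal ?_)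
    gcongr
    exact le_max_left _ _
  · have h1 := one_lt_log_of_three_le hT
    have h2 : 0 ≤ Real.log (Real.log T) := Real.log_nonneg h1.le
    have h3 : Real.log (Real.log T) ≤ Real.log (Real.log T₁) := by
      gcongr
    refine (measure_mono (t := Icc T (2 * T)) fun t ht => ht.1).trans ?_
    rw [Real.volume_Icc]
    apply ENNReal.ofReal_le_ofReal
    have h4 : 1 ≤ K * Real.exp (-Real.log (Real.log T) ^ δ) := by
      calc (1:ℝ) = Real.exp (Real.log (Real.log T) ^ δ) *
            Real.exp (-Real.log (Real.log T) ^ δ) := by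
            rw [← Real.exp_add, add_neg_cancel, Real.exp_zero]
        _ ≤ K * Real.exp (-Real.log (Real.log T) ^ δ) := by
            gcongr
            refine le_trans ?_ (le_max_right _ _)
            gcongr
    nlinarith

theorem mul_sub_rpow_le {δ C L : ℝ} (hδ : 1 < δ) (hC : 0 < C) (hL : 0 ≤ L) :
    C * L - L ^ δ ≤ C * C ^ (1 / (δ - 1)) := by
  have hd : 0 < δ - 1 := by linarith
  rcases le_total L (C ^ (1 / (δ - 1))) with h | h
  · have : C * L ≤ C * C ^ (1 / (δ - 1)) := by gcongr
    linarith [Real.rpow_nonneg hL δ]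
  · have hL0 : 0 < L := lt_of_lt_of_le (by positivity) h
    have h1 : C ≤ L ^ (δ - 1) := by
      calc C = (C ^ (1 / (δ - 1))) ^ (δ - 1) := by
            rw [← Real.rpow_mul hC.le, one_div_mul_cancel hd.ne', Real.rpow_one]
        _ ≤ L ^ (δ - 1) := by gcongr
    have h2 : L ^ δ = L ^ (δ - 1) * L := by
      rw [← Real.rpow_add_one hL0.ne', sub_add_cancel]
    have h3 : C * L ≤ L ^ (δ - 1) * L := by gcongr
    have h4 : 0 ≤ C * C ^ (1 / (δ - 1)) := by positivity
    linarith

theorem statement14 (S : ℝ → ℝ) (hS : IsS S) :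
    ∀ δ : ℝ, 0 < δ →
      (∃ A : ℝ, 0 < A ∧ ∃ K : ℝ, ∀ T : ℝ, 3 ≤ T →
        (volume {t : ℝ | t ∈ Icc T (2 * T) ∧
            (Real.log (Real.log T)) ^ (1/2 + δ : ℝ) ≤ |S t|}).toReal ≤
          K * T * Real.exp (-A * (Real.log (Real.log T)) ^ δ)) ∧
      (1 < δ → ∀ C₁ : ℝ, 0 < C₁ → ∃ K : ℝ, ∀ T : ℝ, 3 ≤ T →
        (volume {t : ℝ | t ∈ Icc T (2 * T) ∧
            (Real.log (Real.log T)) ^ (1/2 + δ : ℝ) ≤ |S t|}).toReal ≤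
          K * T * (Real.log T) ^ (-C₁)) := by
  intro δ hδ
  obtain ⟨K, hK, hmain⟩ := exists_volume_dyadic_le hS hδ
  refine ⟨⟨1, one_pos, K, fun T hT => ?_⟩, fun hδ1 C₁ hC₁ =>
    ⟨K * Real.exp (C₁ * C₁ ^ (1 / (δ - 1))), fun T hT => (hmain T hT).trans ?_⟩⟩
  · rw [neg_one_mul]
    exact hmain T hT
  · have h1 := one_lt_log_of_three_le hT
    have h2 := mul_sub_rpow_le hδ1 hC₁ (Real.log_nonneg h1.le)
    rw [Real.rpow_def_of_pos (by linarith : 0 < Real.log T)]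
    calc K * T * Real.exp (-Real.log (Real.log T) ^ δ) ≤
        K * T * Real.exp (C₁ * C₁ ^ (1 / (δ - 1)) + Real.log (Real.log T) * -C₁) := by
          gcongr
          linarith
      _ = _ := by rw [Real.exp_add]; ring
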